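/- arXiv:1702.03403 — 5 statements merged into one kernel-verified Lean document; each statement's English description precedes it below -/
import Mathlib

section
/- Let p ≥ 7 be a prime and d ≥ 3 an integer. Then every sequence of ((p^d − p)/(p^2 − p))·(3p − 7) + 4 elements of (ℤ/pℤ)^d contains a nonempty zero-sum subsequence of length at most p; that is, η((ℤ/pℤ)^d) ≤ ((p^d − p)/(p^2 − p))·(3p − 7) + 4. -/
section Algebra
variable {k : Type*} [Field k]

lemma cubic_form_value {t₁ t₂ t₃ s₁ s₂ s₃ α β γ δ n n' M : k}
    (h23 : t₂ ≠ t₃) (hs₂ : s₂ ≠ 0) (hs₃ : s₃ ≠ 0)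
    (A23 : α * t₂ * t₃ + β * (t₂ + t₃) + γ = s₂ * s₃)
    (A13 : α * t₁ * t₃ + β * (t₁ + t₃) + γ = s₁ * s₃)
    (A12 : α * t₁ * t₂ + β * (t₁ + t₂) + γ = s₁ * s₂)
    (A123 : α * t₁ * t₂ * t₃ + β * (t₁ * t₂ + t₁ * t₃ + t₂ * t₃) + γ * (t₁ + t₂ + t₃) + δ
      = s₁ * s₂ * s₃)
    (hM : (t₂ - t₃) * M = s₂ - s₃)
    (N1 : n * t₁ + n' = 3 * s₁ - (α * t₁ + β)
      - (α * t₁ * t₂ ^ 2 + β * (t₂ ^ 2 + 2 * t₁ * t₂) + γ * (t₁ + 2 * t₂) + δ) / s₂ ^ 2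
      - (α * t₁ * t₃ ^ 2 + β * (t₃ ^ 2 + 2 * t₁ * t₃) + γ * (t₁ + 2 * t₃) + δ) / s₃ ^ 2) :
    (n * t₁ + n') * (s₂ * s₃) = s₁ * (1 - M) * (s₂ * s₃ + (t₂ - t₃) ^ 2 * M) := by
  have hx : t₂ - t₃ ≠ 0 := sub_ne_zero.2 h23
  have e1 : α * t₁ + β = s₁ * M := by
    apply mul_left_cancel₀ hx
    linear_combination A12 - A13 - s₁ * hM
  have e2 : α * t₁ * t₂ ^ 2 + β * (t₂ ^ 2 + 2 * t₁ * t₂) + γ * (t₁ + 2 * t₂) + δ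
      = s₁ * s₂ * (s₃ + t₂ - t₃) := by
    linear_combination A123 + (t₂ - t₃) * A12
  have e3 : α * t₁ * t₃ ^ 2 + β * (t₃ ^ 2 + 2 * t₁ * t₃) + γ * (t₁ + 2 * t₃) + δ
      = s₁ * s₃ * (s₂ + t₃ - t₂) := by
    linear_combination A123 + (t₃ - t₂) * A13
  rw [e1, e2, e3] at N1
  rw [N1]
  field_simp
  obtain rfl : s₂ = s₃ + (t₂ - t₃) * M := by linear_combination -hM
  ring

lemma leading_value {t₁ t₂ t₃ s₁ s₂ s₃ α β γ n : k}
    (h12 : t₁ ≠ t₂) (h13 : t₁ ≠ t₃) (h23 : t₂ ≠ t₃)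
    (hs₁ : s₁ ≠ 0) (hs₂ : s₂ ≠ 0) (hs₃ : s₃ ≠ 0)
    (A23 : α * t₂ * t₃ + β * (t₂ + t₃) + γ = s₂ * s₃)
    (A13 : α * t₁ * t₃ + β * (t₁ + t₃) + γ = s₁ * s₃)
    (A12 : α * t₁ * t₂ + β * (t₁ + t₂) + γ = s₁ * s₂)
    (N11 : n = 3 - (α * t₁ ^ 2 + 2 * β * t₁ + γ) / s₁ ^ 2
      - (α * t₂ ^ 2 + 2 * β * t₂ + γ) / s₂ ^ 2 - (α * t₃ ^ 2 + 2 * β * t₃ + γ) / s₃ ^ 2) :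
    n * ((t₂ - t₃) * (t₃ - t₁) * (t₁ - t₂) * (s₁ * s₂ * s₃)) =
      ((t₂ - t₃) * s₁ + (t₃ - t₁) * s₂ + (t₁ - t₂) * s₃) *
      (s₂ * s₃ * (t₃ - t₁) * (t₁ - t₂) + s₃ * s₁ * (t₂ - t₃) * (t₁ - t₂)
        + s₁ * s₂ * (t₂ - t₃) * (t₃ - t₁)) := by
  have hx : t₂ - t₃ ≠ 0 := sub_ne_zero.2 h23
  have hy : t₃ - t₁ ≠ 0 := sub_ne_zero.2 h13.symm
  have hz : t₁ - t₂ ≠ 0 := sub_ne_zero.2 h12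
  have e1 : (α * t₁ ^ 2 + 2 * β * t₁ + γ) = s₁ * (s₂ + (t₁ - t₂) * ((s₂ - s₃) / (t₂ - t₃))) := by
    field_simp
    linear_combination (t₂ - t₃) * A12 + (t₁ - t₂) * (A12 - A13)
  have e2 : (α * t₂ ^ 2 + 2 * β * t₂ + γ) = s₂ * (s₃ + (t₂ - t₃) * ((s₃ - s₁) / (t₃ - t₁))) := by
    field_simp
    linear_combination (t₃ - t₁) * A23 + (t₂ - t₃) * (A23 - A12)
  have e3 : (α * t₃ ^ 2 + 2 * β * t₃ + γ) = s₃ * (s₁ + (t₃ - t₁) * ((s₁ - s₂) / (t₁ - t₂))) := by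
    field_simp
    linear_combination (t₁ - t₂) * A13 + (t₃ - t₁) * (A13 - A23)
  rw [e1, e2, e3] at N11
  rw [N11]
  field_simp
  ring

lemma pair_relation {t₁ t₂ t₃ s₁ s₂ s₃ n n' n'' c M : k}
    (h23 : t₂ ≠ t₃) (hs₁ : s₁ ≠ 0)
    (hM : (t₂ - t₃) * M = s₂ - s₃)
    (hf : (n * t₁ + n') * (s₂ * s₃) = s₁ * (1 - M) * (s₂ * s₃ + (t₂ - t₃) ^ 2 * M))
    (N12 : s₃ * (n * t₁ * t₂ + n' * (t₁ + t₂) + n'') = s₁ * s₂ * s₃ - s₁ * s₂ * (t₃ + c))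
    (N13 : s₂ * (n * t₁ * t₃ + n' * (t₁ + t₃) + n'') = s₁ * s₂ * s₃ - s₁ * s₃ * (t₂ + c)) :
    s₂ = s₃ ∨ (t₂ + c) * (s₂ - (t₂ + c)) + (t₃ + c) * (s₃ - (t₃ + c))
      + 2 * (s₂ - (t₂ + c)) * (s₃ - (t₃ + c)) = 0 := by
  have hx : t₂ - t₃ ≠ 0 := sub_ne_zero.2 h23
  have key : (1 - M) * (s₂ * s₃ + (t₂ - t₃) ^ 2 * M) * (t₂ - t₃)
      = s₂ * s₃ * (s₂ - s₃) - s₂ ^ 2 * (t₃ + c) + s₃ ^ 2 * (t₂ + c) := by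
    apply mul_left_cancel₀ hs₁
    linear_combination s₂ * N12 - s₃ * N13 - (t₂ - t₃) * hf
  by_cases hM0 : M = 0
  · left; subst hM0; linear_combination -hM
  · right
    apply mul_left_cancel₀ (mul_ne_zero hM0 hx)
    obtain rfl : s₂ = s₃ + (t₂ - t₃) * M := by linear_combination -hM
    linear_combination -key

lemma collinear_of_one_pair_eq {t₁ t₂ t₃ s₁ s n n' M₂ M₃ : k} (h2 : (2 : k) ≠ 0)
    (h12 : t₁ ≠ t₂) (h13 : t₁ ≠ t₃) (h23 : t₂ ≠ t₃) (hs₁ : s₁ ≠ 0) (hs : s ≠ 0) (hne : s₁ ≠ s)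
    (hM₂ : (t₃ - t₁) * M₂ = s - s₁) (hM₃ : (t₁ - t₂) * M₃ = s₁ - s)
    (hf₂ : (n * t₂ + n') * (s * s₁) = s * (1 - M₂) * (s * s₁ + (t₃ - t₁) ^ 2 * M₂))
    (hf₃ : (n * t₃ + n') * (s₁ * s) = s * (1 - M₃) * (s₁ * s + (t₁ - t₂) ^ 2 * M₃))
    (hn : n * ((t₂ - t₃) * (t₃ - t₁) * (t₁ - t₂) * (s₁ * s * s)) =
      ((t₂ - t₃) * s₁ + (t₃ - t₁) * s + (t₁ - t₂) * s) *
      (s * s * (t₃ - t₁) * (t₁ - t₂) + s * s₁ * (t₂ - t₃) * (t₁ - t₂)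
        + s₁ * s * (t₂ - t₃) * (t₃ - t₁)))
    (P12 : t₁ * (s₁ - t₁) + t₂ * (s - t₂) + 2 * (s₁ - t₁) * (s - t₂) = 0)
    (P13 : t₁ * (s₁ - t₁) + t₃ * (s - t₃) + 2 * (s₁ - t₁) * (s - t₃) = 0) :
    (s₁ = t₁ - t₂ ∧ s = t₃ - t₂) ∨ (s₁ = t₁ - t₃ ∧ s = t₂ - t₃) := by
  have hx : t₂ - t₃ ≠ 0 := sub_ne_zero.2 h23
  have hy : t₃ - t₁ ≠ 0 := sub_ne_zero.2 h13.symm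
  have hz : t₁ - t₂ ≠ 0 := sub_ne_zero.2 h12
  have he : s₁ - s ≠ 0 := sub_ne_zero.2 hne
  have w1 : 2 * (s₁ - t₁) = s - t₂ - t₃ := by
    apply mul_left_cancel₀ hx
    linear_combination P13 - P12
  obtain rfl : M₂ = (s - s₁) / (t₃ - t₁) := by field_simp; linear_combination hM₂
  obtain rfl : M₃ = (s₁ - s) / (t₁ - t₂) := by field_simp; linear_combination hM₃
  have hsq : (s - (t₂ - t₃)) * (s + (t₂ - t₃)) = 0 := by
    have hd : n * (t₂ - t₃) * (s * s₁) = s * (s₁ - s) * (t₂ - t₃)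
        * ((t₃ - t₁) * (t₁ - t₂) - s * s₁) / ((t₃ - t₁) * (t₁ - t₂)) := by
      have : n * (t₂ - t₃) * (s * s₁) = (n * t₂ + n') * (s * s₁) - (n * t₃ + n') * (s₁ * s) := by
        ring
      rw [this, hf₂, hf₃]
      field_simp
      ring
    rw [eq_div_iff (mul_ne_zero hy hz)] at hd
    have h0 : s * (s₁ - s) * (t₂ - t₃) * s₁ ≠ 0 := by simp_all
    apply mul_left_cancel₀ h0
    linear_combination s * hd - hn
  rcases mul_eq_zero.1 hsq with h | h
  · right
    refine ⟨?_, by linear_combination h⟩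
    apply mul_left_cancel₀ h2
    linear_combination w1 + h
  · left
    refine ⟨?_, by linear_combination h⟩
    apply mul_left_cancel₀ h2
    linear_combination w1 + h

lemma cubic_value_of_param {w₁ w₂ w₃ A B C t₁ t₂ t₃ s₁ s₂ s₃ f M : k}
    (hw₁ : w₁ ≠ 0) (hw₂ : w₂ ≠ 0) (hw₃ : w₃ ≠ 0)
    (hA : A = w₁ * w₃ + w₁ * w₂ - w₂ * w₃) (hB : B = w₂ * w₁ + w₂ * w₃ - w₃ * w₁)
    (hC : C = w₃ * w₂ + w₃ * w₁ - w₁ * w₂)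
    (ht₁ : t₁ = -A / w₁) (ht₂ : t₂ = -B / w₂) (ht₃ : t₃ = -C / w₃)
    (e₁ : s₁ = t₁ + w₁) (e₂ : s₂ = t₂ + w₂) (e₃ : s₃ = t₃ + w₃)
    (hs₁ : s₁ ≠ 0) (hs₂ : s₂ ≠ 0) (h23 : t₂ ≠ t₃)
    (hM : (t₂ - t₃) * M = s₂ - s₃)
    (hf : f * (s₂ * s₃) = s₁ * (1 - M) * (s₂ * s₃ + (t₂ - t₃) ^ 2 * M)) :
    A ≠ 0 ∧ f * (w₁ * A) = w₁ ^ 2 * w₂ * w₃ - A ^ 2 := by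
  have hX : t₂ - t₃ = -((w₂ - w₃) * A) / (w₂ * w₃) := by
    rw [ht₂, ht₃, hA, hB, hC]; field_simp; ring
  have f₁ : s₁ = -((w₃ - w₁) * (w₁ - w₂)) / w₁ := by
    rw [e₁, ht₁, hA]; field_simp; ring
  have f₂ : s₂ = -((w₁ - w₂) * (w₂ - w₃)) / w₂ := by
    rw [e₂, ht₂, hB]; field_simp; ring
  have f₃ : s₃ = -((w₂ - w₃) * (w₃ - w₁)) / w₃ := by
    rw [e₃, ht₃, hC]; field_simp; ring
  have hX0 := sub_ne_zero.2 h23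
  have hA0 : A ≠ 0 := by rintro rfl; simp [hX] at hX0
  have g : w₂ - w₃ ≠ 0 := by intro h; simp [f₂, h] at hs₂
  have g₂ : w₃ - w₁ ≠ 0 := by intro h; simp [f₁, h] at hs₁
  have g₃ : w₁ - w₂ ≠ 0 := by intro h; simp [f₁, h] at hs₁
  have hM' : M = (w₁ * w₃ + w₁ * w₂ - 2 * (w₂ * w₃)) / A := by
    apply mul_left_cancel₀ hX0
    rw [hM, hX, f₂, f₃]
    field_simp
    ring
  refine ⟨hA0, ?_⟩
  rw [hM', hX, f₁, f₂, f₃] at hf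
  field_simp at hf
  apply mul_left_cancel₀ (mul_ne_zero hw₂ hw₃)
  rw [hA] at hf ⊢
  linear_combination hf

lemma leading_value_of_param {w₁ w₂ w₃ A B C t₁ t₂ t₃ s₁ s₂ s₃ n : k}
    (hw₁ : w₁ ≠ 0) (hw₂ : w₂ ≠ 0) (hw₃ : w₃ ≠ 0)
    (hA : A = w₁ * w₃ + w₁ * w₂ - w₂ * w₃) (hB : B = w₂ * w₁ + w₂ * w₃ - w₃ * w₁)
    (hC : C = w₃ * w₂ + w₃ * w₁ - w₁ * w₂)
    (ht₁ : t₁ = -A / w₁) (ht₂ : t₂ = -B / w₂) (ht₃ : t₃ = -C / w₃)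
    (e₁ : s₁ = t₁ + w₁) (e₂ : s₂ = t₂ + w₂) (e₃ : s₃ = t₃ + w₃)
    (hs₁ : s₁ ≠ 0) (hs₂ : s₂ ≠ 0)
    (hn : n * ((t₂ - t₃) * (t₃ - t₁) * (t₁ - t₂) * (s₁ * s₂ * s₃)) =
      ((t₂ - t₃) * s₁ + (t₃ - t₁) * s₂ + (t₁ - t₂) * s₃) *
      (s₂ * s₃ * (t₃ - t₁) * (t₁ - t₂) + s₃ * s₁ * (t₂ - t₃) * (t₁ - t₂)
        + s₁ * s₂ * (t₂ - t₃) * (t₃ - t₁))) :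
    w₁ - w₂ ≠ 0 ∧ n * (A * B * C) = (A + B + C) * (A * B + B * C + C * A) := by
  have hX : t₂ - t₃ = -((w₂ - w₃) * A) / (w₂ * w₃) := by
    rw [ht₂, ht₃, hA, hB, hC]; field_simp; ring
  have hY : t₃ - t₁ = -((w₃ - w₁) * B) / (w₃ * w₁) := by
    rw [ht₁, ht₃, hA, hB, hC]; field_simp; ring
  have hZ : t₁ - t₂ = -((w₁ - w₂) * C) / (w₁ * w₂) := by
    rw [ht₂, ht₁, hA, hB, hC]; field_simp; ring
  have f₁ : s₁ = -((w₃ - w₁) * (w₁ - w₂)) / w₁ := by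
    rw [e₁, ht₁, hA]; field_simp; ring
  have f₂ : s₂ = -((w₁ - w₂) * (w₂ - w₃)) / w₂ := by
    rw [e₂, ht₂, hB]; field_simp; ring
  have f₃ : s₃ = -((w₂ - w₃) * (w₃ - w₁)) / w₃ := by
    rw [e₃, ht₃, hC]; field_simp; ring
  have g : w₂ - w₃ ≠ 0 := by intro h; simp [f₂, h] at hs₂
  have g₂ : w₃ - w₁ ≠ 0 := by intro h; simp [f₁, h] at hs₁
  have g₃ : w₁ - w₂ ≠ 0 := by intro h; simp [f₁, h] at hs₁
  refine ⟨g₃, ?_⟩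
  rw [hX, hY, hZ, f₁, f₂, f₃] at hn
  generalize w₂ - w₃ = d₁ at *
  generalize w₃ - w₁ = d₂ at *
  generalize w₁ - w₂ = d₃ at *
  field_simp at hn
  linear_combination hn

lemma collinear_of_pairwise_relation {t₁ t₂ t₃ s₁ s₂ s₃ n n' M₁ M₂ M₃ : k}
    (h2 : (2 : k) ≠ 0) (h3 : (3 : k) ≠ 0)
    (h12 : t₁ ≠ t₂) (h13 : t₁ ≠ t₃) (h23 : t₂ ≠ t₃) (hs₁ : s₁ ≠ 0) (hs₂ : s₂ ≠ 0) (hs₃ : s₃ ≠ 0)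
    (hM₁ : (t₂ - t₃) * M₁ = s₂ - s₃)
    (hM₂ : (t₃ - t₁) * M₂ = s₃ - s₁) (hM₃ : (t₁ - t₂) * M₃ = s₁ - s₂)
    (hf₁ : (n * t₁ + n') * (s₂ * s₃) = s₁ * (1 - M₁) * (s₂ * s₃ + (t₂ - t₃) ^ 2 * M₁))
    (hf₂ : (n * t₂ + n') * (s₃ * s₁) = s₂ * (1 - M₂) * (s₃ * s₁ + (t₃ - t₁) ^ 2 * M₂))
    (hf₃ : (n * t₃ + n') * (s₁ * s₂) = s₃ * (1 - M₃) * (s₁ * s₂ + (t₁ - t₂) ^ 2 * M₃))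
    (hn : n * ((t₂ - t₃) * (t₃ - t₁) * (t₁ - t₂) * (s₁ * s₂ * s₃)) =
      ((t₂ - t₃) * s₁ + (t₃ - t₁) * s₂ + (t₁ - t₂) * s₃) *
      (s₂ * s₃ * (t₃ - t₁) * (t₁ - t₂) + s₃ * s₁ * (t₂ - t₃) * (t₁ - t₂)
        + s₁ * s₂ * (t₂ - t₃) * (t₃ - t₁)))
    (P12 : t₁ * (s₁ - t₁) + t₂ * (s₂ - t₂) + 2 * (s₁ - t₁) * (s₂ - t₂) = 0)
    (P13 : t₁ * (s₁ - t₁) + t₃ * (s₃ - t₃) + 2 * (s₁ - t₁) * (s₃ - t₃) = 0)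
    (P23 : t₂ * (s₂ - t₂) + t₃ * (s₃ - t₃) + 2 * (s₂ - t₂) * (s₃ - t₃) = 0) :
    (s₁ - t₁ = s₂ - t₂ ∧ s₁ - t₁ = s₃ - t₃) ∨ (s₂ = t₂ - t₁ ∧ s₃ = t₃ - t₁) ∨
      (s₁ = t₁ - t₂ ∧ s₃ = t₃ - t₂) ∨ (s₁ = t₁ - t₃ ∧ s₂ = t₂ - t₃) := by
  obtain ⟨w₁, e₁⟩ : ∃ w, s₁ = t₁ + w := ⟨s₁ - t₁, by ring⟩
  obtain ⟨w₂, e₂⟩ : ∃ w, s₂ = t₂ + w := ⟨s₂ - t₂, by ring⟩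
  obtain ⟨w₃, e₃⟩ : ∃ w, s₃ = t₃ + w := ⟨s₃ - t₃, by ring⟩
  have v₁ : s₁ - t₁ = w₁ := by rw [e₁]; ring
  have v₂ : s₂ - t₂ = w₂ := by rw [e₂]; ring
  have v₃ : s₃ - t₃ = w₃ := by rw [e₃]; ring
  rw [v₁, v₂] at P12
  rw [v₁, v₃] at P13
  rw [v₂, v₃] at P23
  have p₁ : t₁ * w₁ = -(w₁ * w₃ + w₁ * w₂ - w₂ * w₃) := by
    apply mul_left_cancel₀ h2
    linear_combination P12 + P13 - P23
  have p₂ : t₂ * w₂ = -(w₂ * w₁ + w₂ * w₃ - w₃ * w₁) := by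
    apply mul_left_cancel₀ h2
    linear_combination P12 + P23 - P13
  have p₃ : t₃ * w₃ = -(w₃ * w₂ + w₃ * w₁ - w₁ * w₂) := by
    apply mul_left_cancel₀ h2
    linear_combination P23 + P13 - P12
  by_cases hw₁ : w₁ = 0
  · subst hw₁
    have : w₂ * w₃ = 0 := by linear_combination -p₁
    rcases mul_eq_zero.1 this with rfl | rfl
    · have : t₃ * w₃ = 0 := by linear_combination p₃
      rcases mul_eq_zero.1 this with rfl | rfl
      · simp_all
      · simp_all
    · have : t₂ * w₂ = 0 := by linear_combination p₂
      rcases mul_eq_zero.1 this with rfl | rfl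
      · simp_all
      · simp_all
  by_cases hw₂ : w₂ = 0
  · subst hw₂
    have : w₁ * w₃ = 0 := by linear_combination -p₂
    rcases mul_eq_zero.1 this with rfl | rfl
    · exact absurd rfl hw₁
    have : t₁ * w₁ = 0 := by linear_combination p₁
    rcases mul_eq_zero.1 this with rfl | rfl
    · simp_all
    · simp_all
  by_cases hw₃ : w₃ = 0
  · subst hw₃
    have : w₁ * w₂ = 0 := by linear_combination -p₃
    rcases mul_eq_zero.1 this with rfl | rfl
    · exact absurd rfl hw₁
    · exact absurd rfl hw₂
  exfalso
  obtain ⟨A, hA⟩ : ∃ A, A = w₁ * w₃ + w₁ * w₂ - w₂ * w₃ := ⟨_, rfl⟩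
  obtain ⟨B, hB⟩ : ∃ B, B = w₂ * w₁ + w₂ * w₃ - w₃ * w₁ := ⟨_, rfl⟩
  obtain ⟨C, hC⟩ : ∃ C, C = w₃ * w₂ + w₃ * w₁ - w₁ * w₂ := ⟨_, rfl⟩
  rw [← hA] at p₁
  rw [← hB] at p₂
  rw [← hC] at p₃
  have ht₁ : t₁ = -A / w₁ := by field_simp; linear_combination p₁
  have ht₂ : t₂ = -B / w₂ := by field_simp; linear_combination p₂
  have ht₃ : t₃ = -C / w₃ := by field_simp; linear_combination p₃
  obtain ⟨hA0, k₁⟩ := cubic_value_of_param hw₁ hw₂ hw₃ hA hB hC ht₁ ht₂ ht₃ e₁ e₂ e₃ hs₁ hs₂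
    h23 hM₁ hf₁
  obtain ⟨hB0, k₂⟩ := cubic_value_of_param hw₂ hw₃ hw₁ hB hC hA ht₂ ht₃ ht₁ e₂ e₃ e₁ hs₂ hs₃
    h13.symm hM₂ hf₂
  obtain ⟨hC0, k₃⟩ := cubic_value_of_param hw₃ hw₁ hw₂ hC hA hB ht₃ ht₁ ht₂ e₃ e₁ e₂ hs₃ hs₁
    h12 hM₃ hf₃
  obtain ⟨hd, hn'⟩ := leading_value_of_param hw₁ hw₂ hw₃ hA hB hC ht₁ ht₂ ht₃ e₁ e₂ e₃ hs₁ hs₂ hn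
  have m₁ : n' * w₁ * A = w₁ ^ 2 * w₂ * w₃ + (n - 1) * A ^ 2 := by
    linear_combination k₁ - n * A * p₁
  have m₂ : n' * w₂ * B = w₂ ^ 2 * w₃ * w₁ + (n - 1) * B ^ 2 := by
    linear_combination k₂ - n * B * p₂
  have hn1 : (n - 1) * (A * B * C) = 8 * (w₁ * w₂ * w₃) ^ 2 := by
    have : (n - 1) * (A * B * C) = (A + B) * (B + C) * (C + A) := by linear_combination hn'
    rw [this, hA, hB, hC]; ring
  have hW : (w₁ * w₂ * w₃) ≠ 0 := by simp [hw₁, hw₂, hw₃]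
  have r₁ : n' * (A * B * C) = w₁ * w₂ * w₃ * (B * C + 4 * A * (B + C)) := by
    apply mul_left_cancel₀ hw₁
    have : B + C = 2 * (w₂ * w₃) := by rw [hB, hC]; ring
    rw [this]
    linear_combination B * C * m₁ + A * hn1
  have r₂ : n' * (A * B * C) = w₁ * w₂ * w₃ * (A * C + 4 * B * (A + C)) := by
    apply mul_left_cancel₀ hw₂
    have : A + C = 2 * (w₁ * w₃) := by rw [hA, hC]; ring
    rw [this]
    linear_combination A * C * m₂ + B * hn1
  have hAB : A = B := by
    apply mul_left_cancel₀ (mul_ne_zero (mul_ne_zero hW h3) hC0)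
    linear_combination r₂ - r₁
  apply hd
  apply mul_left_cancel₀ (mul_ne_zero h2 hw₃)
  rw [hA, hB] at hAB
  linear_combination hAB

lemma collinear_of_slopes {t₁ t₂ t₃ s₁ s₂ s₃ α β γ δ n n' n'' c : k}
    (h2 : (2 : k) ≠ 0) (h3 : (3 : k) ≠ 0)
    (h12 : t₁ ≠ t₂) (h13 : t₁ ≠ t₃) (h23 : t₂ ≠ t₃)
    (hs₁ : s₁ ≠ 0) (hs₂ : s₂ ≠ 0) (hs₃ : s₃ ≠ 0)
    (A23 : α * t₂ * t₃ + β * (t₂ + t₃) + γ = s₂ * s₃)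
    (A13 : α * t₁ * t₃ + β * (t₁ + t₃) + γ = s₁ * s₃)
    (A12 : α * t₁ * t₂ + β * (t₁ + t₂) + γ = s₁ * s₂)
    (A123 : α * t₁ * t₂ * t₃ + β * (t₁ * t₂ + t₁ * t₃ + t₂ * t₃) + γ * (t₁ + t₂ + t₃) + δ
      = s₁ * s₂ * s₃)
    (N11 : n = 3 - (α * t₁ ^ 2 + 2 * β * t₁ + γ) / s₁ ^ 2
      - (α * t₂ ^ 2 + 2 * β * t₂ + γ) / s₂ ^ 2 - (α * t₃ ^ 2 + 2 * β * t₃ + γ) / s₃ ^ 2)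
    (N1 : n * t₁ + n' = 3 * s₁ - (α * t₁ + β)
      - (α * t₁ * t₂ ^ 2 + β * (t₂ ^ 2 + 2 * t₁ * t₂) + γ * (t₁ + 2 * t₂) + δ) / s₂ ^ 2
      - (α * t₁ * t₃ ^ 2 + β * (t₃ ^ 2 + 2 * t₁ * t₃) + γ * (t₁ + 2 * t₃) + δ) / s₃ ^ 2)
    (N2 : n * t₂ + n' = 3 * s₂ - (α * t₂ + β)
      - (α * t₂ * t₃ ^ 2 + β * (t₃ ^ 2 + 2 * t₂ * t₃) + γ * (t₂ + 2 * t₃) + δ) / s₃ ^ 2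
      - (α * t₂ * t₁ ^ 2 + β * (t₁ ^ 2 + 2 * t₂ * t₁) + γ * (t₂ + 2 * t₁) + δ) / s₁ ^ 2)
    (N3 : n * t₃ + n' = 3 * s₃ - (α * t₃ + β)
      - (α * t₃ * t₁ ^ 2 + β * (t₁ ^ 2 + 2 * t₃ * t₁) + γ * (t₃ + 2 * t₁) + δ) / s₁ ^ 2
      - (α * t₃ * t₂ ^ 2 + β * (t₂ ^ 2 + 2 * t₃ * t₂) + γ * (t₃ + 2 * t₂) + δ) / s₂ ^ 2)
    (N12 : s₃ * (n * t₁ * t₂ + n' * (t₁ + t₂) + n'') = s₁ * s₂ * s₃ - s₁ * s₂ * (t₃ + c))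
    (N13 : s₂ * (n * t₁ * t₃ + n' * (t₁ + t₃) + n'') = s₁ * s₂ * s₃ - s₁ * s₃ * (t₂ + c))
    (N23 : s₁ * (n * t₂ * t₃ + n' * (t₂ + t₃) + n'') = s₁ * s₂ * s₃ - s₂ * s₃ * (t₁ + c)) :
    (s₁ = s₂ ∧ s₁ = s₃) ∨
    (s₁ - t₁ = s₂ - t₂ ∧ s₁ - t₁ = s₃ - t₃) ∨ (s₂ = t₂ - t₁ ∧ s₃ = t₃ - t₁) ∨
      (s₁ = t₁ - t₂ ∧ s₃ = t₃ - t₂) ∨ (s₁ = t₁ - t₃ ∧ s₂ = t₂ - t₃) := by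
  have slope {t t' : k} (h : t ≠ t') (s s' : k) : (t - t') * ((s - s') / (t - t')) = s - s' :=
    mul_div_cancel₀ _ (sub_ne_zero.2 h)
  have hM₁ := slope h23 s₂ s₃
  have hM₂ := slope h13.symm s₃ s₁
  have hM₃ := slope h12 s₁ s₂
  generalize (s₂ - s₃) / (t₂ - t₃) = M₁ at hM₁
  generalize (s₃ - s₁) / (t₃ - t₁) = M₂ at hM₂
  generalize (s₁ - s₂) / (t₁ - t₂) = M₃ at hM₃
  have hf₁ := cubic_form_value h23 hs₂ hs₃ A23 A13 A12 A123 hM₁ N1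
  have hf₂ := cubic_form_value h13.symm hs₃ hs₁ (t₁ := t₂) (s₁ := s₂) (δ := δ)
    (by linear_combination A13) (by linear_combination A12) (by linear_combination A23)
    (by linear_combination A123) hM₂ N2
  have hf₃ := cubic_form_value h12 hs₁ hs₂ (t₁ := t₃) (s₁ := s₃) (δ := δ)
    (by linear_combination A12) (by linear_combination A23) (by linear_combination A13)
    (by linear_combination A123) hM₃ N3
  have hn := leading_value h12 h13 h23 hs₁ hs₂ hs₃ A23 A13 A12 N11
  have P23 := pair_relation h23 hs₁ hM₁ hf₁ N12 N13
  have P31 := pair_relation h13.symm hs₂ (c := c) (n'' := n'') hM₂ hf₂ (by linear_combination N23)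
    (by linear_combination N12)
  have P12 := pair_relation h12 hs₃ (c := c) (n'' := n'') hM₃ hf₃ (by linear_combination N13)
    (by linear_combination N23)
  have c12 : t₁ + c ≠ t₂ + c := by simpa using h12
  have c13 : t₁ + c ≠ t₃ + c := by simpa using h13
  have c23 : t₂ + c ≠ t₃ + c := by simpa using h23
  by_cases e23 : s₂ = s₃
  · by_cases e12 : s₁ = s₂
    · exact Or.inl ⟨e12, e12.trans e23⟩
    subst e23
    replace P12 := P12.resolve_left e12
    replace P31 := P31.resolve_left (Ne.symm e12)
    have := collinear_of_one_pair_eq (n := n) (n' := n' - n * c) h2 c12 c13 c23 hs₁ hs₂ e12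
      (M₂ := M₂) (M₃ := M₃) (by linear_combination hM₂) (by linear_combination hM₃)
      (by linear_combination hf₂) (by linear_combination hf₃) (by linear_combination hn)
      (by linear_combination P12) (by linear_combination P31)
    simp only [add_sub_add_right_eq_sub] at this
    exact Or.inr (Or.inr (Or.inr this))
  by_cases e13 : s₁ = s₃
  · subst e13
    replace P12 := P12.resolve_left (Ne.symm e23)
    replace P23 := P23.resolve_left e23
    have := collinear_of_one_pair_eq (n := n) (n' := n' - n * c) h2 c23 c12.symm c13.symm hs₂ hs₁
      e23 (M₂ := M₃) (M₃ := M₁) (by linear_combination hM₃) (by linear_combination hM₁)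
      (by linear_combination hf₃) (by linear_combination hf₁) (by linear_combination hn)
      (by linear_combination P23) (by linear_combination P12)
    simp only [add_sub_add_right_eq_sub] at this
    rcases this with h | h
    · exact Or.inr (Or.inr (Or.inr (Or.inr h.symm)))
    · exact Or.inr (Or.inr (Or.inl h))
  by_cases e12 : s₁ = s₂
  · subst e12
    replace P31 := P31.resolve_left (Ne.symm e23)
    replace P23 := P23.resolve_left e23
    have := collinear_of_one_pair_eq (n := n) (n' := n' - n * c) h2 c13.symm c23.symm c12 hs₃ hs₁
      (Ne.symm e13) (M₂ := M₁) (M₃ := M₂) (by linear_combination hM₁) (by linear_combination hM₂)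
      (by linear_combination hf₁) (by linear_combination hf₂) (by linear_combination hn)
      (by linear_combination P31) (by linear_combination P23)
    simp only [add_sub_add_right_eq_sub] at this
    rcases this with h | h
    · exact Or.inr (Or.inr (Or.inl h.symm))
    · exact Or.inr (Or.inr (Or.inr (Or.inl h.symm)))
  right
  have := collinear_of_pairwise_relation (n := n) (n' := n' - n * c) h2 h3 c12 c13 c23
    hs₁ hs₂ hs₃ (M₁ := M₁) (M₂ := M₂) (M₃ := M₃)
    (by linear_combination hM₁) (by linear_combination hM₂) (by linear_combination hM₃)
    (by linear_combination hf₁) (by linear_combination hf₂) (by linear_combination hf₃)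
    (by linear_combination hn)
    (by linear_combination P12.resolve_left e12)
    (by linear_combination P31.resolve_left (Ne.symm e13))
    (by linear_combination P23.resolve_left e23)
  simp only [add_sub_add_right_eq_sub] at this
  simpa only [← sub_sub, sub_left_inj] using this

lemma exists_functional_of_relations {x₁ x₂ x₃ y₁ y₂ y₃ α β γ δ n n' n'' c : k}
    (h2 : (2 : k) ≠ 0) (h3 : (3 : k) ≠ 0)
    (hy₁ : y₁ ≠ 0) (hy₂ : y₂ ≠ 0) (hy₃ : y₃ ≠ 0)
    (h12 : x₁ * y₂ ≠ x₂ * y₁) (h13 : x₁ * y₃ ≠ x₃ * y₁) (h23 : x₂ * y₃ ≠ x₃ * y₂)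
    (A23 : α * x₂ * x₃ + β * (x₂ * y₃ + x₃ * y₂) + γ * y₂ * y₃ = 1)
    (A13 : α * x₁ * x₃ + β * (x₁ * y₃ + x₃ * y₁) + γ * y₁ * y₃ = 1)
    (A12 : α * x₁ * x₂ + β * (x₁ * y₂ + x₂ * y₁) + γ * y₁ * y₂ = 1)
    (A123 : α * x₁ * x₂ * x₃ + β * (x₁ * x₂ * y₃ + x₁ * x₃ * y₂ + x₂ * x₃ * y₁)
      + γ * (x₁ * y₂ * y₃ + x₂ * y₁ * y₃ + x₃ * y₁ * y₂) + δ * y₁ * y₂ * y₃ = 1)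
    (N11 : n = 3 - (α * x₁ ^ 2 + 2 * β * x₁ * y₁ + γ * y₁ ^ 2)
      - (α * x₂ ^ 2 + 2 * β * x₂ * y₂ + γ * y₂ ^ 2)
      - (α * x₃ ^ 2 + 2 * β * x₃ * y₃ + γ * y₃ ^ 2))
    (N1 : n * x₁ + n' * y₁ = 3 - (α * x₁ + β * y₁)
      - (α * x₁ * x₂ ^ 2 + β * (x₂ ^ 2 * y₁ + 2 * x₁ * x₂ * y₂)
        + γ * (x₁ * y₂ ^ 2 + 2 * x₂ * y₁ * y₂) + δ * y₁ * y₂ ^ 2)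
      - (α * x₁ * x₃ ^ 2 + β * (x₃ ^ 2 * y₁ + 2 * x₁ * x₃ * y₃)
        + γ * (x₁ * y₃ ^ 2 + 2 * x₃ * y₁ * y₃) + δ * y₁ * y₃ ^ 2))
    (N2 : n * x₂ + n' * y₂ = 3 - (α * x₂ + β * y₂)
      - (α * x₂ * x₃ ^ 2 + β * (x₃ ^ 2 * y₂ + 2 * x₂ * x₃ * y₃)
        + γ * (x₂ * y₃ ^ 2 + 2 * x₃ * y₂ * y₃) + δ * y₂ * y₃ ^ 2)
      - (α * x₂ * x₁ ^ 2 + β * (x₁ ^ 2 * y₂ + 2 * x₂ * x₁ * y₁)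
        + γ * (x₂ * y₁ ^ 2 + 2 * x₁ * y₂ * y₁) + δ * y₂ * y₁ ^ 2))
    (N3 : n * x₃ + n' * y₃ = 3 - (α * x₃ + β * y₃)
      - (α * x₃ * x₁ ^ 2 + β * (x₁ ^ 2 * y₃ + 2 * x₃ * x₁ * y₁)
        + γ * (x₃ * y₁ ^ 2 + 2 * x₁ * y₃ * y₁) + δ * y₃ * y₁ ^ 2)
      - (α * x₃ * x₂ ^ 2 + β * (x₂ ^ 2 * y₃ + 2 * x₃ * x₂ * y₂)
        + γ * (x₃ * y₂ ^ 2 + 2 * x₂ * y₃ * y₂) + δ * y₃ * y₂ ^ 2))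
    (N12 : n * x₁ * x₂ + n' * (x₁ * y₂ + x₂ * y₁) + n'' * y₁ * y₂ = 1 - (x₃ + c * y₃))
    (N13 : n * x₁ * x₃ + n' * (x₁ * y₃ + x₃ * y₁) + n'' * y₁ * y₃ = 1 - (x₂ + c * y₂))
    (N23 : n * x₂ * x₃ + n' * (x₂ * y₃ + x₃ * y₂) + n'' * y₂ * y₃ = 1 - (x₁ + c * y₁)) :
    ∃ u v : k, (u ≠ 0 ∨ v ≠ 0) ∧ (u = 0 ∨ u = 1) ∧ (u * x₁ + v * y₁ = 0 ∨ u * x₁ + v * y₁ = 1) ∧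
      (u * x₂ + v * y₂ = 0 ∨ u * x₂ + v * y₂ = 1) ∧
      (u * x₃ + v * y₃ = 0 ∨ u * x₃ + v * y₃ = 1) := by
  obtain ⟨s₁, rfl⟩ : ∃ s, y₁ = s⁻¹ := ⟨y₁⁻¹, by simp⟩
  obtain ⟨s₂, rfl⟩ : ∃ s, y₂ = s⁻¹ := ⟨y₂⁻¹, by simp⟩
  obtain ⟨s₃, rfl⟩ : ∃ s, y₃ = s⁻¹ := ⟨y₃⁻¹, by simp⟩
  simp only [ne_eq, inv_eq_zero] at hy₁ hy₂ hy₃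
  obtain ⟨t₁, rfl⟩ : ∃ t, x₁ = t / s₁ := ⟨x₁ * s₁, by field_simp⟩
  obtain ⟨t₂, rfl⟩ : ∃ t, x₂ = t / s₂ := ⟨x₂ * s₂, by field_simp⟩
  obtain ⟨t₃, rfl⟩ : ∃ t, x₃ = t / s₃ := ⟨x₃ * s₃, by field_simp⟩
  have d12 : t₁ ≠ t₂ := by rintro rfl; apply h12; field_simp
  have d13 : t₁ ≠ t₃ := by rintro rfl; apply h13; field_simp
  have d23 : t₂ ≠ t₃ := by rintro rfl; apply h23; field_simp
  have := collinear_of_slopes (α := α) (β := β) (γ := γ) (δ := δ) (n := n) (n' := n') (n'' := n'')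
    (c := c) h2 h3 d12 d13 d23 hy₁ hy₂ hy₃
    (by field_simp at A23; linear_combination A23)
    (by field_simp at A13; linear_combination A13)
    (by field_simp at A12; linear_combination A12)
    (by field_simp at A123; linear_combination A123)
    (by rw [N11]; field_simp)
    (by field_simp at N1 ⊢; linear_combination N1)
    (by field_simp at N2 ⊢; linear_combination N2)
    (by field_simp at N3 ⊢; linear_combination N3)
    (by field_simp at N12; linear_combination N12)
    (by field_simp at N13; linear_combination N13)
    (by field_simp at N23; linear_combination N23)
  rcases this with ⟨rfl, rfl⟩ | ⟨e₁, e₂⟩ | ⟨rfl, rfl⟩ | ⟨rfl, rfl⟩ | ⟨rfl, rfl⟩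
  · exact ⟨0, s₁, by simp [hy₁]⟩
  · refine ⟨1, s₁ - t₁, by simp, by simp, Or.inr ?_, Or.inr ?_, Or.inr ?_⟩
    · field_simp; ring
    · rw [e₁]; field_simp; ring
    · rw [e₂]; field_simp; ring
  · exact ⟨1, -t₁, by simp, by simp, Or.inl (by field_simp; ring), Or.inr (by field_simp; ring),
      Or.inr (by field_simp; ring)⟩
  · exact ⟨1, -t₂, by simp, by simp, Or.inr (by field_simp; ring), Or.inl (by field_simp; ring),
      Or.inr (by field_simp; ring)⟩
  · exact ⟨1, -t₃, by simp, by simp, Or.inr (by field_simp; ring), Or.inr (by field_simp; ring),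
      Or.inl (by field_simp; ring)⟩

/-- Let `w₁, w₂, w₃` be the vectors `(xᵢ, yᵢ)` and `w₀ = (1, 0)`, pairwise independent. If an even
quartic vanishes at the signed sums of `w₀, w₀, w₁, w₂, w₃` with mixed signs, and equals `2` at the
full sum, then `w₀, w₁, w₂, w₃` lie on two parallel lines `φ = 0` and `φ = 1`. -/
lemma exists_functional_of_even_quartic {x₁ x₂ x₃ y₁ y₂ y₃ a₀ a₁ a₂ a₃ a₄ b₀ b₁ b₂ c₀ : k}
    (h2 : (2 : k) ≠ 0) (h3 : (3 : k) ≠ 0)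
    (hy₁ : y₁ ≠ 0) (hy₂ : y₂ ≠ 0) (hy₃ : y₃ ≠ 0)
    (h12 : x₁ * y₂ ≠ x₂ * y₁) (h13 : x₁ * y₃ ≠ x₃ * y₁) (h23 : x₂ * y₃ ≠ x₃ * y₂)
    {H : k → k → k}
    (hH : ∀ X Y, H X Y = a₀ * X ^ 4 + a₁ * X ^ 3 * Y + a₂ * X ^ 2 * Y ^ 2 + a₃ * X * Y ^ 3
      + a₄ * Y ^ 4 + b₀ * X ^ 2 + b₁ * X * Y + b₂ * Y ^ 2 + c₀)
    (eppp : H (2 + x₁ + x₂ + x₃) (y₁ + y₂ + y₃) = 2)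
    (eppm : H (2 + x₁ + x₂ - x₃) (y₁ + y₂ - y₃) = 0)
    (epmp : H (2 + x₁ - x₂ + x₃) (y₁ - y₂ + y₃) = 0)
    (epmm : H (2 + x₁ - x₂ - x₃) (y₁ - y₂ - y₃) = 0)
    (empp : H (2 - x₁ + x₂ + x₃) (-y₁ + y₂ + y₃) = 0)
    (empm : H (2 - x₁ + x₂ - x₃) (-y₁ + y₂ - y₃) = 0)
    (emmp : H (2 - x₁ - x₂ + x₃) (-y₁ - y₂ + y₃) = 0)
    (emmm : H (2 - x₁ - x₂ - x₃) (-y₁ - y₂ - y₃) = 0)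
    (fppp : H (x₁ + x₂ + x₃) (y₁ + y₂ + y₃) = 0)
    (fppm : H (x₁ + x₂ - x₃) (y₁ + y₂ - y₃) = 0)
    (fpmp : H (x₁ - x₂ + x₃) (y₁ - y₂ + y₃) = 0)
    (fmpp : H (-x₁ + x₂ + x₃) (-y₁ + y₂ + y₃) = 0) :
    ∃ u v : k, (u ≠ 0 ∨ v ≠ 0) ∧ (u = 0 ∨ u = 1) ∧ (u * x₁ + v * y₁ = 0 ∨ u * x₁ + v * y₁ = 1) ∧
      (u * x₂ + v * y₂ = 0 ∨ u * x₂ + v * y₂ = 1) ∧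
      (u * x₃ + v * y₃ = 0 ∨ u * x₃ + v * y₃ = 1) := by
  simp only [hH] at eppp eppm epmp epmm empp empm emmp emmm fppp fppm fpmp fmpp
  have halve (z : k) : ∃ w, 2 * w = z := ⟨z / 2, mul_div_cancel₀ _ h2⟩
  obtain ⟨n, hn⟩ := halve (96 * b₀ + 2 * (192 * a₀)
    + (192 * a₀ * (x₁ ^ 2 + x₂ ^ 2 + x₃ ^ 2) + 2 * (48 * a₁) * (x₁ * y₁ + x₂ * y₂ + x₃ * y₃)
      + 32 * a₂ * (y₁ ^ 2 + y₂ ^ 2 + y₃ ^ 2)))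
  obtain ⟨n', hn'⟩ := halve (48 * b₁ + 2 * (48 * a₁)
    + (48 * a₁ * (x₁ ^ 2 + x₂ ^ 2 + x₃ ^ 2) + 2 * (32 * a₂) * (x₁ * y₁ + x₂ * y₂ + x₃ * y₃)
      + 48 * a₃ * (y₁ ^ 2 + y₂ ^ 2 + y₃ ^ 2)))
  obtain ⟨n'', hn''⟩ := halve (96 * b₂ + 2 * (32 * a₂)
    + (32 * a₂ * (x₁ ^ 2 + x₂ ^ 2 + x₃ ^ 2) + 2 * (48 * a₃) * (x₁ * y₁ + x₂ * y₂ + x₃ * y₃)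
      + 192 * a₄ * (y₁ ^ 2 + y₂ ^ 2 + y₃ ^ 2)))
  have A23 : 192 * a₀ * x₂ * x₃ + 48 * a₁ * (x₂ * y₃ + x₃ * y₂) + 32 * a₂ * y₂ * y₃ = 1 := by
    apply mul_left_cancel₀ h2
    linear_combination eppp - eppm - epmp + epmm + empp - empm - emmp + emmm -
      2 * (fppp - fppm - fpmp + fmpp)
  have A13 : 192 * a₀ * x₁ * x₃ + 48 * a₁ * (x₁ * y₃ + x₃ * y₁) + 32 * a₂ * y₁ * y₃ = 1 := by
    apply mul_left_cancel₀ h2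
    linear_combination eppp - eppm + epmp - epmm - empp + empm - emmp + emmm -
      2 * (fppp - fppm + fpmp - fmpp)
  have A12 : 192 * a₀ * x₁ * x₂ + 48 * a₁ * (x₁ * y₂ + x₂ * y₁) + 32 * a₂ * y₁ * y₂ = 1 := by
    apply mul_left_cancel₀ h2
    linear_combination eppp + eppm - epmp - epmm - empp - empm + emmp + emmm -
      2 * (fppp + fppm - fpmp - fmpp)
  have A123 : 192 * a₀ * x₁ * x₂ * x₃ + 48 * a₁ * (x₁ * x₂ * y₃ + x₁ * x₃ * y₂ + x₂ * x₃ * y₁)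
      + 32 * a₂ * (x₁ * y₂ * y₃ + x₂ * y₁ * y₃ + x₃ * y₁ * y₂) + 48 * a₃ * y₁ * y₂ * y₃ = 1 := by
    apply mul_left_cancel₀ h2
    linear_combination eppp - eppm - epmp + epmm - empp + empm + emmp - emmm
  refine exists_functional_of_relations (n := n) (n' := n') (n'' := n'') (δ := 48 * a₃)
    (c := 48 * a₁ * x₁ * x₂ * x₃ + 32 * a₂ * (x₁ * x₂ * y₃ + x₁ * x₃ * y₂ + x₂ * x₃ * y₁)
      + 48 * a₃ * (x₁ * y₂ * y₃ + x₂ * y₁ * y₃ + x₃ * y₁ * y₂) + 192 * a₄ * y₁ * y₂ * y₃)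
    h2 h3 hy₁ hy₂ hy₃ h12 h13 h23 A23 A13 A12 A123 ?_ ?_ ?_ ?_ ?_ ?_ ?_
  · apply mul_left_cancel₀ h2
    linear_combination hn + 3 * (eppp + eppm + epmp + epmm + empp + empm + emmp + emmm) -
      6 * (fppp + fppm + fpmp + fmpp)
  · apply mul_left_cancel₀ h2
    linear_combination x₁ * hn + y₁ * hn' +
      3 * (eppp + eppm + epmp + epmm - empp - empm - emmp - emmm)
  · apply mul_left_cancel₀ h2
    linear_combination x₂ * hn + y₂ * hn' +
      3 * (eppp + eppm - epmp - epmm + empp + empm - emmp - emmm)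
  · apply mul_left_cancel₀ h2
    linear_combination x₃ * hn + y₃ * hn' +
      3 * (eppp - eppm + epmp - epmm + empp - empm + emmp - emmm)
  · apply mul_left_cancel₀ h2
    linear_combination x₁ * x₂ * hn + (x₁ * y₂ + x₂ * y₁) * hn' + y₁ * y₂ * hn'' +
      12 * (fppp + fppm - fpmp - fmpp) + 2 * A12 - 2 * x₃ * A123
  · apply mul_left_cancel₀ h2
    linear_combination x₁ * x₃ * hn + (x₁ * y₃ + x₃ * y₁) * hn' + y₁ * y₃ * hn'' +
      12 * (fppp - fppm + fpmp - fmpp) + 2 * A13 - 2 * x₂ * A123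
  · apply mul_left_cancel₀ h2
    linear_combination x₂ * x₃ * hn + (x₂ * y₃ + x₃ * y₂) * hn' + y₂ * y₃ * hn'' +
      12 * (fppp - fppm - fpmp + fmpp) + 2 * A23 - 2 * x₁ * A123

end Algebra

section PolynomialMethod
variable {k V E : Type*} [Field k] [AddCommGroup V] [Module k V] [AddCommGroup E] [Module k E]

/-- `DegLT n f` says that `f : V → k` is a polynomial function of degree less than `n`. -/
inductive DegLT : ℕ → (V → k) → Prop
  | zero (n : ℕ) : DegLT n 0
  | const (n : ℕ) (c : k) : DegLT (n + 1) fun _ => c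
  | add {n : ℕ} {f g : V → k} : DegLT n f → DegLT n g → DegLT n (f + g)
  | mul {n : ℕ} {f : V → k} (l : V →ₗ[k] k) : DegLT n f → DegLT (n + 1) fun v => l v * f v

namespace DegLT

lemma mono {m n : ℕ} {f : V → k} (h : DegLT m f) (hmn : m ≤ n) : DegLT n f := by
  induction h generalizing n with
  | zero => exact zero n
  | const m c => obtain ⟨n, rfl⟩ := Nat.exists_eq_add_of_le' (le_trans (by lia) hmn : 1 ≤ n)
                 exact const n c
  | add _ _ h₁ h₂ => exact (h₁ hmn).add (h₂ hmn)
  | mul l _ ih =>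
    obtain ⟨n, rfl⟩ := Nat.exists_eq_add_of_le' (le_trans (by lia) hmn : 1 ≤ n)
    exact (ih (by lia)).mul l

lemma eq_zero {f : V → k} (h : DegLT 0 f) : f = 0 := by
  generalize hn : 0 = n at h
  induction h with
  | zero => rfl
  | const => lia
  | add _ _ h₁ h₂ => simp [h₁ hn, h₂ hn]
  | mul => lia

lemma zero_fun (n : ℕ) : DegLT n fun _ : V => (0 : k) := zero n

lemma add_fun {n : ℕ} {f g : V → k} (hf : DegLT n f) (hg : DegLT n g) :
    DegLT n fun v => f v + g v := hf.add hg

lemma const_mul {n : ℕ} {f : V → k} (h : DegLT n f) (c : k) : DegLT n fun v => c * f v := by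
  induction h with
  | zero n => simpa using zero_fun n
  | const n a => exact const n (c * a)
  | add _ _ h₁ h₂ => simpa only [Pi.add_apply, mul_add] using h₁.add_fun h₂
  | mul l _ ih => simpa only [mul_left_comm] using ih.mul l

lemma sub {n : ℕ} {f g : V → k} (hf : DegLT n f) (hg : DegLT n g) : DegLT n (f - g) := by
  convert hf.add (hg.const_mul (-1)) using 1
  ext v
  simp [sub_eq_add_neg]

lemma mul_fun {m n : ℕ} {f g : V → k} (hf : DegLT m f) (hg : DegLT (n + 1) g) :
    DegLT (m + n) (f * g) := by
  induction hf with
  | zero m => simpa using zero (m + n)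
  | const m c => exact (hg.const_mul c).mono (by lia)
  | add _ _ h₁ h₂ => simpa only [add_mul] using h₁.add h₂
  | @mul m f l _ ih =>
    have := ih.mul l
    simp only [Pi.mul_apply, ← mul_assoc] at this
    rw [add_right_comm]
    exact this

lemma comp_affine {n : ℕ} {f : V → k} (h : DegLT n f) (L : E →ₗ[k] V) (b : V) :
    DegLT n fun v => f (L v + b) := by
  induction h with
  | zero n => exact zero n
  | const n c => exact const n c
  | add _ _ h₁ h₂ => exact h₁.add h₂
  | mul l _ ih =>
    convert (ih.mul (l ∘ₗ L)).add ((ih.const_mul (l b)).mono (Nat.le_succ _)) using 1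
    ext v
    simp [add_mul]

lemma comp_add {n : ℕ} {f : V → k} (h : DegLT n f) (b : V) : DegLT n fun v => f (v + b) :=
  h.comp_affine LinearMap.id b

lemma sub_comp_add {n : ℕ} {f : V → k} (h : DegLT (n + 1) f) (b : V) :
    DegLT n fun v => f v - f (v + b) := by
  generalize hm : n + 1 = m at h
  induction h generalizing n with
  | zero => simpa using zero_fun n
  | const => simpa using zero_fun n
  | add _ _ h₁ h₂ => simpa only [Pi.add_apply, add_sub_add_comm] using (h₁ hm).add_fun (h₂ hm)
  | @mul m f l hf ih =>
    obtain rfl : n = m := by lia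
    cases n with
    | zero => rw [hf.eq_zero]; simpa using zero_fun 0
    | succ n =>
      convert ((ih rfl).mul l).sub ((hf.comp_add b).const_mul (l b)) using 1
      ext v
      simp only [map_add, Pi.sub_apply]
      ring

lemma alternating_sum {ι : Type*} [DecidableEq ι] (g : ι → V) (U : Finset ι) {n : ℕ} {f : V → k}
    (h : DegLT (n + U.card) f) :
    DegLT n fun v => ∑ T ∈ U.powerset, (-1) ^ T.card * f (v + ∑ i ∈ T, g i) := by
  induction U using Finset.induction_on generalizing f with
  | empty => simpa using h
  | insert a U ha ih =>
    rw [Finset.card_insert_of_notMem ha, ← add_assoc] at h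
    convert ih (h.sub_comp_add (g a)) using 1
    ext v
    rw [Finset.sum_powerset_insert ha, ← Finset.sum_add_distrib]
    refine Finset.sum_congr rfl fun T hT => ?_
    have haT : a ∉ T := fun h => ha (Finset.mem_powerset.1 hT h)
    rw [Finset.card_insert_of_notMem haT, Finset.sum_insert haT, pow_succ, add_assoc v,
      add_comm (∑ i ∈ T, g i)]
    ring

lemma linear_pow (l : V →ₗ[k] k) (m : ℕ) : DegLT (m + 1) fun v => l v ^ m := by
  induction m with
  | zero => simpa using const 0 (1 : k)
  | succ m ih => simpa only [pow_succ'] using ih.mul l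

lemma prod {ι : Type*} (s : Finset ι) {m : ℕ} {f : ι → V → k}
    (h : ∀ i ∈ s, DegLT (m + 1) (f i)) : DegLT (s.card * m + 1) fun v => ∏ i ∈ s, f i v := by
  classical
  induction s using Finset.induction_on with
  | empty => simpa using const 0 (1 : k)
  | insert a s ha ih =>
    simp only [Finset.prod_insert ha, Finset.card_insert_of_notMem ha]
    convert (h a (by simp)).mul_fun (ih fun i hi => h i (by simp [hi])) using 1
    · ring
    · rfl

lemma eq_const {f : V → k} (h : DegLT 1 f) : ∃ c, ∀ v, f v = c := by
  generalize hn : 1 = n at h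
  induction h with
  | zero => exact ⟨0, fun _ => rfl⟩
  | const n c => exact ⟨c, fun _ => rfl⟩
  | add _ _ h₁ h₂ =>
    obtain ⟨c₁, h₁⟩ := h₁ hn
    obtain ⟨c₂, h₂⟩ := h₂ hn
    exact ⟨c₁ + c₂, fun v => by simp [h₁, h₂]⟩
  | mul l hf _ =>
    obtain rfl : _ = 0 := (Nat.succ.inj hn).symm
    exact ⟨0, fun v => by simp [hf.eq_zero]⟩

lemma exists_eq_const_add_linear_mul {n : ℕ} {f : V → k} (h : DegLT (n + 1) f) {X Y : V →ₗ[k] k}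
    (hXY : ∀ l : V →ₗ[k] k, ∃ a b : k, l = a • X + b • Y) :
    ∃ (c : k) (f₁ f₂ : V → k), DegLT n f₁ ∧ DegLT n f₂ ∧
      ∀ v, f v = c + X v * f₁ v + Y v * f₂ v := by
  generalize hm : n + 1 = m at h
  induction h with
  | zero => exact ⟨0, 0, 0, zero n, zero n, by simp⟩
  | const m c => exact ⟨c, 0, 0, zero n, zero n, by simp⟩
  | add _ _ h₁ h₂ =>
    obtain ⟨c, f₁, f₂, hf₁, hf₂, hf⟩ := h₁ hm
    obtain ⟨c', g₁, g₂, hg₁, hg₂, hg⟩ := h₂ hm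
    refine ⟨c + c', f₁ + g₁, f₂ + g₂, hf₁.add hg₁, hf₂.add hg₂, fun v => ?_⟩
    simp only [Pi.add_apply, hf, hg]
    ring
  | @mul m f l hf _ =>
    obtain rfl : n = m := by lia
    obtain ⟨a, b, rfl⟩ := hXY l
    refine ⟨0, _, _, hf.const_mul a, hf.const_mul b, fun v => ?_⟩
    simp only [LinearMap.add_apply, LinearMap.smul_apply, smul_eq_mul]
    ring

lemma exists_affine {f : V → k} (h : DegLT 2 f) {X Y : V →ₗ[k] k}
    (hXY : ∀ l : V →ₗ[k] k, ∃ a b : k, l = a • X + b • Y) :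
    ∃ a b c : k, ∀ v, f v = c + a * X v + b * Y v := by
  obtain ⟨c, f₁, f₂, h₁, h₂, hf⟩ := h.exists_eq_const_add_linear_mul hXY
  obtain ⟨a, ha⟩ := h₁.eq_const
  obtain ⟨b, hb⟩ := h₂.eq_const
  exact ⟨a, b, c, fun v => by rw [hf, ha, hb]; ring⟩

lemma exists_cubic {f : V → k} (h : DegLT 4 f) {X Y : V →ₗ[k] k}
    (hXY : ∀ l : V →ₗ[k] k, ∃ a b : k, l = a • X + b • Y) :
    ∃ a₀ a₁ a₂ a₃ b₀ b₁ b₂ c₀ c₁ d₀ : k, ∀ v, f v = a₀ * X v ^ 3 + a₁ * X v ^ 2 * Y v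
      + a₂ * X v * Y v ^ 2 + a₃ * Y v ^ 3 + b₀ * X v ^ 2 + b₁ * X v * Y v + b₂ * Y v ^ 2
      + c₀ * X v + c₁ * Y v + d₀ := by
  obtain ⟨c, f₁, f₂, h₁, h₂, hf⟩ := h.exists_eq_const_add_linear_mul hXY
  obtain ⟨c₁, f₁₁, f₁₂, h₁₁, h₁₂, hf₁⟩ := h₁.exists_eq_const_add_linear_mul hXY
  obtain ⟨c₂, f₂₁, f₂₂, h₂₁, h₂₂, hf₂⟩ := h₂.exists_eq_const_add_linear_mul hXY
  obtain ⟨a, b, r, e₁⟩ := h₁₁.exists_affine hXY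
  obtain ⟨a', b', r', e₂⟩ := h₁₂.exists_affine hXY
  obtain ⟨a'', b'', r'', e₃⟩ := h₂₁.exists_affine hXY
  obtain ⟨a₃, b₃, r₃, e₄⟩ := h₂₂.exists_affine hXY
  refine ⟨a, b + a' + a'', b' + b'' + a₃, b₃, r, r' + r'', r₃, c₁, c₂, c, fun v => ?_⟩
  rw [hf, hf₁, hf₂, e₁, e₂, e₃, e₄]
  ring

lemma exists_even_quartic {f : V → k} (h : DegLT 5 f) {X Y : V →ₗ[k] k}
    (hXY : ∀ l : V →ₗ[k] k, ∃ a b : k, l = a • X + b • Y) :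
    ∃ a₀ a₁ a₂ a₃ a₄ b₀ b₁ b₂ c₀ : k, ∀ v, f v + f (-v) = a₀ * X v ^ 4 + a₁ * X v ^ 3 * Y v
      + a₂ * X v ^ 2 * Y v ^ 2 + a₃ * X v * Y v ^ 3 + a₄ * Y v ^ 4 + b₀ * X v ^ 2 + b₁ * X v * Y v
      + b₂ * Y v ^ 2 + c₀ := by
  obtain ⟨c, f₁, f₂, h₁, h₂, hf⟩ := h.exists_eq_const_add_linear_mul hXY
  obtain ⟨a₀, a₁, a₂, a₃, b₀, b₁, b₂, c₀, c₁, d₀, e⟩ := h₁.exists_cubic hXY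
  obtain ⟨a₀', a₁', a₂', a₃', b₀', b₁', b₂', c₀', c₁', d₀', e'⟩ := h₂.exists_cubic hXY
  refine ⟨2 * a₀, 2 * (a₁ + a₀'), 2 * (a₂ + a₁'), 2 * (a₃ + a₂'), 2 * a₃', 2 * c₀,
    2 * (c₁ + c₀'), 2 * c₁', 2 * c, fun v => ?_⟩
  rw [hf, hf, e, e, e', e']
  simp only [map_neg]
  ring

end DegLT

lemma exists_degLT_indicator [Fintype k] [Module.Finite k V] :
    ∃ δ : V → k, DegLT (Module.finrank k V * (Fintype.card k - 1) + 1) δ ∧ δ 0 = 1 ∧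
      ∀ v, v ≠ 0 → δ v = 0 := by
  let b := Module.finBasis k V
  have hc : 1 < Fintype.card k := Fintype.one_lt_card
  refine ⟨fun v => ∏ i, (1 - b.coord i v ^ (Fintype.card k - 1)), ?_, ?_, fun v hv => ?_⟩
  · have := DegLT.prod (V := V) Finset.univ (m := Fintype.card k - 1)
      (f := fun i v => 1 - b.coord i v ^ (Fintype.card k - 1))
      fun i _ => (DegLT.const _ (1 : k)).sub (DegLT.linear_pow (b.coord i) _)
    simpa using this
  · simp [zero_pow (by lia : Fintype.card k - 1 ≠ 0)]
  · obtain ⟨i, hi⟩ : ∃ i, b.coord i v ≠ 0 := by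
      by_contra! h
      exact hv (b.forall_coord_eq_zero_iff.1 h)
    exact Finset.prod_eq_zero (Finset.mem_univ i)
      (by rw [FiniteField.pow_card_sub_one_eq_one _ hi]; simp)

/-- Families longer than `finrank k V * (card k - 1)` have a nonempty zero-sum subfamily. -/
lemma exists_zero_sum_subset [Fintype k] [Module.Finite k V] {ι : Type*} (g : ι → V)
    (U : Finset ι) (hU : Module.finrank k V * (Fintype.card k - 1) < U.card) :
    ∃ T ⊆ U, T.Nonempty ∧ ∑ i ∈ T, g i = 0 := by
  classical
  by_contra! h
  obtain ⟨δ, hδ, h0, h1⟩ := exists_degLT_indicator (k := k) (V := V)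
  have := congrFun (DegLT.alternating_sum g U (n := 0) (hδ.mono (by lia))).eq_zero 0
  rw [Finset.sum_eq_single_of_mem ∅ (by simp)] at this
  · simp [h0] at this
  · intro T hT hne
    rw [h1, mul_zero]
    simpa using h T (Finset.mem_powerset.1 hT) (Finset.nonempty_iff_ne_empty.2 hne)

lemma exists_degLT_of_minimal_zero_sum [Fintype k] [Module.Finite k V] {ι : Type*} [DecidableEq ι]
    {g : ι → V}
    {W K : Finset ι} (hW : W.card = Module.finrank k V * (Fintype.card k - 1) + 1)
    (hsum : ∑ i ∈ W, g i = 0) (hmin : ∀ T ⊆ W, T.Nonempty → ∑ i ∈ T, g i = 0 → T = W)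
    (hK : K ⊆ W) (hne : K.Nonempty) :
    ∃ f : V → k, DegLT K.card f ∧ f 0 = 1 ∧ f (∑ i ∈ K, g i) = (-1) ^ (W.card - K.card) ∧
      ∀ T ⊂ K, T.Nonempty → f (∑ i ∈ T, g i) = 0 := by
  obtain ⟨δ, hδ, h0, h1⟩ := exists_degLT_indicator (k := k) (V := V)
  have hcard : K.card + (W \ K).card = W.card := by
    rw [add_comm]; exact Finset.card_sdiff_add_card_eq_card hK
  have key : ∀ T ⊆ K, ∀ T' ⊆ W \ K, T.Nonempty ∨ T'.Nonempty →
      ∑ i ∈ T, g i + ∑ i ∈ T', g i = 0 → T = K ∧ T' = W \ K := by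
    intro T hT T' hT' hne h
    have hd : Disjoint T T' := Finset.disjoint_of_subset_left hT
      (Finset.disjoint_of_subset_right hT' Finset.disjoint_sdiff)
    have hu : T ∪ T' = W := by
      apply hmin
      · exact Finset.union_subset (hT.trans hK) (hT'.trans Finset.sdiff_subset)
      · rcases hne with h | h
        · exact h.mono Finset.subset_union_left
        · exact h.mono Finset.subset_union_right
      · rw [Finset.sum_union hd, h]
    have hc := Finset.card_union_of_disjoint hd
    rw [hu] at hc
    have h1 := Finset.card_le_card hT
    have h2 := Finset.card_le_card hT'
    exact ⟨Finset.eq_of_subset_of_card_le hT (by lia), Finset.eq_of_subset_of_card_le hT' (by lia)⟩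
  refine ⟨_, DegLT.alternating_sum g (W \ K) (hδ.mono (by lia)), ?_, ?_, ?_⟩
  · rw [Finset.sum_eq_single_of_mem ∅ (by simp)]
    · simp [h0]
    · intro T hT hT0
      rw [h1, mul_zero]
      intro h
      rw [Finset.mem_powerset] at hT
      have := (key ∅ (by simp) T hT (Or.inr (Finset.nonempty_iff_ne_empty.2 hT0))
        (by simpa using h)).1
      exact hne.ne_empty this.symm
  · rw [Finset.sum_eq_single_of_mem (W \ K) (by simp)]
    · rw [add_comm, Finset.sum_sdiff hK, hsum, h0, mul_one, Finset.card_sdiff_of_subset hK]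
    · intro T hT hT0
      rw [h1, mul_zero]
      intro h
      rw [Finset.mem_powerset] at hT
      exact hT0 (key K subset_rfl T hT (Or.inl hne) h).2
  · intro T hT hTne
    refine Finset.sum_eq_zero fun T' hT' => ?_
    rw [h1, mul_zero]
    intro h
    exact hT.ne (key T hT.1 T' (Finset.mem_powerset.1 hT') (Or.inl hTne) h).1

end PolynomialMethod

section Plane
variable {k V : Type*} [Field k] [AddCommGroup V] [Module k V]

lemma functional_eq_of_pair (hV : Module.finrank k V = 2) {x y : V}
    (h : LinearIndependent k ![x, y]) {φ ψ : V →ₗ[k] k} (hx : φ x = ψ x) (hy : φ y = ψ y) :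
    φ = ψ := by
  refine (basisOfLinearIndependentOfCardEqFinrank h (by simp [hV])).ext fun i => ?_
  fin_cases i <;> simpa

lemma exists_smul_eq_of_functional_eq_zero (hV : Module.finrank k V = 2) {x y : V} (hx0 : x ≠ 0)
    {φ : V →ₗ[k] k} (hφ : φ ≠ 0) (hx : φ x = 0) (hy : φ y = 0) : ∃ c : k, c • x = y := by
  by_contra! h
  exact hφ (functional_eq_of_pair hV ((LinearIndependent.pair_iff' hx0).2 h) (by simpa) (by simpa))

lemma eq_of_three_values (hV : Module.finrank k V = 2) {a u v : V}
    (hau : LinearIndependent k ![a, u]) (hav : LinearIndependent k ![a, v])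
    (huv : LinearIndependent k ![u, v]) {φ ψ : V →ₗ[k] k} (hψ : ψ ≠ 0)
    (h1 : φ a = 1) (h2 : φ u = 1) (h3 : φ v = 1)
    (ha : ψ a = 0 ∨ ψ a = 1) (hu : ψ u = 0 ∨ ψ u = 1) (hv : ψ v = 0 ∨ ψ v = 1) : ψ = φ := by
  have two {x y : V} (h : LinearIndependent k ![x, y]) (hx : ψ x = 0) (hy : ψ y = 0) : False :=
    hψ (functional_eq_of_pair hV h (by simpa) (by simpa))
  rcases ha with ha | ha
  · rcases hu with hu | hu
    · exact (two hau ha hu).elim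
    rcases hv with hv | hv
    · exact (two hav ha hv).elim
    exact functional_eq_of_pair hV huv (hu.trans h2.symm) (hv.trans h3.symm)
  · rcases hu with hu | hu
    · rcases hv with hv | hv
      · exact (two huv hu hv).elim
      exact functional_eq_of_pair hV hav (ha.trans h1.symm) (hv.trans h3.symm)
    exact functional_eq_of_pair hV hau (ha.trans h1.symm) (hu.trans h2.symm)

/-- If any three further vectors of `D` lie, together with `a`, on two parallel lines
`φ = 0` and `φ = 1`, then so does the whole of `D`. -/
lemma exists_functional_forall_of_four (hV : Module.finrank k V = 2) (h3 : (3 : k) ≠ 0)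
    {D : Finset V} {a : V} (haD : a ∈ D) (hD : 4 ≤ D.card)
    (hind : ∀ x ∈ D, ∀ y ∈ D, x ≠ y → LinearIndependent k ![x, y])
    (hfour : ∀ u ∈ D, ∀ v ∈ D, ∀ w ∈ D, a ≠ u → a ≠ v → a ≠ w → u ≠ v → u ≠ w → v ≠ w →
      ∃ φ : V →ₗ[k] k, φ ≠ 0 ∧ (φ a = 0 ∨ φ a = 1) ∧ (φ u = 0 ∨ φ u = 1) ∧ (φ v = 0 ∨ φ v = 1) ∧
        (φ w = 0 ∨ φ w = 1)) :
    ∃ φ : V →ₗ[k] k, φ ≠ 0 ∧ ∀ x ∈ D, φ x = 0 ∨ φ x = 1 := by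
  classical
  have onLine {u v : V} {φ : V →ₗ[k] k} (hφ : φ ≠ 0) (hu : u ∈ D) (hv : v ∈ D) (hau : a ≠ u)
      (hav : a ≠ v) (huv : u ≠ v) (h1 : φ a = 1) (h2 : φ u = 1) (h3 : φ v = 1) :
      ∃ φ : V →ₗ[k] k, φ ≠ 0 ∧ ∀ x ∈ D, φ x = 0 ∨ φ x = 1 := by
    refine ⟨φ, hφ, fun x hx => ?_⟩
    by_cases hxa : a = x
    · exact Or.inr (hxa ▸ h1)
    by_cases hxu : u = x
    · exact Or.inr (hxu ▸ h2)
    by_cases hxv : v = x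
    · exact Or.inr (hxv ▸ h3)
    obtain ⟨ψ, hψ, e1, e2, e3, e4⟩ := hfour u hu v hv x hx hau hav hxa huv hxu hxv
    rwa [← eq_of_three_values hV (hind a haD u hu hau) (hind a haD v hv hav) (hind u hu v hv huv)
      hψ h1 h2 h3 e1 e2 e3]
  obtain ⟨t, ht, htc⟩ := Finset.exists_subset_card_eq
    (show 3 ≤ (D.erase a).card by rw [Finset.card_erase_of_mem haD]; lia)
  obtain ⟨u, v, w, huv, huw, hvw, rfl⟩ := Finset.card_eq_three.1 htc
  simp only [Finset.insert_subset_iff, Finset.singleton_subset_iff, Finset.mem_erase] at ht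
  obtain ⟨⟨hau, hu⟩, ⟨hav, hv⟩, haw, hw⟩ := ht
  replace hau := hau.symm
  replace hav := hav.symm
  replace haw := haw.symm
  obtain ⟨φ, hφ, e1, e2, e3, e4⟩ := hfour u hu v hv w hw hau hav haw huv huw hvw
  have two {x y : V} (h : LinearIndependent k ![x, y]) (hx : φ x = 0) (hy : φ y = 0) : False :=
    hφ (functional_eq_of_pair hV h (by simpa) (by simpa))
  rcases e1 with e1 | e1
  swap
  · rcases e2 with e2 | e2
    · rcases e3 with e3 | e3
      · exact (two (hind u hu v hv huv) e2 e3).elim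
      rcases e4 with e4 | e4
      · exact (two (hind u hu w hw huw) e2 e4).elim
      exact onLine hφ hv hw hav haw hvw e1 e3 e4
    rcases e3 with e3 | e3
    · rcases e4 with e4 | e4
      · exact (two (hind v hv w hw hvw) e3 e4).elim
      exact onLine hφ hu hw hau haw huw e1 e2 e4
    exact onLine hφ hu hv hau hav huv e1 e2 e3
  replace e2 := e2.resolve_left (two (hind a haD u hu hau) e1)
  replace e3 := e3.resolve_left (two (hind a haD v hv hav) e1)
  replace e4 := e4.resolve_left (two (hind a haD w hw haw) e1)
  have ha0 : a ≠ 0 := by simpa using (hind a haD u hu hau).ne_zero 0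
  have pair {u v x : V} (hu : u ∈ D) (hv : v ∈ D) (hx : x ∈ D) (hau : a ≠ u)
      (hav : a ≠ v) (hax : a ≠ x) (huv : u ≠ v) (hux : u ≠ x) (hvx : v ≠ x)
      (e2 : φ u = 1) (e3 : φ v = 1) : (φ x = 0 ∨ φ x = 1) ∨ u - v = a ∨ u - v = -a := by
    obtain ⟨ψ, hψ, f1, f2, f3, f4⟩ := hfour u hu v hv x hx hau hav hax huv hux hvx
    have twoψ {x y : V} (h : LinearIndependent k ![x, y]) (hx : ψ x = 0) (hy : ψ y = 0) : False :=
      hψ (functional_eq_of_pair hV h (by simpa) (by simpa))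
    obtain ⟨c, hc⟩ := exists_smul_eq_of_functional_eq_zero hV ha0 hφ e1
      (show φ (u - v) = 0 by rw [map_sub, e2, e3, sub_self])
    have hψc := congrArg ψ hc
    rw [map_sub, map_smul, smul_eq_mul] at hψc
    rcases f1 with f1 | f1
    · have g2 := f2.resolve_left (twoψ (hind a haD u hu hau) f1)
      rw [← functional_eq_of_pair hV (hind a haD u hu hau) (f1.trans e1.symm) (g2.trans e2.symm)]
      exact Or.inl f4
    · rw [f1, mul_one] at hψc
      rcases f2 with f2 | f2 <;> rcases f3 with f3 | f3
      · exact (twoψ (hind u hu v hv huv) f2 f3).elim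
      · refine Or.inr (Or.inr ?_)
        rw [← hc, hψc, f2, f3]
        simp
      · refine Or.inr (Or.inl ?_)
        rw [← hc, hψc, f2, f3]
        simp
      · have := functional_eq_of_pair hV (hind u hu v hv huv) (f2.trans e2.symm) (f3.trans e3.symm)
        rw [this, e1] at f1
        exact (zero_ne_one f1).elim
  refine ⟨φ, hφ, fun x hx => ?_⟩
  by_cases hxa : a = x
  · exact Or.inl (hxa ▸ e1)
  by_cases hxu : u = x
  · exact Or.inr (hxu ▸ e2)
  by_cases hxv : v = x
  · exact Or.inr (hxv ▸ e3)
  by_cases hxw : w = x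
  · exact Or.inr (hxw ▸ e4)
  have smul_a {c : k} (hc : c • a = 0) : c = 0 := (smul_eq_zero.1 hc).resolve_right ha0
  rcases pair hu hv hx hau hav hxa huv hxu hxv e2 e3 with h | h
  · exact h
  rcases pair hv hw hx hav haw hxa hvw hxv hxw e3 e4 with h' | h'
  · exact h'
  rcases pair hu hw hx hau haw hxa huw hxu hxw e2 e4 with h'' | h''
  · exact h''
  exfalso
  have hsum : (u - v) + (v - w) = u - w := by abel
  rcases h with h | h <;> rcases h' with h' | h' <;> rcases h'' with h'' | h'' <;>
    rw [h, h', h''] at hsum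
  · exact one_ne_zero (smul_a (c := 1) (by linear_combination (norm := module) hsum))
  · exact h3 (smul_a (by linear_combination (norm := module) hsum))
  · exact one_ne_zero (smul_a (c := 1) (by linear_combination (norm := module) -hsum))
  · exact one_ne_zero (smul_a (c := 1) (by linear_combination (norm := module) hsum))
  · exact one_ne_zero (smul_a (c := 1) (by linear_combination (norm := module) -hsum))
  · exact one_ne_zero (smul_a (c := 1) (by linear_combination (norm := module) hsum))
  · exact h3 (smul_a (by linear_combination (norm := module) -hsum))
  · exact one_ne_zero (smul_a (c := 1) (by linear_combination (norm := module) -hsum))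

end Plane

section MinimalZeroSum
variable {k V ι : Type*} [Field k] [AddCommGroup V] [Module k V]

lemma functional_eq_smul_coord_add (b : Module.Basis (Fin 2) k V) (l : V →ₗ[k] k) :
    ∃ c c' : k, l = c • b.coord 0 + c' • b.coord 1 := by
  refine ⟨l (b 0), l (b 1), b.ext fun i => ?_⟩
  fin_cases i <;> simp

lemma coord_mul_coord_ne (b : Module.Basis (Fin 2) k V) {u v : V}
    (h : LinearIndependent k ![u, v]) :
    b.coord 0 u * b.coord 1 v ≠ b.coord 0 v * b.coord 1 u := by
  intro he
  have hzero {w : V} (h₀ : b.coord 0 w = 0) (h₁ : b.coord 1 w = 0) : w = 0 :=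
    b.forall_coord_eq_zero_iff.1 fun i => by fin_cases i <;> assumption
  rw [LinearIndependent.pair_iff] at h
  have h₁ := h (b.coord 1 v) (-b.coord 1 u) (hzero
    (by simp only [map_add, map_smul, smul_eq_mul]; linear_combination he)
    (by simp only [map_add, map_smul, smul_eq_mul]; ring))
  have h₂ := h (b.coord 0 v) (-b.coord 0 u) (hzero
    (by simp only [map_add, map_smul, smul_eq_mul]; ring)
    (by simp only [map_add, map_smul, smul_eq_mul]; linear_combination -he))
  have hu : u = 0 := hzero (neg_eq_zero.1 h₂.2) (neg_eq_zero.1 h₁.2)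
  exact one_ne_zero (h 1 0 (by simp [hu])).1

variable [Fintype k] {g : ι → V} {W : Finset ι}

lemma linearIndependent_of_minimal_zero_sum (hV : Module.finrank k V = 2)
    (hW : W.card = 2 * (Fintype.card k - 1) + 1) (hsum : ∑ i ∈ W, g i = 0)
    (hmin : ∀ T ⊆ W, T.Nonempty → ∑ i ∈ T, g i = 0 → T = W) {i j : ι} (hi : i ∈ W) (hj : j ∈ W)
    (hij : g i ≠ g j) : LinearIndependent k ![g i, g j] := by
  classical
  have : Module.Finite k V := Module.finite_of_finrank_pos (by lia)
  have hk : 1 < Fintype.card k := Fintype.one_lt_card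
  have hi0 : g i ≠ 0 := by
    intro h
    have := congrArg Finset.card (hmin {i} (by simpa) (by simp) (by simpa))
    rw [Finset.card_singleton] at this
    lia
  have hne : i ≠ j := fun h => hij (h ▸ rfl)
  obtain ⟨f, hf, hf0, -, hfs⟩ := exists_degLT_of_minimal_zero_sum (k := k) (K := {i, j})
    (by rwa [hV]) hsum hmin (by simp [Finset.insert_subset_iff, hi, hj]) (by simp)
  rw [Finset.card_pair hne] at hf
  have hfi := hfs {i} (by rw [Finset.ssubset_iff]; exact ⟨j, by simpa using hne.symm, by grind⟩)
    (by simp)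
  have hfj := hfs {j} (by rw [Finset.ssubset_iff]; exact ⟨i, by simpa using hne, by grind⟩)
    (by simp)
  rw [Finset.sum_singleton] at hfi hfj
  obtain ⟨a, b, c, hfabc⟩ := hf.exists_affine
    (functional_eq_smul_coord_add (Module.finBasisOfFinrankEq k V hV))
  rw [hfabc] at hf0 hfi hfj
  simp only [map_zero, mul_zero, add_zero] at hf0
  subst hf0
  refine (LinearIndependent.pair_iff' hi0).2 fun c hc => hij ?_
  rw [← hc] at hfj ⊢
  simp only [map_smul, smul_eq_mul] at hfj
  rw [show c = 1 by linear_combination c * hfi - hfj, one_smul]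

/-- Five members of a minimal zero-sum family of maximal length produce an even quartic polynomial
`H` whose value at every signed sum of these members, not all signs being equal, vanishes. -/
lemma exists_even_quartic_of_minimal_zero_sum (b : Module.Basis (Fin 2) k V) (h2 : (2 : k) ≠ 0)
    (hW : W.card = 2 * (Fintype.card k - 1) + 1) (hsum : ∑ i ∈ W, g i = 0)
    (hmin : ∀ T ⊆ W, T.Nonempty → ∑ i ∈ T, g i = 0 → T = W) {e : Fin 5 → ι}
    (he : Function.Injective e) (heW : ∀ t, e t ∈ W) :
    ∃ a₀ a₁ a₂ a₃ a₄ b₀ b₁ b₂ c₀ : k, ∀ (A : Finset (Fin 5)) (x y : k),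
      x = ∑ t, (if t ∈ A then 1 else -1) * b.coord 0 (g (e t)) →
      y = ∑ t, (if t ∈ A then 1 else -1) * b.coord 1 (g (e t)) →
      a₀ * x ^ 4 + a₁ * x ^ 3 * y + a₂ * x ^ 2 * y ^ 2 + a₃ * x * y ^ 3 + a₄ * y ^ 4
        + b₀ * x ^ 2 + b₁ * x * y + b₂ * y ^ 2 + c₀ = if A = ∅ ∨ A = Finset.univ then 2 else 0 := by
  classical
  have : Module.Finite k V := Module.Finite.of_basis b
  have hV : Module.finrank k V = 2 := by simp [Module.finrank_eq_card_basis b]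
  let σ (A : Finset (Fin 5)) : V := ∑ t ∈ A, g (e t)
  have hσ (A : Finset (Fin 5)) : ∑ i ∈ A.image e, g i = σ A := Finset.sum_image he.injOn
  have hcard : (Finset.univ.image e).card = 5 := by
    rw [Finset.card_image_of_injective _ he]; rfl
  have hKW : Finset.univ.image e ⊆ W := by simpa [Finset.subset_iff] using heW
  have hle := Finset.card_le_card hKW
  obtain ⟨f, hf, hf0, hfK, hfs⟩ := exists_degLT_of_minimal_zero_sum (k := k)
    (K := Finset.univ.image e) (by rwa [hV]) hsum hmin hKW (by simp)
  rw [hcard] at hf hfK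
  rw [hσ, hW, Even.neg_one_pow ⟨Fintype.card k - 1 - 2, by lia⟩] at hfK
  replace hfs (A : Finset (Fin 5)) (hA : A.Nonempty) (hA' : A ≠ Finset.univ) : f (σ A) = 0 := by
    rw [← hσ]
    refine hfs _ ?_ (hA.image e)
    rw [Finset.image_ssubset_image he]
    exact A.subset_univ.ssubset_of_ne hA'
  obtain ⟨a₀, a₁, a₂, a₃, a₄, b₀, b₁, b₂, c₀, hH⟩ :=
    (hf.comp_affine ((2⁻¹ : k) • LinearMap.id) ((2⁻¹ : k) • σ Finset.univ)).exists_even_quartic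
      (functional_eq_smul_coord_add b)
  refine ⟨a₀, a₁, a₂, a₃, a₄, b₀, b₁, b₂, c₀, fun A x y hx hy => ?_⟩
  have hs : σ Finset.univ = σ A + σ Aᶜ := (Finset.sum_add_sum_compl A _).symm
  have hl (l : V →ₗ[k] k) : l (σ A - σ Aᶜ) = ∑ t, (if t ∈ A then 1 else -1) * l (g (e t)) := by
    rw [← Finset.sum_add_sum_compl A, sub_eq_add_neg, map_add, map_neg, map_sum, map_sum,
      ← Finset.sum_neg_distrib]
    congr 1 <;> refine Finset.sum_congr rfl fun t ht => ?_
    · simp [ht]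
    · simp [Finset.mem_compl.1 ht]
  have h := hH (σ A - σ Aᶜ)
  rw [hl, hl, ← hx, ← hy] at h
  rw [← h, hs]
  have hpos : f (((2⁻¹ : k) • LinearMap.id : V →ₗ[k] V) (σ A - σ Aᶜ) + (2⁻¹ : k) • (σ A + σ Aᶜ)) =
      f (σ A) := by
    congr 1
    simp only [LinearMap.smul_apply, LinearMap.id_apply, ← smul_add]
    rw [show σ A - σ Aᶜ + (σ A + σ Aᶜ) = (2 : k) • σ A by module, inv_smul_smul₀ h2]
  have hneg : f (((2⁻¹ : k) • LinearMap.id : V →ₗ[k] V) (-(σ A - σ Aᶜ)) +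
      (2⁻¹ : k) • (σ A + σ Aᶜ)) = f (σ Aᶜ) := by
    congr 1
    simp only [LinearMap.smul_apply, LinearMap.id_apply, ← smul_add]
    rw [show -(σ A - σ Aᶜ) + (σ A + σ Aᶜ) = (2 : k) • σ Aᶜ by module, inv_smul_smul₀ h2]
  rw [hpos, hneg]
  split_ifs with hA
  · rcases hA with rfl | rfl
    · rw [Finset.compl_empty, hfK]
      simp only [σ, Finset.sum_empty, hf0]
      norm_num
    · rw [Finset.compl_univ, hfK]
      simp only [σ, Finset.sum_empty, hf0]
      norm_num
  · rw [not_or] at hA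
    rw [hfs A (Finset.nonempty_iff_ne_empty.2 hA.1) hA.2,
      hfs Aᶜ (by simpa [Finset.nonempty_iff_ne_empty] using hA.2) (by simpa using hA.1), add_zero]

lemma exists_functional_of_minimal_zero_sum (hV : Module.finrank k V = 2)
    (h2 : (2 : k) ≠ 0) (h3 : (3 : k) ≠ 0)
    (hW : W.card = 2 * (Fintype.card k - 1) + 1) (hsum : ∑ i ∈ W, g i = 0)
    (hmin : ∀ T ⊆ W, T.Nonempty → ∑ i ∈ T, g i = 0 → T = W) {i j i₁ i₂ i₃ : ι}
    (hi : i ∈ W) (hj : j ∈ W) (hi₁ : i₁ ∈ W) (hi₂ : i₂ ∈ W) (hi₃ : i₃ ∈ W)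
    (hij : i ≠ j) (hgij : g i = g j) (h₁ : g i ≠ g i₁) (h₂ : g i ≠ g i₂) (h₃ : g i ≠ g i₃)
    (h₁₂ : g i₁ ≠ g i₂) (h₁₃ : g i₁ ≠ g i₃) (h₂₃ : g i₂ ≠ g i₃) :
    ∃ φ : V →ₗ[k] k, φ ≠ 0 ∧ (φ (g i) = 0 ∨ φ (g i) = 1) ∧ (φ (g i₁) = 0 ∨ φ (g i₁) = 1) ∧
      (φ (g i₂) = 0 ∨ φ (g i₂) = 1) ∧ (φ (g i₃) = 0 ∨ φ (g i₃) = 1) := by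
  classical
  have : Module.Finite k V := Module.finite_of_finrank_pos (by lia)
  have ind {i j : ι} (hi : i ∈ W) (hj : j ∈ W) (hij : g i ≠ g j) :
      LinearIndependent k ![g i, g j] :=
    linearIndependent_of_minimal_zero_sum hV hW hsum hmin hi hj hij
  let b := basisOfLinearIndependentOfCardEqFinrank (ind hi hi₁ h₁) (by simp [hV])
  have hb₀ : b 0 = g i := by simp [b]
  have hb₁ : b 1 = g i₁ := by simp [b]
  have hX : b.coord 0 (g i) = 1 := by rw [← hb₀]; simp
  have hY : b.coord 1 (g i) = 0 := by rw [← hb₀]; simp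
  have he : Function.Injective ![i, j, i₁, i₂, i₃] := by
    refine List.nodup_ofFn.1 ?_
    simp only [List.ofFn_succ]
    simp
    grind
  obtain ⟨a₀, a₁, a₂, a₃, a₄, b₀, b₁, b₂, c₀, eval⟩ :=
    exists_even_quartic_of_minimal_zero_sum b h2 hW hsum hmin he
      fun t => by fin_cases t <;> assumption
  have eval_zero (A : Finset (Fin 5)) {x y : k} (hA : ¬(A = ∅ ∨ A = Finset.univ)) (hx) (hy) :=
    (eval A x y hx hy).trans (if_neg hA)
  have sum_eq (A : Finset (Fin 5)) (l : V →ₗ[k] k) :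
      ∑ t, (if t ∈ A then 1 else -1) * l (g (![i, j, i₁, i₂, i₃] t)) =
        (if 0 ∈ A then 1 else -1) * l (g i) +
        (if 1 ∈ A then 1 else -1) * l (g i) + (if 2 ∈ A then 1 else -1) * l (g i₁) +
        (if 3 ∈ A then 1 else -1) * l (g i₂) + (if 4 ∈ A then 1 else -1) * l (g i₃) := by
    simp [Fin.sum_univ_five, hgij]
  obtain ⟨u, v, huv, e₀, e₁, e₂, e₃⟩ := exists_functional_of_even_quartic h2 h3
    (x₁ := b.coord 0 (g i₁)) (x₂ := b.coord 0 (g i₂)) (x₃ := b.coord 0 (g i₃))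
    (y₁ := b.coord 1 (g i₁)) (y₂ := b.coord 1 (g i₂)) (y₃ := b.coord 1 (g i₃))
    (by simpa [hX, hY] using coord_mul_coord_ne b (ind hi hi₁ h₁))
    (by simpa [hX, hY] using coord_mul_coord_ne b (ind hi hi₂ h₂))
    (by simpa [hX, hY] using coord_mul_coord_ne b (ind hi hi₃ h₃))
    (coord_mul_coord_ne b (ind hi₁ hi₂ h₁₂)) (coord_mul_coord_ne b (ind hi₁ hi₃ h₁₃))
    (coord_mul_coord_ne b (ind hi₂ hi₃ h₂₃)) (fun _ _ => rfl)
    (by rw [eval Finset.univ _ _ (by rw [sum_eq, hX]; simp; ring) (by rw [sum_eq, hY]; simp)]; simp)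
    (eval_zero {0, 1, 2, 3} (by decide)
      (by rw [sum_eq, hX]; simp; ring) (by rw [sum_eq, hY]; simp; ring))
    (eval_zero {0, 1, 2, 4} (by decide)
      (by rw [sum_eq, hX]; simp; ring) (by rw [sum_eq, hY]; simp; ring))
    (eval_zero {0, 1, 2} (by decide)
      (by rw [sum_eq, hX]; simp; ring) (by rw [sum_eq, hY]; simp; ring))
    (eval_zero {0, 1, 3, 4} (by decide)
      (by rw [sum_eq, hX]; simp; ring) (by rw [sum_eq, hY]; simp))
    (eval_zero {0, 1, 3} (by decide)
      (by rw [sum_eq, hX]; simp; ring) (by rw [sum_eq, hY]; simp; ring))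
    (eval_zero {0, 1, 4} (by decide)
      (by rw [sum_eq, hX]; simp; ring) (by rw [sum_eq, hY]; simp; ring))
    (eval_zero {0, 1} (by decide)
      (by rw [sum_eq, hX]; simp; ring) (by rw [sum_eq, hY]; simp; ring))
    (eval_zero {0, 2, 3, 4} (by decide)
      (by rw [sum_eq, hX]; simp) (by rw [sum_eq, hY]; simp))
    (eval_zero {0, 2, 3} (by decide)
      (by rw [sum_eq, hX]; simp; ring) (by rw [sum_eq, hY]; simp; ring))
    (eval_zero {0, 2, 4} (by decide)
      (by rw [sum_eq, hX]; simp; ring) (by rw [sum_eq, hY]; simp; ring))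
    (eval_zero {0, 3, 4} (by decide)
      (by rw [sum_eq, hX]; simp) (by rw [sum_eq, hY]; simp))
  refine ⟨u • b.coord 0 + v • b.coord 1, fun h0 => ?_, ?_, ?_, ?_, ?_⟩
  · have hu := LinearMap.congr_fun h0 (b 0)
    have hv := LinearMap.congr_fun h0 (b 1)
    simp at hu hv
    tauto
  · simpa [hX, hY, -Module.Basis.coord_apply] using e₀
  · exact e₁
  · exact e₂
  · exact e₃

end MinimalZeroSum

section ShortZeroSum
variable {p : ℕ} {V ι : Type*} [AddCommGroup V]

/-- A family has no nonempty zero-sum subfamily with at most `p` members. -/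
def ShortFree (p : ℕ) (g : ι → V) : Prop :=
  ∀ T : Finset ι, T.Nonempty → T.card ≤ p → ∑ i ∈ T, g i ≠ 0

namespace ShortFree
variable {g : ι → V}

lemma eq_of_subset (h : ShortFree p g) {T T' : Finset ι} (hT : T.card ≤ 2 * p)
    (hsum : ∑ i ∈ T, g i = 0) (hsub : T' ⊆ T) (hne : T'.Nonempty)
    (hsum' : ∑ i ∈ T', g i = 0) : T' = T := by
  classical
  by_contra hne'
  have h₁ : p < T'.card := lt_of_not_ge fun hle => h T' hne hle hsum'
  have h₂ : p < (T \ T').card := lt_of_not_ge fun hle =>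
    h (T \ T') (Finset.sdiff_nonempty.2 fun hs => hne' (hsub.antisymm hs)) hle (by
      rw [← Finset.sum_sdiff hsub, hsum', add_zero] at hsum
      exact hsum)
  have := Finset.card_sdiff_add_card_eq_card hsub
  lia

variable [Fact p.Prime] [Module (ZMod p) V]

lemma card_le [Fintype ι] (h : ShortFree p g) (hV : Module.finrank (ZMod p) V = 2) :
    Fintype.card ι ≤ 3 * p - 3 := by
  classical
  have : Module.Finite (ZMod p) V := Module.finite_of_finrank_pos (by lia)
  have hp := (Fact.out : p.Prime).two_le
  by_contra! hlt
  obtain ⟨U, -, hU⟩ := Finset.exists_subset_card_eq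
    (show 3 * p - 2 ≤ (Finset.univ : Finset ι).card by rw [Finset.card_univ]; lia)
  obtain ⟨T, hTU, hT, hT0⟩ := exists_zero_sum_subset (k := ZMod p) (fun i => (g i, (1 : ZMod p))) U
    (by rw [Module.finrank_prod, hV, Module.finrank_self, ZMod.card]; lia)
  rw [Prod.ext_iff, Prod.fst_sum, Prod.snd_sum] at hT0
  obtain ⟨hT₁, hT₂⟩ := hT0
  simp only [Finset.sum_const, nsmul_eq_mul, mul_one, Prod.fst_zero, Prod.snd_zero,
    ZMod.natCast_eq_zero_iff] at hT₁ hT₂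
  have hle := Finset.card_le_card hTU
  have hp' : p < T.card := lt_of_not_ge fun hle => h T hT hle hT₁
  obtain ⟨c, hc⟩ := hT₂
  have hc2 : c = 2 := by
    have h₁ : 1 < c := by by_contra! hc1; nlinarith
    have h₂ : c < 3 := by by_contra! hc1; have := Nat.mul_le_mul_left p hc1; lia
    lia
  subst hc2
  obtain ⟨i, hi⟩ := hT
  obtain ⟨T', hT', hne, hs⟩ := exists_zero_sum_subset (k := ZMod p) g (T.erase i)
    (by rw [hV, ZMod.card, Finset.card_erase_of_mem hi]; lia)
  have := h.eq_of_subset (by lia) hT₁ (hT'.trans (Finset.erase_subset i T)) hne hs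
  exact Finset.notMem_erase i T (hT' (this ▸ hi))

lemma exists_zero_sum_of_card_eq [Fintype ι] (h : ShortFree p g)
    (hV : Module.finrank (ZMod p) V = 2) (hι : Fintype.card ι = 3 * p - 3) :
    ∃ W : Finset ι, W.card = 2 * p - 1 ∧ ∑ i ∈ W, g i = 0 := by
  classical
  have : Module.Finite (ZMod p) V := Module.finite_of_finrank_pos (by lia)
  have hp := (Fact.out : p.Prime).two_le
  obtain ⟨T, -, hT, hT0⟩ := exists_zero_sum_subset (k := ZMod p)
    (fun i : Option ι => (i.elim 0 g, (1 : ZMod p))) Finset.univ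
    (by rw [Module.finrank_prod, hV, Module.finrank_self, ZMod.card, Finset.card_univ,
          Fintype.card_option]; lia)
  rw [Prod.ext_iff, Prod.fst_sum, Prod.snd_sum] at hT0
  obtain ⟨hT₁, hT₂⟩ := hT0
  simp only [Finset.sum_const, nsmul_eq_mul, mul_one, Prod.fst_zero, Prod.snd_zero,
    ZMod.natCast_eq_zero_iff] at hT₁ hT₂
  have hle : T.card ≤ 3 * p - 2 := by
    have := Finset.card_le_univ T
    rw [Fintype.card_option] at this
    lia
  have hsum : ∑ i ∈ T.eraseNone, g i = 0 := by
    rw [← hT₁, Finset.sum_subset (Finset.subset_insert none T), ← Finset.insertNone_eraseNone,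
      Finset.sum_insertNone]
    · simp
    · simp_all
  obtain ⟨c, hc⟩ := hT₂
  have hpos := hT.card_pos
  have hc3 : c < 3 := by by_contra! hc1; have := Nat.mul_le_mul_left p hc1; lia
  have hc0 : c ≠ 0 := by rintro rfl; lia
  have hE := Finset.card_eraseNone_le (s := T)
  have hE' : T.card ≤ T.eraseNone.card + 1 := by
    rw [← Finset.card_insertNone, Finset.insertNone_eraseNone]
    exact Finset.card_le_card (Finset.subset_insert _ _)
  have hne : T.eraseNone.Nonempty := by
    rw [← Finset.card_pos]
    nlinarith [Nat.one_le_iff_ne_zero.2 hc0]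
  have hlt : p < T.eraseNone.card := lt_of_not_ge fun hle => h _ hne hle hsum
  have hc2 : c = 2 := by
    rcases (by lia : c = 1 ∨ c = 2) with rfl | rfl
    · lia
    · rfl
  subst hc2
  rcases (by lia : T.eraseNone.card = 2 * p - 1 ∨ T.eraseNone.card = 2 * p) with hW | hW
  · exact ⟨_, hW, hsum⟩
  exfalso
  obtain ⟨i, hi⟩ := hne
  obtain ⟨T', hT', hne, hs⟩ := exists_zero_sum_subset (k := ZMod p) g (T.eraseNone.erase i)
    (by rw [hV, ZMod.card, Finset.card_erase_of_mem hi]; lia)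
  have := h.eq_of_subset (by lia) hsum (hT'.trans (Finset.erase_subset i _)) hne hs
  exact Finset.notMem_erase i T.eraseNone (hT' (this ▸ hi))

/-- In a plane, a family of multiplicities at most four without short zero-sum subfamilies does not
attain the bound of `ShortFree.card_le`. -/
lemma card_le_of_card_fiber_le_four [Fintype ι] [DecidableEq V] (h : ShortFree p g)
    (hV : Module.finrank (ZMod p) V = 2) (hp7 : 7 ≤ p)
    (hmult : ∀ v, (Finset.univ.filter fun i => g i = v).card ≤ 4) :
    Fintype.card ι ≤ 3 * p - 4 := by
  have : Module.Finite (ZMod p) V := Module.finite_of_finrank_pos (by lia)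
  have : Finite V := Module.finite_of_finite (ZMod p)
  by_contra! hlt
  obtain ⟨W, hW, hsum⟩ := h.exists_zero_sum_of_card_eq hV (le_antisymm (h.card_le hV) (by lia))
  have hmin : ∀ T ⊆ W, T.Nonempty → ∑ i ∈ T, g i = 0 → T = W := fun T hT hne hT0 =>
    h.eq_of_subset (by lia) hsum hT hne hT0
  have hW' : W.card = 2 * (Fintype.card (ZMod p) - 1) + 1 := by rw [ZMod.card]; lia
  have ind {i j : ι} (hi : i ∈ W) (hj : j ∈ W) (hij : g i ≠ g j) :
      LinearIndependent (ZMod p) ![g i, g j] :=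
    linearIndependent_of_minimal_zero_sum hV hW' hsum hmin hi hj hij
  have cast_ne {n : ℕ} (h0 : 0 < n) (hn : n < p) : ((n : ℕ) : ZMod p) ≠ 0 := by
    rw [Ne, ZMod.natCast_eq_zero_iff]
    exact Nat.not_dvd_of_pos_of_lt h0 hn
  have h2 : (2 : ZMod p) ≠ 0 := mod_cast cast_ne (n := 2) (by lia) (by lia)
  have h3 : (3 : ZMod p) ≠ 0 := mod_cast cast_ne (n := 3) (by lia) (by lia)
  have hfib (v : V) : (W.filter fun i => g i = v).card ≤ 4 :=
    (Finset.card_le_card (Finset.filter_subset_filter _ W.subset_univ)).trans (hmult v)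
  have hD : 4 ≤ (W.image g).card := by
    have := Finset.card_le_mul_card_image W 4 fun v _ => hfib v
    lia
  obtain ⟨i, hi, j, hj, hij, hgij⟩ : ∃ i ∈ W, ∃ j ∈ W, i ≠ j ∧ g i = g j := by
    by_contra! hinj
    have h0 (i : ι) : g i ≠ 0 := by
      simpa using h {i} (by simp) (by rw [Finset.card_singleton]; lia)
    have hle := Nat.card_le_card_of_injective
      (fun i : W => Projectivization.mk (ZMod p) (g i) (h0 i)) fun i j hij => by
        by_contra hne
        rw [Projectivization.mk_eq_mk_iff'] at hij
        obtain ⟨c, hc⟩ := hij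
        have hji := hinj j j.2 i i.2 fun h => hne (Subtype.ext h.symm)
        exact (LinearIndependent.pair_iff' (h0 j)).1 (ind j.2 i.2 hji) c hc
    rw [Projectivization.card_of_finrank_two _ _ hV, Nat.card_eq_fintype_card, Fintype.card_coe,
      Nat.card_zmod] at hle
    lia
  obtain ⟨φ, hφ, hφD⟩ := exists_functional_forall_of_four hV h3 (Finset.mem_image_of_mem g hi) hD
    (by
      simp only [Finset.forall_mem_image]
      exact fun i hi j hj hij => ind hi hj hij)
    (by
      simp only [Finset.forall_mem_image]
      exact fun _ hi₁ _ hi₂ _ hi₃ => exists_functional_of_minimal_zero_sum hV h2 h3 hW' hsum hmin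
        hi hj hi₁ hi₂ hi₃ hij hgij)
  rw [Finset.forall_mem_image] at hφD
  have hzero : (W.filter fun i => φ (g i) = 0).card ≤ 4 := by
    rcases (W.filter fun i => φ (g i) = 0).eq_empty_or_nonempty with he | ⟨t, ht⟩
    · simp [he]
    rw [Finset.mem_filter] at ht
    refine (Finset.card_le_card fun s hs => ?_).trans (hfib (g t))
    rw [Finset.mem_filter] at hs ⊢
    refine ⟨hs.1, ?_⟩
    by_contra hne
    exact hφ (functional_eq_of_pair hV (ind hs.1 ht.1 hne) (by simpa using hs.2)
      (by simpa using ht.2))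
  have hone : p ∣ (W.filter fun i => ¬φ (g i) = 0).card := by
    have hφsum : ∑ i ∈ W, φ (g i) = 0 := by rw [← map_sum, hsum, map_zero]
    rw [← ZMod.natCast_eq_zero_iff, Finset.card_filter, Nat.cast_sum]
    refine (Finset.sum_congr rfl fun i hi => ?_).trans hφsum
    rcases hφD hi with h | h <;> simp [h]
  have hadd := Finset.card_filter_add_card_filter_not (s := W) fun i => φ (g i) = 0
  obtain ⟨c, hc⟩ := hone
  rcases Nat.lt_or_ge c 2 with hc2 | hc2
  · have := Nat.mul_le_mul_left p (Nat.le_of_lt_succ hc2)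
    lia
  · have := Nat.mul_le_mul_left p hc2
    lia

end ShortFree
end ShortZeroSum

section Counting

lemma card_add_mul_le_of_card_plane_le {k V ι : Type*} [Field k] [Finite k] [AddCommGroup V]
    [Module k V] [Module.Finite k V] [Fintype ι] [DecidableEq ι] {g : ι → V} {a : V} (ha : a ≠ 0)
    {B d : ℕ} (hd : Module.finrank k V = d + 1)
    [DecidablePred fun j => g j ∈ Submodule.span k {a}]
    (hB : ∀ b, LinearIndependent k ![a, b] → ∀ U : Finset ι,
      (∀ j ∈ U, g j ∈ Submodule.span k {a, b}) → U.card ≤ B) :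
    Fintype.card ι + (∑ i ∈ Finset.range d, Nat.card k ^ i) *
      (Finset.univ.filter fun j => g j ∈ Submodule.span k {a}).card ≤
    (Finset.univ.filter fun j => g j ∈ Submodule.span k {a}).card +
      (∑ i ∈ Finset.range d, Nat.card k ^ i) * B := by
  classical
  have : Finite V := Module.finite_of_finite k
  let L := Submodule.span k {a}
  have : Finite (V ⧸ L) := Module.finite_of_finite k
  let : Fintype (Projectivization k (V ⧸ L)) := Fintype.ofFinite _
  have hQ : Module.finrank k (V ⧸ L) = d := by
    have h₁ := L.finrank_quotient_add_finrank
    rw [finrank_span_singleton ha] at h₁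
    lia
  have h0 (j : {j // g j ∉ L}) : L.mkQ (g j) ≠ 0 := by simpa using j.2
  let f (j : {j // g j ∉ L}) : Projectivization k (V ⧸ L) := .mk k (L.mkQ (g j)) (h0 j)
  have hfib (q : Projectivization k (V ⧸ L)) :
      (Finset.univ.filter fun j => f j = q).card +
        (Finset.univ.filter fun j => g j ∈ L).card ≤ B := by
    induction q using Projectivization.ind with | h w hw =>
    obtain ⟨b, rfl⟩ := L.mkQ_surjective w
    have hind : LinearIndependent k ![a, b] := by
      refine (LinearIndependent.pair_iff' ha).2 fun c hc => hw ?_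
      rw [Submodule.mkQ_apply, Submodule.Quotient.mk_eq_zero, ← hc]
      exact L.smul_mem c (Submodule.mem_span_singleton_self a)
    have hdisj : Disjoint
        ((Finset.univ.filter fun j => f j = .mk k (L.mkQ b) hw).map (.subtype _))
        (Finset.univ.filter fun j => g j ∈ L) := by
      rw [Finset.disjoint_left]
      intro j hj
      obtain ⟨j, -, rfl⟩ := Finset.mem_map.1 hj
      simpa using j.2
    rw [← Finset.card_map (.subtype _), ← Finset.card_union_of_disjoint hdisj]
    refine hB b hind _ fun j hj => ?_
    rcases Finset.mem_union.1 hj with hj | hj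
    · obtain ⟨j, hj', rfl⟩ := Finset.mem_map.1 hj
      obtain ⟨c, hc⟩ := (Projectivization.mk_eq_mk_iff' ..).1 (Finset.mem_filter.1 hj').2
      rw [← map_smul, eq_comm, ← sub_eq_zero, ← map_sub, Submodule.mkQ_apply,
        Submodule.Quotient.mk_eq_zero, Submodule.mem_span_singleton] at hc
      obtain ⟨c', hc'⟩ := hc
      exact Submodule.mem_span_pair.2 ⟨c', c, by rw [hc']; simp⟩
    · exact Submodule.span_mono (by simp) (Finset.mem_filter.1 hj).2
  have hN : Fintype.card (Projectivization k (V ⧸ L)) = ∑ i ∈ Finset.range d, Nat.card k ^ i := by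
    rw [← Nat.card_eq_fintype_card, Projectivization.card_of_finrank k _ hQ]
  have hoff : Fintype.card {j // g j ∉ L} = ∑ q, (Finset.univ.filter fun j => f j = q).card :=
    Finset.card_eq_sum_card_fiberwise (by simp)
  have hsum := Finset.sum_le_sum fun q (_ : q ∈ Finset.univ) => hfib q
  rw [Finset.sum_add_distrib, ← hoff, Finset.sum_const, Finset.sum_const, Finset.card_univ, hN,
    smul_eq_mul, smul_eq_mul] at hsum
  have hall := Fintype.card_subtype_compl fun j => g j ∈ L
  have hle := Fintype.card_subtype_le fun j => g j ∈ L
  rw [Fintype.card_subtype fun j => g j ∈ L] at hall hle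
  lia

lemma card_le_mul_of_card_line_le {k V ι : Type*} [Field k] [Finite k] [AddCommGroup V]
    [Module k V] [Module.Finite k V] [Fintype ι] {g : ι → V} (h0 : ∀ i, g i ≠ 0)
    {m d : ℕ} (hd : Module.finrank k V = d)
    [∀ i, DecidablePred fun j => g j ∈ Submodule.span k {g i}]
    (hm : ∀ i, (Finset.univ.filter fun j => g j ∈ Submodule.span k {g i}).card ≤ m) :
    Fintype.card ι ≤ m * ∑ i ∈ Finset.range d, Nat.card k ^ i := by
  classical
  have : Finite V := Module.finite_of_finite k
  let : Fintype (Projectivization k V) := Fintype.ofFinite _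
  rw [← Projectivization.card_of_finrank k V hd, Nat.card_eq_fintype_card, ← Finset.card_univ,
    ← Finset.card_univ]
  refine Finset.card_le_mul_card_image_of_maps_to
    (f := fun i => Projectivization.mk k (g i) (h0 i)) (by simp) m fun q _ => ?_
  rcases (Finset.univ.filter fun i => Projectivization.mk k (g i) (h0 i) = q).eq_empty_or_nonempty
    with he | ⟨i, hi⟩
  · simp [he]
  refine (Finset.card_le_card fun j hj => ?_).trans (hm i)
  rw [Finset.mem_filter] at hi hj
  obtain ⟨c, hc⟩ := (Projectivization.mk_eq_mk_iff' ..).1 (hj.2.trans hi.2.symm)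
  exact Finset.mem_filter.2 ⟨hj.1, Submodule.mem_span_singleton.2 ⟨c, hc⟩⟩

end Counting

namespace ShortFree
variable {p : ℕ} {V ι : Type*} [AddCommGroup V] {g : ι → V}

lemma codRestrict {k : Type*} [Ring k] [Module k V] (h : ShortFree p g) {P : Submodule k V}
    {U : Finset ι} (hU : ∀ j ∈ U, g j ∈ P) :
    ShortFree p fun j : U => (⟨g j, hU j j.2⟩ : P) := by
  intro T hT hTp hsum
  refine h (T.map (.subtype _)) (hT.map) (by rwa [Finset.card_map]) ?_
  have := congrArg P.subtype hsum
  rw [map_sum, map_zero] at this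
  rw [Finset.sum_map]
  exact this

variable [Fact p.Prime] [Module (ZMod p) V]

lemma card_lt [Fintype ι] [Module.Finite (ZMod p) V] (h : ShortFree p g) (hp7 : 7 ≤ p) {d : ℕ}
    (hd : Module.finrank (ZMod p) V = d + 3) :
    Fintype.card ι < (∑ i ∈ Finset.range (d + 2), p ^ i) * (3 * p - 7) + 4 := by
  classical
  have h0 (i : ι) : g i ≠ 0 := by
    simpa using h {i} (by simp) (by rw [Finset.card_singleton]; lia)
  rcases isEmpty_or_nonempty ι with hι | hι
  · rw [Fintype.card_eq_zero]
    lia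
  obtain ⟨i, -, hi⟩ := Finset.exists_max_image Finset.univ
    (fun i => (Finset.univ.filter fun j => g j ∈ Submodule.span (ZMod p) {g i}).card)
    Finset.univ_nonempty
  set m := (Finset.univ.filter fun j => g j ∈ Submodule.span (ZMod p) {g i}).card with hm
  have hfib (v : V) : (Finset.univ.filter fun j => g j = v).card ≤ m := by
    rcases (Finset.univ.filter fun j => g j = v).eq_empty_or_nonempty with he | ⟨j, hj⟩
    · simp [he]
    obtain rfl := (Finset.mem_filter.1 hj).2
    refine (Finset.card_le_card fun l hl => ?_).trans (hi j (Finset.mem_univ j))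
    rw [Finset.mem_filter] at hl ⊢
    exact ⟨hl.1, hl.2 ▸ Submodule.mem_span_singleton_self _⟩
  have rank {b : V} (hb : LinearIndependent (ZMod p) ![g i, b]) :
      Module.finrank (ZMod p) (Submodule.span (ZMod p) {g i, b}) = 2 := by
    have := finrank_span_eq_card hb
    rwa [Matrix.range_cons_cons_empty, Fintype.card_fin] at this
  obtain ⟨q, rfl⟩ := Nat.exists_eq_add_of_le hp7
  have hN : 2 ≤ ∑ i ∈ Finset.range (d + 2), (7 + q) ^ i := by
    rw [Finset.sum_range_succ', Finset.sum_range_succ']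
    simp only [zero_add, pow_one, pow_zero]
    lia
  have hN' : ∑ i ∈ Finset.range (d + 3), (7 + q) ^ i =
      (7 + q) * ∑ i ∈ Finset.range (d + 2), (7 + q) ^ i + 1 := by
    rw [Finset.sum_range_succ', Finset.mul_sum]
    simp [pow_succ']
  rw [show 3 * (7 + q) - 7 = 14 + 3 * q by lia]
  rcases Nat.lt_or_ge m 3 with hm3 | hm3
  · have := card_le_mul_of_card_line_le h0 hd fun i' => (hi i' (Finset.mem_univ i'))
    rw [Nat.card_zmod, hN'] at this
    have := Nat.mul_le_mul_right
      ((7 + q) * ∑ i ∈ Finset.range (d + 2), (7 + q) ^ i + 1) (Nat.le_of_lt_succ hm3)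
    nlinarith
  rcases Nat.lt_or_ge m 5 with hm5 | hm5
  · have := card_add_mul_le_of_card_plane_le (h0 i) hd (B := 17 + 3 * q) fun b hb U hU => by
      have := (h.codRestrict hU).card_le_of_card_fiber_le_four (rank hb) hp7 fun v => by
        rw [← Finset.card_map (.subtype _)]
        refine (Finset.card_le_card fun j hj => ?_).trans ((hfib v).trans (Nat.le_of_lt_succ hm5))
        obtain ⟨j, hj', rfl⟩ := Finset.mem_map.1 hj
        rw [Finset.mem_filter] at hj' ⊢
        exact ⟨Finset.mem_univ _, congrArg Subtype.val hj'.2⟩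
      rw [Fintype.card_coe] at this
      lia
    rw [Nat.card_zmod, ← hm] at this
    nlinarith
  · have := card_add_mul_le_of_card_plane_le (h0 i) hd (B := 18 + 3 * q) fun b hb U hU => by
      have := (h.codRestrict hU).card_le (rank hb)
      rw [Fintype.card_coe] at this
      lia
    rw [Nat.card_zmod, ← hm] at this
    nlinarith

end ShortFree

theorem eta_zmod_p_pow_d_le (p d : ℕ) (hp : p.Prime) (hp7 : 7 ≤ p) (hd : 3 ≤ d) :
    ∀ S : Multiset (Fin d → ZMod p),
      S.card = (p ^ d - p) / (p ^ 2 - p) * (3 * p - 7) + 4 →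
        ∃ T : Multiset (Fin d → ZMod p), T ≤ S ∧ T ≠ 0 ∧ T.card ≤ p ∧ T.sum = 0 := by
  intro S hS
  have : Fact p.Prime := ⟨hp⟩
  by_contra! hT
  obtain ⟨d, rfl⟩ := Nat.exists_eq_add_of_le' hd
  induction S using Quotient.inductionOn with | h l =>
  have hfree : ShortFree p l.get := by
    intro T hne hTp hsum
    refine hT (T.val.map l.get) ?_ (by simpa using hne.ne_empty) (by simpa using hTp) hsum
    refine (Multiset.map_le_map (Finset.val_le_iff.2 T.subset_univ)).trans_eq ?_
    simp [Fin.univ_val_map]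
  have hlt := hfree.card_lt hp7 (d := d) (by simp)
  have hgeom : (p ^ (d + 3) - p) / (p ^ 2 - p) = ∑ i ∈ Finset.range (d + 2), p ^ i := by
    rw [Nat.geomSum_eq hp.two_le, pow_succ, pow_two, ← Nat.sub_one_mul, ← Nat.sub_one_mul,
      Nat.mul_div_mul_right _ _ hp.pos]
  rw [hgeom] at hS
  simp at hlt hS
  lia
end

section
/- Let p be a prime and d ≥ 3 an integer. Then every sequence of (6p − 4)·p^{d−3} + 1 elements of (ℤ/pℤ)^d contains a nonempty zero-sum subsequence of length at most (3p − 1)/2. -/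
open Finset

/-- The functions on finite sets that are represented by a polynomial of degree at most `k`
in the membership indicators. -/
def setPolynomial (ι R : Type*) [CommRing R] [DecidableEq ι] (k : ℕ) :
    Submodule R (Finset ι → R) :=
  Submodule.span R {f | ∃ J : Finset ι, J.card ≤ k ∧ f = fun I => if J ⊆ I then 1 else 0}

namespace setPolynomial

variable {ι R : Type*} [CommRing R] [DecidableEq ι]

lemma indicator_mem {J : Finset ι} {k : ℕ} (hJ : J.card ≤ k) :
    (fun I => if J ⊆ I then 1 else 0) ∈ setPolynomial ι R k :=
  Submodule.subset_span ⟨J, hJ, rfl⟩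

lemma mono {a b : ℕ} (h : a ≤ b) : setPolynomial ι R a ≤ setPolynomial ι R b :=
  Submodule.span_mono fun _ ⟨J, hJ, hf⟩ => ⟨J, hJ.trans h, hf⟩

lemma one_mem (k : ℕ) : (1 : Finset ι → R) ∈ setPolynomial ι R k := by
  convert indicator_mem (ι := ι) (R := R) (J := ∅) (k := k) (by simp) using 1
  ext I
  simp

lemma natCast_mem (n k : ℕ) : (n : Finset ι → R) ∈ setPolynomial ι R k := by
  rw [← nsmul_one]
  exact nsmul_mem (one_mem k) n

lemma mul_mem {a b : ℕ} {f g : Finset ι → R} (hf : f ∈ setPolynomial ι R a)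
    (hg : g ∈ setPolynomial ι R b) : f * g ∈ setPolynomial ι R (a + b) := by
  refine (?_ : setPolynomial ι R a * setPolynomial ι R b ≤ setPolynomial ι R (a + b))
    (Submodule.mul_mem_mul hf hg)
  unfold setPolynomial
  rw [Submodule.span_mul_span, Submodule.span_le]
  rintro _ ⟨_, ⟨J, hJ, rfl⟩, _, ⟨K, hK, rfl⟩, rfl⟩
  refine Submodule.subset_span ⟨J ∪ K, (card_union_le J K).trans (by omega), ?_⟩
  ext I
  simp only [Pi.mul_apply, union_subset_iff]
  split_ifs <;> simp_all

lemma pow_mem {a : ℕ} {f : Finset ι → R} (hf : f ∈ setPolynomial ι R a) (n : ℕ) :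
    f ^ n ∈ setPolynomial ι R (n * a) := by
  induction n with
  | zero => simpa using one_mem _
  | succ n ih => rw [pow_succ, Nat.succ_mul]; exact mul_mem ih hf

lemma prod_mem {κ : Type*} {a : ℕ} (s : Finset κ) {f : κ → Finset ι → R}
    (hf : ∀ c, f c ∈ setPolynomial ι R a) :
    ∏ c ∈ s, f c ∈ setPolynomial ι R (s.card * a) := by
  classical
  induction s using Finset.induction_on with
  | empty => simpa using one_mem _
  | insert c s hc ih =>
    rw [prod_insert hc, card_insert_of_notMem hc, Nat.succ_mul, add_comm]
    exact mul_mem (hf c) ih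

lemma sum_mem_one [Fintype ι] (c : ι → R) :
    (fun I : Finset ι => ∑ i ∈ I, c i) ∈ setPolynomial ι R 1 := by
  have h : (fun I : Finset ι => ∑ i ∈ I, c i) =
      ∑ i, c i • fun I : Finset ι => if {i} ⊆ I then (1 : R) else 0 := by
    ext I
    simp [Finset.sum_apply]
  rw [h]
  exact Submodule.sum_mem _ fun i _ => Submodule.smul_mem _ _ (indicator_mem (by simp))

lemma choose_card_mem [Fintype ι] (k : ℕ) :
    (fun I : Finset ι => (I.card.choose k : R)) ∈ setPolynomial ι R k := by
  have h : (fun I : Finset ι => (I.card.choose k : R)) =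
      ∑ J ∈ powersetCard k univ, fun I : Finset ι => if J ⊆ I then (1 : R) else 0 := by
    ext I
    rw [Finset.sum_apply, Finset.sum_boole, ← card_powersetCard]
    congr 2
    ext J
    simp [mem_powersetCard, and_comm]
  rw [h]
  exact Submodule.sum_mem _ fun J hJ => indicator_mem (mem_powersetCard.1 hJ).2.le

lemma alternating_sum_eq_zero {k : ℕ} {f : Finset ι → R} (hf : f ∈ setPolynomial ι R k)
    {A : Finset ι} (hA : k < A.card) : ∑ I ∈ A.powerset, (-1) ^ I.card * f I = 0 := by
  induction hf using Submodule.span_induction with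
  | zero => simp
  | add f g _ _ hf hg => simp [mul_add, sum_add_distrib, hf, hg]
  | smul c f _ hf =>
    simp only [Pi.smul_apply, smul_eq_mul, mul_left_comm _ c, ← mul_sum, hf, mul_zero]
  | mem f hf =>
    obtain ⟨J, hJ, rfl⟩ := hf
    obtain ⟨a, haA, haJ⟩ := exists_mem_notMem_of_card_lt_card (hJ.trans_lt hA)
    rw [← insert_erase haA, sum_powerset_insert (notMem_erase a A), ← sum_add_distrib]
    refine sum_eq_zero fun I hI => ?_
    have haI : a ∉ I := fun h => notMem_erase a A (mem_powerset.1 hI h)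
    have hJI : J ⊆ insert a I ↔ J ⊆ I := subset_insert_iff_of_notMem haJ
    simp only [card_insert_of_notMem haI, hJI]
    ring

end setPolynomial

section ZeroSum

variable {ι : Type*} [Fintype ι] [DecidableEq ι] {p : ℕ} [Fact p.Prime]

lemma one_sub_pow_card_sub_one (y : ZMod p) : 1 - y ^ (p - 1) = if y = 0 then 1 else 0 := by
  have hp := (Fact.out : p.Prime).two_le
  split_ifs with h
  · rw [h, zero_pow (by omega), sub_zero]
  · rw [ZMod.pow_card_sub_one_eq_one h, sub_self]

/-- The Chevalley–Warning argument for weighted counts of zero-sum subsequences. -/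
lemma alternating_sum_zero_sum_eq_zero {d m : ℕ} (v : ι → Fin d → ZMod p)
    {Q : Finset ι → ZMod p} (hQ : Q ∈ setPolynomial ι (ZMod p) m) {A : Finset ι}
    (hA : m + d * (p - 1) < A.card) :
    ∑ I ∈ A.powerset with ∑ i ∈ I, v i = 0, (-1) ^ I.card * Q I = 0 := by
  have hP : (∏ c : Fin d, (1 - (fun I : Finset ι => ∑ i ∈ I, v i c) ^ (p - 1))) * Q ∈
      setPolynomial ι (ZMod p) (d * (p - 1) + m) := by
    refine setPolynomial.mul_mem ?_ hQ
    simpa using setPolynomial.prod_mem (univ : Finset (Fin d)) fun c =>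
      Submodule.sub_mem _ (setPolynomial.one_mem (p - 1))
        (by simpa using setPolynomial.pow_mem (setPolynomial.sum_mem_one fun i => v i c) (p - 1))
  rw [← setPolynomial.alternating_sum_eq_zero hP (by omega : _ < A.card), sum_filter]
  refine sum_congr rfl fun I _ => ?_
  simp only [Pi.mul_apply, Finset.prod_apply, Pi.sub_apply, Pi.one_apply, Pi.pow_apply,
    one_sub_pow_card_sub_one, prod_boole]
  have h : (∑ i ∈ I, v i = 0) ↔ ∀ c ∈ (univ : Finset (Fin d)), ∑ i ∈ I, v i c = 0 := by
    simp [funext_iff, Finset.sum_apply]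
  by_cases h0 : ∑ i ∈ I, v i = 0
  · rw [if_pos h0, if_pos (h.1 h0), one_mul]
  · rw [if_neg h0, if_neg (mt h.2 h0), zero_mul, mul_zero]

/-- Every sequence longer than `d * (p - 1)` over `(ℤ/pℤ)^d` has a zero-sum subsequence. -/
lemma exists_zero_sum {d : ℕ} (v : ι → Fin d → ZMod p) {A : Finset ι}
    (hA : d * (p - 1) < A.card) : ∃ I ⊆ A, I.Nonempty ∧ ∑ i ∈ I, v i = 0 := by
  by_contra! h
  have key := alternating_sum_zero_sum_eq_zero v (setPolynomial.one_mem 0)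
    (by omega : 0 + d * (p - 1) < A.card)
  rw [sum_eq_single ∅] at key
  · simp at key
  · intro I hI hne
    rw [mem_filter, mem_powerset] at hI
    exact absurd hI.2 (h I hI.1 (nonempty_iff_ne_empty.2 hne))
  · simp

lemma one_sub_card_pow_mem :
    (fun I : Finset ι => 1 - (I.card : ZMod p) ^ (p - 1)) ∈ setPolynomial ι (ZMod p) (p - 1) := by
  refine Submodule.sub_mem _ (setPolynomial.one_mem (p - 1)) ?_
  change (fun I : Finset ι => (I.card : ZMod p)) ^ (p - 1) ∈ _
  simpa using setPolynomial.pow_mem (setPolynomial.sum_mem_one fun _ : ι => (1 : ZMod p)) (p - 1)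

/-- Every sequence longer than `(d + 1) * (p - 1)` over `(ℤ/pℤ)^d` has a zero-sum subsequence of
length divisible by `p`. -/
lemma exists_zero_sum_dvd_card {d : ℕ} (v : ι → Fin d → ZMod p) {A : Finset ι}
    (hA : (d + 1) * (p - 1) < A.card) :
    ∃ I ⊆ A, I.Nonempty ∧ p ∣ I.card ∧ ∑ i ∈ I, v i = 0 := by
  by_contra! h
  rw [add_one_mul] at hA
  have key := alternating_sum_zero_sum_eq_zero v one_sub_card_pow_mem
    (by omega : p - 1 + d * (p - 1) < A.card)
  simp only [one_sub_pow_card_sub_one, ZMod.natCast_eq_zero_iff] at key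
  rw [sum_eq_single ∅] at key
  · simp at key
  · intro I hI hne
    rw [mem_filter, mem_powerset] at hI
    rw [if_neg fun hdvd => h I hI.1 (nonempty_iff_ne_empty.2 hne) hdvd hI.2, mul_zero]
  · simp

lemma exists_zero_sum_odd_mul (hp2 : p ≠ 2) (v : ι → Fin 3 → ZMod p) {A : Finset ι}
    (hA : A.card = 6 * p - 3) :
    ∃ I ⊆ A, (I.card = p ∨ I.card = 3 * p ∨ I.card = 5 * p) ∧ ∑ i ∈ I, v i = 0 := by
  by_contra! h
  have hp : p.Prime := Fact.out
  have hp0 := hp.two_le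
  have hQ : (fun I : Finset ι => 1 - (I.card : ZMod p) ^ (p - 1)) *
      ((fun I : Finset ι => (I.card.choose p : ZMod p)) - (2 : ℕ)) *
      ((fun I : Finset ι => (I.card.choose p : ZMod p)) - (4 : ℕ)) ∈
      setPolynomial ι (ZMod p) (p - 1 + p + p) :=
    setPolynomial.mul_mem (setPolynomial.mul_mem one_sub_card_pow_mem
      (Submodule.sub_mem _ (setPolynomial.choose_card_mem p) (setPolynomial.natCast_mem 2 p)))
      (Submodule.sub_mem _ (setPolynomial.choose_card_mem p) (setPolynomial.natCast_mem 4 p))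
  have key := alternating_sum_zero_sum_eq_zero v hQ
    (by omega : p - 1 + p + p + 3 * (p - 1) < A.card)
  rw [sum_eq_single ∅] at key
  · have h8 : (2 : ZMod p) ^ 3 = 0 := by
      simp [one_sub_pow_card_sub_one, Nat.choose_eq_zero_of_lt hp.pos] at key
      rcases key with h | h
      · rw [h]; simp
      · linear_combination 2 * h
    have h2 : ((2 : ℕ) : ZMod p) = 0 := by exact_mod_cast eq_zero_of_pow_eq_zero h8
    rw [ZMod.natCast_eq_zero_iff] at h2
    exact hp2 ((Nat.prime_dvd_prime_iff_eq hp Nat.prime_two).1 h2)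
  · intro I hI hne
    rw [mem_filter, mem_powerset] at hI
    have hle := card_le_card hI.1
    have hpos := card_pos.2 (nonempty_iff_ne_empty.2 hne)
    have hI' := fun hc => h I hI.1 hc hI.2
    simp only [Pi.mul_apply, Pi.sub_apply, Pi.natCast_apply, one_sub_pow_card_sub_one,
      ZMod.natCast_eq_zero_iff]
    by_cases hdvd : p ∣ I.card
    · obtain ⟨b, hb⟩ := hdvd
      have hlucas : (I.card.choose p : ZMod p) = b := by
        rw [ZMod.natCast_eq_natCast_iff]
        have := Choose.choose_modEq_choose_mod_mul_choose_div_nat (n := I.card) (k := p) (p := p)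
        simpa [hb, Nat.div_self hp.pos, hp.pos] using this
      have hb6 : b < 6 := by
        by_contra! hb6
        have := Nat.mul_le_mul_left p hb6
        omega
      rw [hlucas]
      interval_cases b <;> first | exact (hI' (by omega)).elim | simp
    · simp [hdvd]
  · simp

/-- A zero-sum subsequence of length `3 * p` splits into two, and one of length `5 * p` contains one
of length `p` or `3 * p`. -/
lemma exists_short_zero_sum_dim_three (hp2 : p ≠ 2) (v : ι → Fin 3 → ZMod p)
    (hι : 6 * p - 3 ≤ Fintype.card ι) :
    ∃ I : Finset ι, I.Nonempty ∧ 2 * I.card ≤ 3 * p - 1 ∧ ∑ i ∈ I, v i = 0 := by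
  have hp : p.Prime := Fact.out
  have hp0 := hp.two_le
  have hodd : p % 2 = 1 := hp.eq_two_or_odd.resolve_left hp2
  have hsdiff : ∀ {I U : Finset ι}, I ⊆ U → ∑ i ∈ U, v i = 0 → ∑ i ∈ I, v i = 0 →
      ∑ i ∈ U \ I, v i = 0 := by
    intro I U hIU hU hI
    rw [← sum_sdiff hIU, hI, add_zero] at hU
    exact hU
  have one : ∀ U : Finset ι, U.card = p → ∑ i ∈ U, v i = 0 →
      ∃ I : Finset ι, I.Nonempty ∧ 2 * I.card ≤ 3 * p - 1 ∧ ∑ i ∈ I, v i = 0 :=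
    fun U hU h0 => ⟨U, card_pos.1 (by omega), by omega, h0⟩
  have three : ∀ U : Finset ι, U.card = 3 * p → ∑ i ∈ U, v i = 0 →
      ∃ I : Finset ι, I.Nonempty ∧ 2 * I.card ≤ 3 * p - 1 ∧ ∑ i ∈ I, v i = 0 := by
    intro U hU h0
    obtain ⟨B, hBU, hB⟩ := exists_subset_card_eq (by omega : 3 * p - 1 ≤ U.card)
    obtain ⟨I, hIB, hne, hI⟩ := exists_zero_sum v (by omega : 3 * (p - 1) < B.card)
    have hle := card_le_card hIB
    have hcard := card_sdiff_of_subset (hIB.trans hBU)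
    by_cases hI2 : 2 * I.card ≤ 3 * p - 1
    · exact ⟨I, hne, hI2, hI⟩
    · exact ⟨U \ I, card_pos.1 (by omega), by omega, hsdiff (hIB.trans hBU) h0 hI⟩
  obtain ⟨A, -, hA⟩ := exists_subset_card_eq
    (by simpa using hι : 6 * p - 3 ≤ (univ : Finset ι).card)
  obtain ⟨U, -, hU | hU | hU, h0⟩ := exists_zero_sum_odd_mul hp2 v hA
  · exact one U hU h0
  · exact three U hU h0
  · obtain ⟨B, hBU, hB⟩ := exists_subset_card_eq (by omega : 5 * p - 1 ≤ U.card)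
    obtain ⟨I, hIB, hne, ⟨b, hb⟩, hI⟩ :=
      exists_zero_sum_dvd_card v (by omega : (3 + 1) * (p - 1) < B.card)
    have hle := card_le_card hIB
    have hcard := card_sdiff_of_subset (hIB.trans hBU)
    have hI' := hsdiff (hIB.trans hBU) h0 hI
    have hpos := card_pos.2 hne
    have hb5 : b < 5 := by
      by_contra! hb5
      have := Nat.mul_le_mul_left p hb5
      omega
    interval_cases b
    · omega
    · exact one I (by omega) hI
    · exact three _ (by omega) hI'
    · exact three I (by omega) hI
    · exact one _ (by omega) hI'

/-- Averaging over the nonzero `l : W`: if `φ` vanishes on `K`, some `l` is annihilated by more than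
`C` of the functionals `φ i`. -/
lemma exists_ne_zero_lt_card_ker {W : Type*} [AddCommGroup W] [Module (ZMod p) W]
    [FiniteDimensional (ZMod p) W] {e C : ℕ} (hW : Module.finrank (ZMod p) W = e + 1)
    (φ : ι → Module.Dual (ZMod p) W) {K : Finset ι} (hK : ∀ i ∈ K, φ i = 0)
    (hC : Fintype.card ι + C * (p ^ (e + 1) - 1) <
      #K * (p ^ (e + 1) - p ^ e) + Fintype.card ι * p ^ e) :
    ∃ l : W, l ≠ 0 ∧ C < #{i | φ i l = 0} := by
  classical
  by_contra! h
  have : Finite W := Module.finite_of_finite (ZMod p)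
  have := Fintype.ofFinite W
  have hcard : ∀ U : Submodule (ZMod p) W, Fintype.card U = p ^ Module.finrank (ZMod p) U :=
    fun U => by rw [Module.card_eq_pow_finrank (K := ZMod p), ZMod.card]
  have hWcard : Fintype.card W = p ^ (e + 1) := by
    rw [Module.card_eq_pow_finrank (K := ZMod p), ZMod.card, hW]
  have hp1 : 1 ≤ p := (Fact.out : p.Prime).one_le
  have hlower : ∀ i, p ^ e + (if i ∈ K then p ^ (e + 1) - p ^ e else 0) ≤ #{l | φ i l = 0} := by
    intro i
    split_ifs with hi
    · simp [hK i hi, hWcard, Nat.add_sub_cancel' (Nat.pow_le_pow_right hp1 e.le_succ)]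
    · have hrank := (φ i).finrank_range_add_finrank_ker
      have hrange := (LinearMap.range (φ i)).finrank_le
      rw [Module.finrank_self] at hrange
      have hker : #{l | φ i l = 0} = p ^ Module.finrank (ZMod p) (LinearMap.ker (φ i)) := by
        rw [← hcard, Fintype.card_subtype]
        simp
      rw [hker, add_zero]
      exact Nat.pow_le_pow_right hp1 (by omega)
  have hupper : ∑ l, #{i | φ i l = 0} ≤ Fintype.card ι + C * (p ^ (e + 1) - 1) := by
    rw [← add_sum_erase univ _ (mem_univ (0 : W))]
    refine add_le_add (card_le_univ _) ?_
    refine (sum_le_card_nsmul _ _ C fun l hl => h l (ne_of_mem_erase hl)).trans_eq ?_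
    rw [card_erase_of_mem (mem_univ _), card_univ, hWcard, smul_eq_mul, mul_comm]
  have hswap : ∑ i, #{l | φ i l = 0} = ∑ l, #{i | φ i l = 0} := by
    simp only [card_filter]
    exact sum_comm
  have hsum := sum_le_sum fun i (_ : i ∈ univ) => hlower i
  rw [sum_add_distrib, sum_const, sum_ite_mem, univ_inter, sum_const, smul_eq_mul, smul_eq_mul,
    card_univ, hswap] at hsum
  omega

lemma hyperplane_count_bound (n k : ℕ) {N : ℕ} (hN : (6 * p - 4) * p ^ (n + 1) + 1 ≤ N)
    (hk : p = 3 ∧ k = 2 ∨ 5 ≤ p ∧ k = 1) :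
    N + (6 * p - 4) * p ^ n * (p ^ (n + 3) - 1) <
      k * (p ^ (n + 3) - p ^ (n + 2)) + N * p ^ (n + 2) := by
  have hp2 : 2 ≤ p := (Fact.out : p.Prime).two_le
  have h1 : 1 ≤ p ^ n := Nat.one_le_pow _ _ (by omega)
  have h2 : 1 ≤ p ^ (n + 3) := Nat.one_le_pow _ _ (by omega)
  have h3 : p ^ (n + 2) ≤ p ^ (n + 3) := Nat.pow_le_pow_right (by omega) (by omega)
  have h4 : 1 ≤ p ^ (n + 2) := Nat.one_le_pow _ _ (by omega)
  have h5 : 4 ≤ 6 * p := by omega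
  zify [h2, h3, h5] at hN h1 h4 ⊢
  have hkey : (1 : ℤ) < p ^ n * (p ^ 2 + k * (p ^ 2 * (p - 1)) - (6 * p - 4) * (p - 1)) := by
    have : (1 : ℤ) < p ^ 2 + k * (p ^ 2 * (p - 1)) - (6 * p - 4) * (p - 1) := by
      rcases hk with ⟨rfl, rfl⟩ | ⟨h, rfl⟩
      · norm_num
      · zify at h
        push_cast
        nlinarith [mul_nonneg (sub_nonneg.2 h) (sub_nonneg.2 h),
          mul_nonneg (mul_nonneg (sub_nonneg.2 h) (sub_nonneg.2 h)) (sub_nonneg.2 h)]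
    nlinarith
  have hmul := mul_le_mul_of_nonneg_right hN (sub_nonneg.2 h4)
  simp only [pow_add] at hmul ⊢
  nlinarith

lemma exists_pair_of_card_lt {V : Type*} [AddCommGroup V] [Module (ZMod 3) V] [Fintype V]
    (v : ι → V) (h0 : ∀ i, v i ≠ 0) (hV : Fintype.card V < 2 * Fintype.card ι) :
    ∃ i j, i ≠ j ∧ (v i = v j ∨ v i + v j = 0) := by
  by_contra! h
  refine hV.not_ge ?_
  rw [two_mul, ← Fintype.card_sum]
  refine Fintype.card_le_of_injective (Sum.elim v (-v)) ?_
  have hinj : Function.Injective v := fun i j hij => by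
    by_contra hne
    exact (h i j hne).1 hij
  have hneg : ∀ i j, v i ≠ -v j := by
    intro i j hij
    by_cases hne : i = j
    · subst hne
      have h3 : (3 : ZMod 3) • v i = 0 := by
        rw [show (3 : ZMod 3) = 0 from rfl, zero_smul]
      apply h0 i
      have h2 : v i + v i = 0 := by nth_rw 1 [hij]; simp
      rw [show (3 : ZMod 3) = 1 + 1 + 1 by norm_num, add_smul, add_smul, one_smul, h2,
        zero_add] at h3
      exact h3
    · exact (h i j hne).2 (by rw [hij, neg_add_cancel])
  rintro (i | i) (j | j) hij
  · exact congrArg _ (hinj hij)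
  · exact (hneg i j hij).elim
  · exact (hneg j i hij.symm).elim
  · exact congrArg _ (hinj (neg_injective hij))

end ZeroSum

/-- The odd case, by passing to a hyperplane that contains many terms of the sequence. -/
theorem exists_short_zero_sum {p : ℕ} [Fact p.Prime] (hp2 : p ≠ 2) (n : ℕ)
    {V : Type*} [AddCommGroup V] [Module (ZMod p) V] [FiniteDimensional (ZMod p) V]
    (hV : Module.finrank (ZMod p) V = n + 3) {ι : Type*} [Fintype ι] (v : ι → V)
    (hι : (6 * p - 4) * p ^ n + 1 ≤ Fintype.card ι) :
    ∃ I : Finset ι, I.Nonempty ∧ 2 * I.card ≤ 3 * p - 1 ∧ ∑ i ∈ I, v i = 0 := by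
  classical
  have hp : p.Prime := Fact.out
  have hp3 : 3 ≤ p := by have := hp.two_le; omega
  induction n generalizing V ι with
  | zero =>
    let f : V ≃ₗ[ZMod p] (Fin 3 → ZMod p) := (Module.finBasisOfFinrankEq _ _ hV).equivFun
    obtain ⟨I, hne, hcard, h0⟩ := exists_short_zero_sum_dim_three hp2 (fun i => f (v i))
      (by rw [pow_zero, mul_one] at hι; omega)
    exact ⟨I, hne, hcard, f.injective (by rw [map_sum, h0, map_zero])⟩
  | succ n ih =>
    by_cases hzero : ∃ i, v i = 0
    · obtain ⟨i, hi⟩ := hzero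
      exact ⟨{i}, singleton_nonempty i, by rw [card_singleton]; omega, by simpa using hi⟩
    push Not at hzero
    by_cases hpair : p = 3 ∧ ∃ i j, i ≠ j ∧ v i + v j = 0
    · obtain ⟨rfl, i, j, hij, h⟩ := hpair
      exact ⟨{i, j}, insert_nonempty _ _, by rw [card_pair hij]; omega, by rw [sum_pair hij, h]⟩
    obtain ⟨x, hx, K, hK, hKcard⟩ : ∃ x : V, x ≠ 0 ∧ ∃ K : Finset ι, (∀ i ∈ K, v i = x) ∧
        (p = 3 ∧ K.card = 2 ∨ 5 ≤ p ∧ K.card = 1) := by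
      by_cases h3 : p = 3
      · subst h3
        have : Finite V := Module.finite_of_finite (ZMod 3)
        have := Fintype.ofFinite V
        obtain ⟨i, j, hij, h | h⟩ := exists_pair_of_card_lt v hzero (by
          rw [Module.card_eq_pow_finrank (K := ZMod 3), ZMod.card, hV]
          have : 3 ^ (n + 1 + 3) = 27 * 3 ^ (n + 1) := by ring
          omega)
        · exact ⟨v i, hzero i, {i, j}, by simp [h], Or.inl ⟨rfl, card_pair hij⟩⟩
        · exact (hpair ⟨rfl, i, j, hij, h⟩).elim
      · have h4 : p ≠ 4 := by rintro rfl; norm_num at hp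
        obtain ⟨i⟩ : Nonempty ι := Fintype.card_pos_iff.1 (by omega)
        exact ⟨v i, hzero i, {i}, by simp, Or.inr ⟨by omega, card_singleton i⟩⟩
    let W := (Submodule.span (ZMod p) {x}).dualAnnihilator
    have hW : Module.finrank (ZMod p) W = n + 2 + 1 := by
      have := Subspace.finrank_add_finrank_dualAnnihilator_eq (Submodule.span (ZMod p) {x})
      rw [finrank_span_singleton hx, hV] at this
      change Module.finrank (ZMod p) (Submodule.span (ZMod p) {x}).dualAnnihilator = _
      omega
    let φ : ι → Module.Dual (ZMod p) W := fun i =>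
      (Module.Dual.eval (ZMod p) V (v i)).comp W.subtype
    have hφ : ∀ i ∈ K, φ i = 0 := by
      intro i hi
      ext l
      change (l : Module.Dual (ZMod p) V) (v i) = 0
      rw [hK i hi]
      exact (Submodule.mem_dualAnnihilator _).1 l.2 x (Submodule.mem_span_singleton_self x)
    obtain ⟨l, hl, hcount⟩ := exists_ne_zero_lt_card_ker hW φ hφ
      (hyperplane_count_bound n K.card hι hKcard)
    let g : Module.Dual (ZMod p) V := l
    have hg : g ≠ 0 := fun h => hl (Subtype.ext h)
    obtain ⟨I, hne, hcard, h0⟩ := ih (V := LinearMap.ker g) (ι := {i // φ i l = 0})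
      (by
        have := Module.Dual.finrank_ker_add_one_of_ne_zero hg
        omega)
      (fun i => ⟨v i, i.2⟩) (by rw [Fintype.card_subtype]; omega)
    refine ⟨I.map (Function.Embedding.subtype _), hne.map, by rwa [card_map], ?_⟩
    simpa [sum_map] using congrArg Subtype.val h0

lemma exists_short_zero_sum_two {d : ℕ} (hd : 3 ≤ d) {ι : Type*} [Fintype ι]
    (v : ι → Fin d → ZMod 2) (hι : (6 * 2 - 4) * 2 ^ (d - 3) + 1 ≤ Fintype.card ι) :
    ∃ I : Finset ι, I.Nonempty ∧ 2 * I.card ≤ 3 * 2 - 1 ∧ ∑ i ∈ I, v i = 0 := by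
  classical
  obtain ⟨n, rfl⟩ := Nat.exists_eq_add_of_le' hd
  obtain ⟨i, j, hij, h⟩ := Fintype.exists_ne_map_eq_of_card_lt v (by
    rw [Nat.add_sub_cancel] at hι
    simp only [Fintype.card_pi, ZMod.card, prod_const, card_univ, Fintype.card_fin, pow_add]
    omega)
  refine ⟨{i, j}, insert_nonempty _ _, by rw [card_pair hij]; omega, ?_⟩
  rw [sum_pair hij, h]
  ext c
  exact CharTwo.add_self_eq_zero _

theorem short_zero_sum_of_long_sequence (p d : ℕ) (hp : p.Prime) (hd : 3 ≤ d) :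
    ∀ S : Multiset (Fin d → ZMod p), S.card = (6 * p - 4) * p ^ (d - 3) + 1 →
      ∃ T : Multiset (Fin d → ZMod p),
        T ≤ S ∧ T ≠ 0 ∧ 2 * T.card ≤ 3 * p - 1 ∧ T.sum = 0 := by
  intro S hS
  have : Fact p.Prime := ⟨hp⟩
  obtain ⟨L, rfl⟩ := Quot.exists_rep S
  change L.length = _ at hS
  obtain ⟨I, hne, hcard, h0⟩ : ∃ I : Finset (Fin L.length), I.Nonempty ∧
      2 * I.card ≤ 3 * p - 1 ∧ ∑ i ∈ I, L.get i = 0 := by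
    by_cases hp2 : p = 2
    · subst hp2
      exact exists_short_zero_sum_two hd L.get (by simp [hS])
    · exact exists_short_zero_sum hp2 (d - 3) (by simp; omega) L.get (by simp [hS])
  refine ⟨I.val.map L.get, ?_, ?_, by simpa using hcard, h0⟩
  · calc I.val.map L.get ≤ (univ : Finset (Fin L.length)).val.map L.get :=
        Multiset.map_le_map (val_le_iff.2 (subset_univ I))
      _ = L := by simp
  · simpa using hne.ne_empty
end

section
/- Let p be a prime and d ≥ 4 an integer. Then every sequence of (6p − 4)·p^{d−4} + 1 elements of (ℤ/pℤ)^d contains a nonempty zero-sum subsequence of length at most 2p. -/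
open Finset Module

/-- The alternating sum over the subsets of `I` of a polynomial of degree less than `#I`, evaluated
at indicator vectors, vanishes. -/
lemma sum_powerset_neg_one_pow_mul_eval_indicator {ι R : Type*} [DecidableEq ι] [CommRing R]
    (I : Finset ι) (P : MvPolynomial ι R) (hP : P.totalDegree < #I) :
    ∑ T ∈ I.powerset, (-1) ^ #T * MvPolynomial.eval (fun i => if i ∈ T then 1 else 0) P = 0 := by
  simp only [MvPolynomial.eval_eq, mul_sum]
  rw [sum_comm]
  refine sum_eq_zero fun u hu => ?_
  obtain ⟨i, hiI, hiu⟩ : ∃ i ∈ I, i ∉ u.support := by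
    refine exists_mem_notMem_of_card_lt_card (lt_of_le_of_lt ?_ hP)
    refine le_trans ?_ (MvPolynomial.le_totalDegree hu)
    rw [Finsupp.sum, card_eq_sum_ones]
    exact sum_le_sum fun j hj => Nat.one_le_iff_ne_zero.2 (Finsupp.mem_support_iff.1 hj)
  rw [← insert_erase hiI, sum_powerset_insert (notMem_erase i I), ← sum_add_distrib]
  refine sum_eq_zero fun T hT => ?_
  have hiT : i ∉ T := fun h => notMem_erase i I (mem_powerset.1 hT h)
  have hprod : ∏ j ∈ u.support, (if j ∈ insert i T then (1 : R) else 0) ^ u j =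
      ∏ j ∈ u.support, (if j ∈ T then (1 : R) else 0) ^ u j := by
    refine prod_congr rfl fun j hj => ?_
    have hji : j ≠ i := fun h => hiu (h ▸ hj)
    simp [hji]
  rw [hprod, card_insert_of_notMem hiT]
  ring

lemma sum_prodMk_one_eq_zero_iff {p : ℕ} {ι V : Type*} [AddCommGroup V] (v : ι → V)
    (T : Finset ι) :
    ∑ i ∈ T, (v i, (1 : ZMod p)) = 0 ↔ ∑ i ∈ T, v i = 0 ∧ p ∣ #T := by
  simp [Prod.ext_iff, Prod.fst_sum, Prod.snd_sum, ZMod.natCast_eq_zero_iff]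

section ZeroSum

variable {p : ℕ} [Fact p.Prime] {ι V : Type*} [DecidableEq ι] [AddCommGroup V]
  [Module (ZMod p) V] [FiniteDimensional (ZMod p) V]

/-- There is a polynomial of degree at most `finrank V * (p - 1)` which detects whether a
subfamily of `v` sums to zero. -/
lemma exists_mvPolynomial_eval_indicator_eq_ite [DecidableEq V] (v : ι → V)
    (I : Finset ι) :
    ∃ Z : MvPolynomial ι (ZMod p), Z.totalDegree ≤ finrank (ZMod p) V * (p - 1) ∧
      ∀ T ⊆ I, MvPolynomial.eval (fun i => if i ∈ T then 1 else 0) Z =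
        if ∑ i ∈ T, v i = 0 then 1 else 0 := by
  let b := finBasis (ZMod p) V
  refine ⟨∏ j, (1 - (∑ i ∈ I, MvPolynomial.C (b.repr (v i) j) * MvPolynomial.X i) ^ (p - 1)),
    ?_, fun T hT => ?_⟩
  · refine (MvPolynomial.totalDegree_finsetProd _ _).trans ?_
    refine (sum_le_card_nsmul _ _ (p - 1) fun j _ => ?_).trans (by simp)
    refine (MvPolynomial.totalDegree_sub _ _).trans (max_le (by simp) ?_)
    refine (MvPolynomial.totalDegree_pow _ _).trans ?_
    refine (Nat.mul_le_mul_left _ (MvPolynomial.totalDegree_finsetSum_le fun i _ => ?_)).trans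
      (mul_one _).le
    exact (MvPolynomial.totalDegree_mul _ _).trans (by simp)
  · have hcoord : ∀ j, MvPolynomial.eval (fun i => if i ∈ T then (1 : ZMod p) else 0)
        (∑ i ∈ I, MvPolynomial.C (b.repr (v i) j) * MvPolynomial.X i) =
          b.repr (∑ i ∈ T, v i) j := by
      intro j
      simp [inter_eq_right.2 hT]
    simp only [map_prod, map_sub, map_one, map_pow, hcoord]
    split_ifs with h
    · have hp : p - 1 ≠ 0 := by have := (Fact.out : p.Prime).two_le; omega
      simp [h, hp]
    · obtain ⟨j, hj⟩ : ∃ j, b.repr (∑ i ∈ T, v i) j ≠ 0 := by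
        by_contra! hall
        exact h (b.repr.map_eq_zero_iff.1 (Finsupp.ext hall))
      exact prod_eq_zero (mem_univ j) (by rw [ZMod.pow_card_sub_one_eq_one hj, sub_self])

/-- Signed count of zero-sum subfamilies, weighted by a binomial coefficient of their length. -/
lemma sum_zero_sum_neg_one_pow_mul_choose [DecidableEq V] (v : ι → V) (I : Finset ι) (k : ℕ)
    (hI : finrank (ZMod p) V * (p - 1) + k < #I) :
    ∑ T ∈ I.powerset with ∑ i ∈ T, v i = 0, (-1 : ZMod p) ^ #T * ((#T).choose k : ZMod p) = 0 := by
  obtain ⟨Z, hZdeg, hZ⟩ := exists_mvPolynomial_eval_indicator_eq_ite (p := p) v I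
  let Q : MvPolynomial ι (ZMod p) := ∑ K ∈ I.powersetCard k, ∏ i ∈ K, MvPolynomial.X i
  have hQdeg : Q.totalDegree ≤ k := by
    refine MvPolynomial.totalDegree_finsetSum_le fun K hK => ?_
    refine (MvPolynomial.totalDegree_finsetProd _ _).trans ?_
    simp [(mem_powersetCard.1 hK).2]
  have hQ : ∀ T ⊆ I, MvPolynomial.eval (fun i => if i ∈ T then 1 else 0) Q =
      ((#T).choose k : ZMod p) := by
    intro T hT
    have hsub : {K ∈ I.powersetCard k | K ⊆ T} = T.powersetCard k := by
      ext K
      simp only [mem_filter, mem_powersetCard]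
      exact ⟨fun h => ⟨h.2, h.1.2⟩, fun h => ⟨⟨h.1.trans hT, h.2⟩, h.1⟩⟩
    simp only [Q, map_sum, map_prod, MvPolynomial.eval_X, prod_ite_zero, prod_const_one]
    rw [← sum_filter, ← card_powersetCard, ← hsub]
    simp [subset_iff]
  rw [sum_filter]
  refine (sum_congr rfl fun T hT => ?_).trans
    (sum_powerset_neg_one_pow_mul_eval_indicator I (Z * Q)
      ((MvPolynomial.totalDegree_mul _ _).trans_lt (by omega)))
  rw [map_mul, hZ T (mem_powerset.1 hT), hQ T (mem_powerset.1 hT)]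
  split_ifs <;> simp

/-- The upper bound for the Davenport constant of `(ℤ/pℤ)^m`. -/
lemma exists_zero_sum_subset_s7 (v : ι → V) (I : Finset ι)
    (hI : finrank (ZMod p) V * (p - 1) < #I) :
    ∃ T ⊆ I, T.Nonempty ∧ ∑ i ∈ T, v i = 0 := by
  classical
  by_contra! h
  have hsum := sum_zero_sum_neg_one_pow_mul_choose (p := p) v I 0 (by simpa using hI)
  have hfilter : {T ∈ I.powerset | ∑ i ∈ T, v i = 0} = {∅} := by
    ext T
    simp only [mem_filter, mem_powerset, mem_singleton]
    refine ⟨fun hT => ?_, fun hT => by simp [hT]⟩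
    by_contra hne
    exact h T hT.1 (nonempty_iff_ne_empty.2 hne) hT.2
  simp [hfilter] at hsum

lemma sum_zero_sum_dvd_card_neg_one_pow_mul_choose [DecidableEq V] (v : ι → V)
    (I : Finset ι) (k : ℕ)
    (hI : (finrank (ZMod p) V + 1) * (p - 1) + k < #I) :
    ∑ T ∈ I.powerset with ∑ i ∈ T, v i = 0 ∧ p ∣ #T,
      (-1 : ZMod p) ^ #T * ((#T).choose k : ZMod p) = 0 := by
  have h := sum_zero_sum_neg_one_pow_mul_choose (p := p) (fun i => (v i, (1 : ZMod p))) I k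
    (by simpa using hI)
  simpa only [sum_prodMk_one_eq_zero_iff] using h

lemma exists_zero_sum_subset_dvd_card (v : ι → V) (I : Finset ι)
    (hI : (finrank (ZMod p) V + 1) * (p - 1) < #I) :
    ∃ T ⊆ I, T.Nonempty ∧ ∑ i ∈ T, v i = 0 ∧ p ∣ #T := by
  simpa only [sum_prodMk_one_eq_zero_iff] using
    exists_zero_sum_subset_s7 (p := p) (fun i => (v i, (1 : ZMod p))) I (by simpa using hI)

/-- A zero-sum family exceeding the Davenport bound splits into two nonempty zero-sum families. -/
lemma exists_zero_sum_subset_two_mul_card_le (v : ι → V) (T : Finset ι)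
    (hT : finrank (ZMod p) V * (p - 1) + 1 < #T) (hsum : ∑ i ∈ T, v i = 0) :
    ∃ A ⊆ T, A.Nonempty ∧ 2 * #A ≤ #T ∧ ∑ i ∈ A, v i = 0 := by
  classical
  obtain ⟨t, ht⟩ : T.Nonempty := card_pos.1 (by omega)
  obtain ⟨A, hA, hAne, hA0⟩ := exists_zero_sum_subset_s7 (p := p) v (T.erase t)
    (by rw [card_erase_of_mem ht]; omega)
  have hAT : A ⊆ T := hA.trans (erase_subset _ _)
  have hcard := card_sdiff_add_card_eq_card hAT
  by_cases hle : 2 * #A ≤ #T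
  · exact ⟨A, hAT, hAne, hle, hA0⟩
  · refine ⟨T \ A, sdiff_subset, ⟨t, mem_sdiff.2 ⟨ht, fun h => notMem_erase t T (hA h)⟩⟩,
      by omega, ?_⟩
    have := sum_sdiff (f := v) hAT
    rwa [hA0, add_zero, hsum] at this

lemma exists_zero_sum_of_prime_ne_three (hp3 : p ≠ 3) (hV : finrank (ZMod p) V = 4) (v : ι → V)
    (I : Finset ι) (hI : #I = 6 * p - 3) :
    ∃ T ⊆ I, T.Nonempty ∧ #T ≤ 2 * p ∧ ∑ i ∈ T, v i = 0 := by
  classical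
  by_contra! h
  have hp : p.Prime := Fact.out
  have hp2 := hp.two_le
  let F : Finset (Finset ι) := {T ∈ I.powerset | ∑ i ∈ T, v i = 0 ∧ p ∣ #T}
  have hempty : ∅ ∈ F := by simp [F]
  have hF : ∀ T ∈ F.erase ∅, #T = 3 * p := by
    intro T hT
    simp only [F, mem_erase, mem_filter, mem_powerset] at hT
    obtain ⟨hne, hTI, h0, c, hc⟩ := hT
    have hne' := nonempty_iff_ne_empty.2 hne
    have hle := card_le_card hTI
    have hlt : c < 6 := by
      by_contra! hge
      have := Nat.mul_le_mul_left p hge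
      omega
    have hgt : 2 < c := by
      by_contra! hge
      have := Nat.mul_le_mul_left p hge
      exact h T hTI hne' (by omega) h0
    obtain rfl | rfl | rfl : c = 3 ∨ c = 4 ∨ c = 5 := by omega
    · omega
    · obtain ⟨A, hA, hAne, hAcard, hA0⟩ :=
        exists_zero_sum_subset_two_mul_card_le (p := p) v T (by rw [hV]; omega) h0
      exact absurd hA0 (h A (hA.trans hTI) hAne (by omega))
    · obtain ⟨t, ht⟩ := hne'
      obtain ⟨A, hA, hAne, hA0, a, ha⟩ := exists_zero_sum_subset_dvd_card (p := p) v (T.erase t)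
        (by rw [card_erase_of_mem ht, hV]; omega)
      have hAT : A ⊆ T := hA.trans (erase_subset _ _)
      have hcard := card_sdiff_add_card_eq_card hAT
      have hsdiff := sum_sdiff (f := v) hAT
      rw [hA0, add_zero, h0] at hsdiff
      rcases le_or_gt a 2 with ha2 | ha2
      · have := Nat.mul_le_mul_left p ha2
        exact absurd hA0 (h A (hAT.trans hTI) hAne (by omega))
      · have := Nat.mul_le_mul_left p (Nat.succ_le_of_lt ha2)
        exact absurd hsdiff (h (T \ A) (sdiff_subset.trans hTI)
          ⟨t, mem_sdiff.2 ⟨ht, fun h => notMem_erase t T (hA h)⟩⟩ (by omega))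
  have hsum : ∀ k, k ≤ p → ((0).choose k : ZMod p) +
      #(F.erase ∅) * ((-1) ^ (3 * p) * ((3 * p).choose k : ZMod p)) = 0 := by
    intro k hk
    have := sum_zero_sum_dvd_card_neg_one_pow_mul_choose (p := p) v I k (by rw [hV]; omega)
    rw [← add_sum_erase _ _ hempty,
      sum_congr rfl fun T hT => by rw [hF T hT], sum_const, nsmul_eq_mul] at this
    simpa using this
  have hchoose : ((3 * p).choose p : ZMod p) = 3 := by
    have := (ZMod.natCast_eq_natCast_iff _ _ _).2
      (Choose.choose_modEq_choose_mod_mul_choose_div_nat (n := 3 * p) (k := p) (p := p))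
    rw [this]
    simp [Nat.div_self hp.pos, Nat.mul_div_cancel _ hp.pos]
  have hthree : (3 : ZMod p) ≠ 0 := by
    intro h3
    have h3' : ((3 : ℕ) : ZMod p) = 0 := by exact_mod_cast h3
    rw [ZMod.natCast_eq_zero_iff] at h3'
    exact hp3 ((Nat.prime_dvd_prime_iff_eq hp Nat.prime_three).1 h3')
  have hzero := hsum 0 (Nat.zero_le _)
  have hone := hsum p le_rfl
  rw [hchoose, Nat.choose_eq_zero_of_lt hp.pos] at hone
  simp only [Nat.choose_zero_right, Nat.cast_one, mul_one, Nat.cast_zero, zero_add] at hzero hone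
  rw [← mul_assoc] at hone
  rw [(mul_eq_zero.1 hone).resolve_right hthree] at hzero
  simp at hzero

end ZeroSum

section Three

variable {ι V : Type*} [DecidableEq ι] [AddCommGroup V] [Module (ZMod 3) V]

lemma exists_zero_sum_card_le_four [FiniteDimensional (ZMod 3) V]
    (hV : finrank (ZMod 3) V = 3) (v : ι → V)
    (I : Finset ι) (hI : #I = 13) :
    ∃ T ⊆ I, T.Nonempty ∧ #T ≤ 4 ∧ ∑ i ∈ T, v i = 0 := by
  classical
  by_contra! h
  have herase : ∀ j ∈ I, ∑ i ∈ I.erase j, v i = 0 := by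
    intro j hj
    have hJ : #(I.erase j) = 12 := by rw [card_erase_of_mem hj, hI]
    by_contra hne
    let F : Finset (Finset ι) := {T ∈ (I.erase j).powerset | ∑ i ∈ T, v i = 0 ∧ 3 ∣ #T}
    have hempty : ∅ ∈ F := by simp [F]
    have hF : ∀ T ∈ F.erase ∅, #T = 6 := by
      intro T hT
      simp only [F, mem_erase, mem_filter, mem_powerset] at hT
      obtain ⟨hTne, hTJ, h0, c, hc⟩ := hT
      have hTI : T ⊆ I := hTJ.trans (erase_subset _ _)
      have hle := card_le_card hTJ
      have hgt : 4 < #T := by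
        by_contra! hge
        exact h T hTI (nonempty_iff_ne_empty.2 hTne) hge h0
      have h12 : #T ≠ 12 := fun h12 => hne (eq_of_subset_of_card_le hTJ (by omega) ▸ h0)
      have h9 : #T ≠ 9 := by
        intro h9
        obtain ⟨A, hA, hAne, hAcard, hA0⟩ :=
          exists_zero_sum_subset_two_mul_card_le (p := 3) v T (by rw [hV]; omega) h0
        exact h A (hA.trans hTI) hAne (by omega) hA0
      omega
    have hsum : ∀ k, k ≤ 3 → ((0).choose k : ZMod 3) +
        #(F.erase ∅) * ((-1) ^ 6 * ((6).choose k : ZMod 3)) = 0 := by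
      intro k hk
      have := sum_zero_sum_dvd_card_neg_one_pow_mul_choose (p := 3) v (I.erase j) k
        (by rw [hV]; omega)
      rw [← add_sum_erase _ _ hempty,
        sum_congr rfl fun T hT => by rw [hF T hT], sum_const, nsmul_eq_mul] at this
      simpa using this
    have hzero := hsum 0 (by norm_num)
    have hthree := hsum 3 le_rfl
    generalize (#(F.erase ∅) : ZMod 3) = x at hzero hthree
    revert x
    decide
  have hconst : ∀ j ∈ I, v j = ∑ i ∈ I, v i := by
    intro j hj
    rw [← add_sum_erase _ _ hj, herase j hj, add_zero]
  obtain ⟨T, hTI, hT⟩ := exists_subset_card_eq (s := I) (n := 3) (by omega)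
  refine h T hTI (card_pos.1 (by omega)) (by omega) ?_
  rw [sum_congr rfl fun j hj => hconst j (hTI hj), sum_const, hT, ← Nat.cast_smul_eq_nsmul (ZMod 3)]
  exact zero_smul (ZMod 3) _

lemma exists_zero_sum_of_not_injOn [FiniteDimensional (ZMod 3) V]
    (hV : finrank (ZMod 3) V = 4) (v : ι → V)
    (I : Finset ι) (hI : #I = 15) (hv : ¬ Set.InjOn v I) :
    ∃ T ⊆ I, T.Nonempty ∧ #T ≤ 6 ∧ ∑ i ∈ T, v i = 0 := by
  simp only [Set.InjOn, not_forall] at hv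
  obtain ⟨i, hi, j, hj, hij, hne⟩ := hv
  rw [mem_coe] at hi hj
  by_cases hg : v i = 0
  · exact ⟨{i}, by simpa using hi, by simp, by simp, by simpa using hg⟩
  let U := Submodule.span (ZMod 3) {v i}
  have hU : finrank (ZMod 3) (V ⧸ U) = 3 := by
    have h1 := U.finrank_quotient_add_finrank
    have h2 : finrank (ZMod 3) U = 1 := finrank_span_singleton hg
    omega
  have hcard : #((I.erase i).erase j) = 13 := by
    rw [card_erase_of_mem (mem_erase.2 ⟨Ne.symm hne, hj⟩), card_erase_of_mem hi, hI]
  obtain ⟨T, hT, hTne, hTcard, hT0⟩ := exists_zero_sum_card_le_four hU (fun k => U.mkQ (v k)) _ hcard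
  have hTI : T ⊆ I := (hT.trans (erase_subset _ _)).trans (erase_subset _ _)
  have hjT : j ∉ T := fun h => notMem_erase _ _ (hT h)
  have hiT : i ∉ T := fun h => notMem_erase _ _ (mem_of_mem_erase (hT h))
  rw [← map_sum, Submodule.mkQ_apply, Submodule.Quotient.mk_eq_zero,
    Submodule.mem_span_singleton] at hT0
  obtain ⟨c, hc⟩ := hT0
  have hthree : v i + (v i + v i) = 0 := by
    have : (3 : ZMod 3) • v i = 0 := zero_smul (ZMod 3) _
    rw [← this]
    module
  obtain rfl | rfl | rfl : c = 0 ∨ c = 1 ∨ c = 2 :=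
    (by decide : ∀ c : ZMod 3, c = 0 ∨ c = 1 ∨ c = 2) c
  · exact ⟨T, hTI, hTne, by omega, by rw [← hc, zero_smul]⟩
  · refine ⟨insert i (insert j T), insert_subset hi (insert_subset hj hTI), by simp, ?_, ?_⟩
    · have := card_insert_le i (insert j T)
      have := card_insert_le j T
      omega
    · rw [sum_insert (by simp [hne, hiT]), sum_insert hjT, ← hc, ← hij, one_smul, hthree]
  · refine ⟨insert i T, insert_subset hi hTI, by simp, ?_, ?_⟩
    · have := card_insert_le i T
      omega
    · rw [sum_insert hiT, ← hc, two_smul, hthree]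

/-- In a family of distinct vectors, the subfamilies of length six with sum `x` containing a
given subfamily of length four differ from it by pairwise disjoint pairs, so three of them
produce a zero-sum subfamily of length six. -/
lemma card_filter_sum_eq_le_two (v : ι → V) (I S : Finset ι) (hv : Set.InjOn v I) (hS : #S = 4)
    (x : V) (h : ∀ T ⊆ I, T.Nonempty → #T ≤ 6 → ∑ i ∈ T, v i ≠ 0) [DecidableEq V] :
    #{B ∈ I.powersetCard 6 | S ⊆ B ∧ ∑ i ∈ B, v i = x} ≤ 2 := by
  by_contra! hlt
  obtain ⟨A, B, C, hA, hB, hC, hAB, hAC, hBC⟩ := two_lt_card_iff.1 hlt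
  have hblock : ∀ D, D ∈ ({B ∈ I.powersetCard 6 | S ⊆ B ∧ ∑ i ∈ B, v i = x} : Finset _) →
      D ⊆ I ∧ S ⊆ D ∧ #(D \ S) = 2 ∧ ∑ i ∈ D \ S, v i = x - ∑ i ∈ S, v i := by
    intro D hD
    simp only [mem_filter, mem_powersetCard] at hD
    obtain ⟨⟨hDI, hD6⟩, hSD, hDx⟩ := hD
    refine ⟨hDI, hSD, ?_, ?_⟩
    · rw [card_sdiff_of_subset hSD]
      omega
    · rw [← hDx, ← sum_sdiff hSD, add_sub_cancel_right]
  have hdisj : ∀ D E, D ∈ ({B ∈ I.powersetCard 6 | S ⊆ B ∧ ∑ i ∈ B, v i = x} : Finset _) →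
      E ∈ ({B ∈ I.powersetCard 6 | S ⊆ B ∧ ∑ i ∈ B, v i = x} : Finset _) → D ≠ E →
      Disjoint (D \ S) (E \ S) := by
    intro D E hD hE hDE
    obtain ⟨hDI, hSD, hD2, hDx⟩ := hblock D hD
    obtain ⟨hEI, hSE, hE2, hEx⟩ := hblock E hE
    rw [disjoint_left]
    intro y hyD hyE
    obtain ⟨a, ha⟩ := card_eq_one.1 ((card_erase_of_mem hyD).trans (by rw [hD2]))
    obtain ⟨b, hb⟩ := card_eq_one.1 ((card_erase_of_mem hyE).trans (by rw [hE2]))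
    rw [← add_sum_erase _ _ hyD, ha, sum_singleton] at hDx
    rw [← add_sum_erase _ _ hyE, hb, sum_singleton, ← hDx] at hEx
    have haD : a ∈ D \ S := mem_of_mem_erase (ha ▸ mem_singleton_self a)
    have hbE : b ∈ E \ S := mem_of_mem_erase (hb ▸ mem_singleton_self b)
    have hab : a = b := hv (hDI (mem_sdiff.1 haD).1) (hEI (mem_sdiff.1 hbE).1)
      (add_left_cancel hEx).symm
    apply hDE
    rw [← sdiff_union_of_subset hSD, ← sdiff_union_of_subset hSE, ← insert_erase hyD,
      ← insert_erase hyE, ha, hb, hab]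
  obtain ⟨hAI, -, hA2, hAx⟩ := hblock A hA
  obtain ⟨hBI, -, hB2, hBx⟩ := hblock B hB
  obtain ⟨hCI, -, hC2, hCx⟩ := hblock C hC
  have hABC : Disjoint (A \ S ∪ B \ S) (C \ S) :=
    disjoint_union_left.2 ⟨hdisj A C hA hC hAC, hdisj B C hB hC hBC⟩
  have hcard : #(A \ S ∪ B \ S ∪ C \ S) = 6 := by
    rw [card_union_of_disjoint hABC, card_union_of_disjoint (hdisj A B hA hB hAB), hA2, hB2, hC2]
  refine h (A \ S ∪ B \ S ∪ C \ S) (union_subset (union_subset (sdiff_subset.trans hAI)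
    (sdiff_subset.trans hBI)) (sdiff_subset.trans hCI)) (card_pos.1 (by omega)) hcard.le ?_
  rw [sum_union hABC, sum_union (hdisj A B hA hB hAB), hAx, hBx, hCx]
  have hthree : (3 : ZMod 3) • (x - ∑ i ∈ S, v i) = 0 := zero_smul (ZMod 3) _
  rw [← hthree]
  module

lemma card_filter_sum_eq_one [FiniteDimensional (ZMod 3) V]
    (hV : finrank (ZMod 3) V = 4) (v : ι → V)
    (I S : Finset ι) (hI : #I = 15) (hv : Set.InjOn v I) (hSI : S ⊆ I) (hS : #S = 4)
    (h : ∀ T ⊆ I, T.Nonempty → #T ≤ 6 → ∑ i ∈ T, v i ≠ 0) [DecidableEq V] :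
    #{B ∈ I.powersetCard 6 | S ⊆ B ∧ ∑ i ∈ B, v i = ∑ i ∈ I, v i} = 1 := by
  have hle := card_filter_sum_eq_le_two v I S hv hS (∑ i ∈ I, v i) h
  have hJ : #(I \ S) = 11 := by rw [card_sdiff_of_subset hSI, hI, hS]
  let F : Finset (Finset ι) := {T ∈ (I \ S).powerset | ∑ i ∈ T, v i = 0 ∧ 3 ∣ #T}
  have hempty : ∅ ∈ F := by simp [F]
  have hF : ∀ T ∈ F.erase ∅, T ⊆ I \ S ∧ ∑ i ∈ T, v i = 0 ∧ #T = 9 := by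
    intro T hT
    simp only [F, mem_erase, mem_filter, mem_powerset] at hT
    obtain ⟨hTne, hTJ, h0, c, hc⟩ := hT
    have hcard := card_le_card hTJ
    have hgt : 6 < #T := by
      by_contra! hge
      exact h T (hTJ.trans sdiff_subset) (nonempty_iff_ne_empty.2 hTne) hge h0
    exact ⟨hTJ, h0, by omega⟩
  have hbij : #(F.erase ∅) = #{B ∈ I.powersetCard 6 | S ⊆ B ∧ ∑ i ∈ B, v i = ∑ i ∈ I, v i} := by
    refine card_nbij' (I \ ·) (I \ ·) ?_ ?_ ?_ ?_
    · intro T hT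
      obtain ⟨hTJ, h0, h9⟩ := hF T hT
      have hTI := hTJ.trans sdiff_subset
      have hsum := sum_sdiff (f := v) hTI
      rw [h0, add_zero] at hsum
      simp only [coe_filter, Set.mem_ofPred_eq, mem_powersetCard]
      exact ⟨⟨sdiff_subset, by rw [card_sdiff_of_subset hTI]; omega⟩,
        fun s hs => mem_sdiff.2 ⟨hSI hs, fun hsT => (mem_sdiff.1 (hTJ hsT)).2 hs⟩, hsum⟩
    · intro B hB
      simp only [coe_filter, Set.mem_ofPred_eq, mem_powersetCard] at hB
      obtain ⟨⟨hBI, hB6⟩, hSB, hBsum⟩ := hB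
      have hsum := sum_sdiff (f := v) hBI
      have hcard : #(I \ B) = 9 := by rw [card_sdiff_of_subset hBI]; omega
      simp only [F, coe_erase, coe_filter, Set.mem_sdiff, Set.mem_ofPred_eq, mem_powerset,
        Set.mem_singleton_iff, hcard]
      refine ⟨⟨sdiff_subset_sdiff subset_rfl hSB, ?_, by norm_num⟩, ?_⟩
      · rwa [hBsum, add_eq_right] at hsum
      · exact (card_pos.1 (by omega)).ne_empty
    · intro T hT
      exact Finset.sdiff_sdiff_eq_self ((hF T hT).1.trans sdiff_subset)
    · intro B hB
      simp only [coe_filter, Set.mem_ofPred_eq, mem_powersetCard] at hB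
      exact Finset.sdiff_sdiff_eq_self hB.1.1
  have hsum := sum_zero_sum_dvd_card_neg_one_pow_mul_choose (p := 3) v (I \ S) 0
    (by rw [hV]; omega)
  rw [← add_sum_erase _ _ hempty,
    sum_congr rfl fun T hT => by rw [(hF T hT).2.2], sum_const, nsmul_eq_mul, hbij, card_empty] at hsum
  generalize #{B ∈ I.powersetCard 6 | S ⊆ B ∧ ∑ i ∈ B, v i = ∑ i ∈ I, v i} = N at hsum hle
  interval_cases N
  · simp at hsum
  · rfl
  · exact absurd hsum (by decide)

/-- The complements of the zero-sum subfamilies of length nine would form a Steiner system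
`S(4, 6, 15)`, which does not exist. -/
lemma exists_zero_sum_of_injOn [FiniteDimensional (ZMod 3) V]
    (hV : finrank (ZMod 3) V = 4) (v : ι → V)
    (I : Finset ι) (hI : #I = 15) (hv : Set.InjOn v I) :
    ∃ T ⊆ I, T.Nonempty ∧ #T ≤ 6 ∧ ∑ i ∈ T, v i = 0 := by
  classical
  by_contra! h
  obtain ⟨j, hj⟩ : I.Nonempty := card_pos.1 (by omega)
  let 𝓑 : Finset (Finset ι) := {B ∈ I.powersetCard 6 | j ∈ B ∧ ∑ i ∈ B, v i = ∑ i ∈ I, v i}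
  have hcount := sum_card_bipartiteAbove_eq_sum_card_bipartiteBelow
    (s := (I.erase j).powersetCard 3) (t := 𝓑) (fun R B => R ⊆ B)
  have habove : ∀ R ∈ (I.erase j).powersetCard 3, #(𝓑.bipartiteAbove (fun R B => R ⊆ B) R) = 1 := by
    intro R hR
    obtain ⟨hRI, hR3⟩ := mem_powersetCard.1 hR
    have hjR : j ∉ R := fun h => notMem_erase _ _ (hRI h)
    rw [← card_filter_sum_eq_one hV v I (insert j R) hI hv
      (insert_subset hj (hRI.trans (erase_subset _ _))) (by rw [card_insert_of_notMem hjR, hR3]) h]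
    congr 1
    ext B
    simp only [𝓑, bipartiteAbove, mem_filter, insert_subset_iff]
    tauto
  have hbelow : ∀ B ∈ 𝓑,
      #(((I.erase j).powersetCard 3).bipartiteBelow (fun R B => R ⊆ B) B) = 10 := by
    intro B hB
    simp only [𝓑, mem_filter, mem_powersetCard] at hB
    obtain ⟨⟨hBI, hB6⟩, hjB, -⟩ := hB
    have : ((I.erase j).powersetCard 3).bipartiteBelow (fun R B => R ⊆ B) B =
        (B.erase j).powersetCard 3 := by
      ext R
      simp only [bipartiteBelow, mem_filter, mem_powersetCard, subset_erase]
      exact ⟨fun h => ⟨⟨h.2, h.1.1.2⟩, h.1.2⟩, fun h => ⟨⟨⟨h.1.1.trans hBI, h.1.2⟩, h.2⟩, h.1.1⟩⟩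
    rw [this, card_powersetCard, card_erase_of_mem hjB, hB6]
    rfl
  rw [sum_congr rfl habove, sum_congr rfl hbelow, sum_const, sum_const, card_powersetCard,
    card_erase_of_mem hj, hI] at hcount
  have hchoose : (15 - 1).choose 3 = 364 := by decide
  rw [hchoose] at hcount
  simp only [smul_eq_mul] at hcount
  omega

end Three

/-- Some hyperplane contains more than the expected number of members of a family of nonzero
vectors, up to rounding. -/
lemma exists_dual_card_filter_gt {p : ℕ} [Fact p.Prime] {ι V : Type*} [AddCommGroup V]
    [Module (ZMod p) V] [FiniteDimensional (ZMod p) V] (v : ι → V) (I : Finset ι) {n M : ℕ}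
    (hV : finrank (ZMod p) V = n + 1) (hI : #I = p * M + 1) (hM : (p - 1) * M + 1 < p ^ n)
    (hv : ∀ i ∈ I, v i ≠ 0) :
    ∃ f : Dual (ZMod p) V, f ≠ 0 ∧ M < #{i ∈ I | f (v i) = 0} := by
  classical
  have : Finite (Dual (ZMod p) V) := Module.finite_of_finite (ZMod p)
  have : Fintype (Dual (ZMod p) V) := Fintype.ofFinite _
  by_contra! h
  have hdual : Fintype.card (Dual (ZMod p) V) = p ^ (n + 1) := by
    rw [Module.card_eq_pow_finrank (K := ZMod p), Subspace.dual_finrank_eq, hV, ZMod.card]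
  have hker : ∀ i ∈ I, #{f : Dual (ZMod p) V | f (v i) = 0} = p ^ n := by
    intro i hi
    have hsurj : Function.Surjective (Dual.eval (ZMod p) V (v i)) :=
      LinearMap.surjective (fun h0 => hv i hi ((Module.forall_dual_apply_eq_zero_iff _ _).1
        fun f => LinearMap.congr_fun h0 f))
    have hrank := (Dual.eval (ZMod p) V (v i)).finrank_range_add_finrank_ker
    rw [LinearMap.range_eq_top.2 hsurj, finrank_top, finrank_self, Subspace.dual_finrank_eq,
      hV] at hrank
    have hcard := Module.card_eq_pow_finrank (K := ZMod p)
      (V := LinearMap.ker (Dual.eval (ZMod p) V (v i)))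
    rw [ZMod.card, show finrank (ZMod p) (LinearMap.ker (Dual.eval (ZMod p) V (v i))) = n by omega]
      at hcard
    rw [← hcard, Fintype.card_subtype]
    simp
  have hcount : ∑ f : Dual (ZMod p) V, #{i ∈ I | f (v i) = 0} = #I * p ^ n := by
    simp only [card_filter]
    rw [sum_comm]
    simp only [← card_filter]
    rw [sum_congr rfl hker, sum_const, smul_eq_mul]
  rw [← add_sum_erase _ _ (mem_univ 0)] at hcount
  have hle := sum_le_card_nsmul (univ.erase (0 : Dual (ZMod p) V))
    (fun f => #{i ∈ I | f (v i) = 0}) M fun f hf => h f (ne_of_mem_erase hf)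
  rw [card_erase_of_mem (mem_univ _), card_univ, hdual, smul_eq_mul] at hle
  simp only [LinearMap.zero_apply, filter_true, hI] at hcount
  have hp := (Fact.out : p.Prime).two_le
  obtain ⟨q, rfl⟩ : ∃ q, p = q + 1 := ⟨p - 1, by omega⟩
  have hpos : 1 ≤ (q + 1) ^ (n + 1) := Nat.one_le_pow _ _ (by omega)
  zify [hpos] at *
  rw [pow_succ] at *
  push_cast at *
  nlinarith

lemma exists_zero_sum_of_finrank_eq_four {p : ℕ} [Fact p.Prime] {ι V : Type*} [DecidableEq ι]
    [AddCommGroup V] [Module (ZMod p) V] [FiniteDimensional (ZMod p) V]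
    (hV : finrank (ZMod p) V = 4) (v : ι → V) (I : Finset ι) (hI : #I = 6 * p - 3) :
    ∃ T ⊆ I, T.Nonempty ∧ #T ≤ 2 * p ∧ ∑ i ∈ T, v i = 0 := by
  by_cases hp3 : p = 3
  · subst hp3
    by_cases hv : Set.InjOn v I
    · exact exists_zero_sum_of_injOn hV v I hI hv
    · exact exists_zero_sum_of_not_injOn hV v I hI hv
  · exact exists_zero_sum_of_prime_ne_three hp3 hV v I hI

lemma exists_zero_sum_of_finrank_eq_add_four {p : ℕ} [Fact p.Prime] {ι : Type*} [DecidableEq ι]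
    (n : ℕ) {V : Type*} [AddCommGroup V] [Module (ZMod p) V] [FiniteDimensional (ZMod p) V]
    (hV : finrank (ZMod p) V = n + 4) (v : ι → V) (I : Finset ι)
    (hI : #I = (6 * p - 4) * p ^ n + 1) :
    ∃ T ⊆ I, T.Nonempty ∧ #T ≤ 2 * p ∧ ∑ i ∈ T, v i = 0 := by
  have hp := (Fact.out : p.Prime).two_le
  induction n generalizing V I with
  | zero => exact exists_zero_sum_of_finrank_eq_four hV v I (by rw [pow_zero] at hI; omega)
  | succ n ih =>
    by_cases h0 : ∃ i ∈ I, v i = 0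
    · obtain ⟨i, hi, hvi⟩ := h0
      exact ⟨{i}, by simpa using hi, by simp, by rw [card_singleton]; omega, by simpa using hvi⟩
    push Not at h0
    obtain ⟨f, hf, hcard⟩ := exists_dual_card_filter_gt (n := n + 4) (M := (6 * p - 4) * p ^ n) v I
      (by omega) (by rw [hI]; ring) (by
        obtain ⟨q, rfl⟩ : ∃ q, p = q + 2 := ⟨p - 2, by omega⟩
        have hpos : 1 ≤ (q + 2) ^ n := Nat.one_le_pow _ _ (by omega)
        rw [show q + 2 - 1 = q + 1 by omega, show 6 * (q + 2) - 4 = 6 * q + 8 by omega, pow_add]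
        have h4 : (q + 1) * (6 * q + 8) + 1 < (q + 2) ^ 4 := by
          ring_nf
          nlinarith [Nat.zero_le q, Nat.zero_le (q ^ 2), Nat.zero_le (q ^ 3), Nat.zero_le (q ^ 4)]
        calc _ ≤ (q + 2) ^ n * ((q + 1) * (6 * q + 8) + 1) := by nlinarith
          _ < _ := Nat.mul_lt_mul_of_pos_left h4 (by omega)) h0
    obtain ⟨J, hJ, hJcard⟩ := exists_subset_card_eq (Nat.succ_le_of_lt hcard)
    have hker : finrank (ZMod p) (LinearMap.ker f) = n + 4 := by
      have hrank := f.finrank_range_add_finrank_ker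
      rw [LinearMap.range_eq_top.2 (LinearMap.surjective hf), finrank_top, finrank_self,
        hV] at hrank
      omega
    let w : ι → LinearMap.ker f := fun i => if h : f (v i) = 0 then ⟨v i, h⟩ else 0
    obtain ⟨T, hTJ, hTne, hTcard, hT0⟩ := ih hker w J hJcard
    refine ⟨T, hTJ.trans (hJ.trans (filter_subset _ _)), hTne, hTcard, ?_⟩
    have hw : ∀ i ∈ T, v i = (w i : V) := fun i hi => by
      simp [w, (mem_filter.1 (hJ (hTJ hi))).2]
    rw [sum_congr rfl hw, ← Submodule.coe_sum, hT0, Submodule.coe_zero]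

theorem zero_sum_le_two_p_of_long_sequence (p d : ℕ) (hp : p.Prime) (hd : 4 ≤ d) :
    ∀ S : Multiset (Fin d → ZMod p), S.card = (6 * p - 4) * p ^ (d - 4) + 1 →
      ∃ T : Multiset (Fin d → ZMod p),
        T ≤ S ∧ T ≠ 0 ∧ T.card ≤ 2 * p ∧ T.sum = 0 := by
  classical
  intro S hS
  have : Fact p.Prime := ⟨hp⟩
  let v : S.ToType → Fin d → ZMod p := fun x => x.1
  obtain ⟨T, -, hTne, hTcard, hT0⟩ := exists_zero_sum_of_finrank_eq_add_four (p := p) (d - 4)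
    (by simp only [finrank_fin_fun]; omega) v univ (by rw [card_univ, Multiset.card_coe, hS])
  refine ⟨T.val.map v, ?_, ?_, by simpa using hTcard, hT0⟩
  · calc T.val.map v ≤ univ.val.map v := Multiset.map_le_map (val_le_iff.2 (subset_univ T))
      _ = S := Multiset.map_univ_coe S
  · simpa using hTne.ne_empty
end

section
/- Let p be a prime and d ≥ 2 an integer. Then there exist integers k and M such that M ≥ η((ℤ/pℤ)^d), every sequence of M elements of (ℤ/pℤ)^d contains k pairwise disjoint nonempty zero-sum subsequences, and M ≤ p^{d−1} + p·k. -/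
/-- The constant `η(G)`: the least `t` such that every multiset of `t` elements of `G`
contains a nonempty zero-sum submultiset of length at most `exp(G)`. -/
noncomputable def etaConstant (G : Type*) [AddCommGroup G] : ℕ :=
  sInf {t : ℕ | ∀ S : Multiset G, S.card = t →
    ∃ T : Multiset G, T ≤ S ∧ T ≠ 0 ∧ T.card ≤ AddMonoid.exponent G ∧ T.sum = 0}

open MvPolynomial in
/-- A consequence of the Chevalley–Warning theorem: if `S` has more than `(p - 1) * #κ` elements,
some nonempty part of `S` has zero sum with respect to all the weights `f · c`, `c : κ`. -/
theorem exists_le_forall_sum_map_eq_zero {p : ℕ} [Fact p.Prime] {α κ : Type*} [Fintype κ]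
    (f : α → κ → ZMod p) (S : Multiset α) (hS : Fintype.card κ * (p - 1) < S.card) :
    ∃ T ≤ S, T ≠ 0 ∧ ∀ c, (T.map (f · c)).sum = 0 := by
  classical
  have hp : p.Prime := Fact.out
  let P : κ → MvPolynomial S (ZMod p) := fun c => ∑ i : S, f i c • X i ^ (p - 1)
  have hdeg : (∑ c, (P c).totalDegree) < Fintype.card S := by
    refine lt_of_le_of_lt (Finset.sum_le_card_nsmul _ _ (p - 1) fun c _ => ?_) (by simpa using hS)
    refine totalDegree_finsetSum_le fun i _ => ?_
    exact (totalDegree_smul_le ..).trans (totalDegree_X_pow ..).le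
  have hdvd := char_dvd_card_solutions_of_fintype_sum_lt p hdeg
  let zero_sol : {x : S → ZMod p // ∀ c, eval x (P c) = 0} :=
    ⟨0, fun c => by simp [P, hp.one_lt, tsub_eq_zero_iff_le]⟩
  obtain ⟨x, hx⟩ := Fintype.exists_ne_of_one_lt_card (hp.one_lt.trans_le <|
    Nat.le_of_dvd (@Fintype.card_pos _ _ ⟨zero_sol⟩) hdvd) zero_sol
  let A : Finset S := {i | x.1 i ≠ 0}
  refine ⟨A.val.map fun i : S => (i : α), ?_, ?_, fun c => ?_⟩
  · conv_rhs => rw [← S.map_univ_coe]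
    exact Multiset.map_le_map (Finset.val_le_iff.2 (Finset.subset_univ _))
  · rw [← Subtype.coe_ne_coe, Function.ne_iff] at hx
    obtain ⟨i, hi⟩ := hx
    have hA : i ∈ A := by simpa [A, zero_sol] using hi
    intro h
    rw [Multiset.map_eq_zero, Finset.val_eq_zero] at h
    simp [h] at hA
  · rw [Multiset.map_map]
    change ∑ i ∈ A, f i c = 0
    simpa [P, A, ZMod.pow_card_sub_one, Finset.sum_filter] using x.2 c

theorem exists_le_card_eq {α : Type*} {S : Multiset α} {n : ℕ} (hn : n ≤ S.card) :
    ∃ T ≤ S, T.card = n := by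
  have hpos : 0 < (Multiset.powersetCard n S).card := by
    rw [Multiset.card_powersetCard]
    exact Nat.choose_pos hn
  obtain ⟨T, hT⟩ := Multiset.card_pos_iff_exists_mem.1 hpos
  exact ⟨T, Multiset.mem_powersetCard.1 hT⟩

/-- The sequence `S` contains `k` pairwise disjoint nonempty zero-sum subsequences. -/
def HasZeroSumSystem {G : Type*} [AddCommMonoid G] (S : Multiset G) (k : ℕ) : Prop :=
  ∃ L : Multiset (Multiset G), L.card = k ∧ L.sum ≤ S ∧ ∀ T ∈ L, T ≠ 0 ∧ T.sum = 0

namespace HasZeroSumSystem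

variable {G : Type*} [AddCommMonoid G] {S S' T : Multiset G} {k k' : ℕ}

theorem zero (S : Multiset G) : HasZeroSumSystem S 0 :=
  ⟨0, by simp⟩

theorem one (hTS : T ≤ S) (hT : T ≠ 0) (hsum : T.sum = 0) : HasZeroSumSystem S 1 :=
  ⟨{T}, by simp, by simpa using hTS, by simp [hT, hsum]⟩

theorem add (h : HasZeroSumSystem S k) (h' : HasZeroSumSystem S' k') :
    HasZeroSumSystem (S + S') (k + k') := by
  obtain ⟨L, rfl, hL, hz⟩ := h
  obtain ⟨L', rfl, hL', hz'⟩ := h'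
  refine ⟨L + L', by simp, by simpa using add_le_add hL hL', fun T hT => ?_⟩
  exact (Multiset.mem_add.1 hT).elim (hz T) (hz' T)

theorem mono (h : HasZeroSumSystem S k) (hS : S ≤ S') (hk : k' ≤ k) :
    HasZeroSumSystem S' k' := by
  obtain ⟨L, rfl, hL, hz⟩ := h
  obtain ⟨L', hL', rfl⟩ := exists_le_card_eq hk
  refine ⟨L', rfl, ?_, fun T hT => hz T (Multiset.mem_of_le hL' hT)⟩
  obtain ⟨R, rfl⟩ := Multiset.le_iff_exists_add.1 hL'
  exact (by simp : L'.sum ≤ (L' + R).sum).trans (hL.trans hS)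

theorem replicate {n : ℕ} {g : G} (hn : n ≠ 0) (hg : n • g = 0) (k : ℕ) :
    HasZeroSumSystem (Multiset.replicate (n * k) g) k :=
  ⟨Multiset.replicate k (Multiset.replicate n g), by simp,
    by simp [Multiset.nsmul_replicate, mul_comm], fun T hT => by
      rw [Multiset.eq_of_mem_replicate hT]
      refine ⟨fun h => hn ?_, by simpa using hg⟩
      simpa using congrArg Multiset.card h⟩

theorem map {H : Type*} [AddCommMonoid H] (φ : G →+ H) (h : HasZeroSumSystem S k) :
    HasZeroSumSystem (S.map φ) k := by
  obtain ⟨L, rfl, hL, hz⟩ := h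
  refine ⟨L.map (Multiset.map φ), by simp, ?_, fun T hT => ?_⟩
  · exact (map_multiset_sum (Multiset.mapAddMonoidHom φ) L).symm.trans_le
      (Multiset.map_le_map hL)
  · obtain ⟨U, hU, rfl⟩ := Multiset.mem_map.1 hT
    refine ⟨by simpa using (hz U hU).1, ?_⟩
    rw [← map_multiset_sum, (hz U hU).2, map_zero]

end HasZeroSumSystem

/-- The Davenport constant of `C_p ^ r` is at most `r (p - 1) + 1`. -/
theorem exists_le_sum_eq_zero_of_lt_card {p r : ℕ} [Fact p.Prime]
    (S : Multiset (Fin r → ZMod p)) (hS : r * (p - 1) < S.card) :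
    ∃ T ≤ S, T ≠ 0 ∧ T.sum = 0 := by
  obtain ⟨T, hT, h0, h⟩ := exists_le_forall_sum_map_eq_zero (fun g => g) S (by simpa using hS)
  refine ⟨T, hT, h0, funext fun c => ?_⟩
  exact (map_multiset_sum (Pi.evalAddMonoidHom (fun _ => ZMod p) c) T).trans (h c)

/-- Every sequence of `3p - 2` elements of `C_p ^ 2` has a zero-sum subsequence of length between
`1` and `p`. -/
theorem exists_short_zero_sum_rank_two {p : ℕ} [Fact p.Prime]
    (S : Multiset (Fin 2 → ZMod p)) (hS : 3 * (p - 1) < S.card) :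
    ∃ T ≤ S, T ≠ 0 ∧ T.card ≤ p ∧ T.sum = 0 := by
  classical
  have hp : 2 ≤ p := (Fact.out : p.Prime).two_le
  obtain ⟨S', hS', hcard⟩ := exists_le_card_eq (Nat.succ_le_of_lt hS)
  obtain ⟨T, hT, h0, h⟩ := exists_le_forall_sum_map_eq_zero
    (fun (g : Fin 2 → ZMod p) (c : Option (Fin 2)) => c.elim 1 g) S' (by simp [hcard])
  have hsum : T.sum = 0 := funext fun c =>
    (map_multiset_sum (Pi.evalAddMonoidHom (fun _ => ZMod p) c) T).trans (h (some c))
  have hdvd : p ∣ T.card := by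
    rw [← CharP.cast_eq_zero_iff (ZMod p)]
    simpa using h none
  have hle := Multiset.card_le_card hT
  obtain ⟨m, hm⟩ := hdvd
  have hm3 : m < 3 := by
    by_contra! hcon
    have := Nat.mul_le_mul_left p hcon
    omega
  rcases Nat.lt_or_ge m 2 with hm2 | hm2
  · refine ⟨T, hT.trans hS', h0, ?_, hsum⟩
    nlinarith
  obtain rfl : m = 2 := by omega
  obtain ⟨a, ha⟩ := Multiset.exists_mem_of_ne_zero h0
  have hea := Multiset.card_erase_add_one ha
  obtain ⟨U, hU, hU0, hUsum⟩ := exists_le_sum_eq_zero_of_lt_card (T.erase a) (by omega)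
  have hUT : U ≤ T := hU.trans (Multiset.erase_le a T)
  have hUcard := Multiset.card_le_card hU
  have hsub := Multiset.card_sub hUT
  rcases Nat.le_total U.card p with hc | hc
  · exact ⟨U, hUT.trans (hT.trans hS'), hU0, hc, hUsum⟩
  · refine ⟨T - U, (Multiset.sub_le_self T U).trans (hT.trans hS'), fun h => ?_, by omega, ?_⟩
    · rw [h, Multiset.card_zero] at hsub
      omega
    · have := congrArg Multiset.sum (Multiset.sub_add_cancel hUT)
      rwa [Multiset.sum_add, hUsum, add_zero, hsum] at this

/-- The `k`-wise Davenport constant of `C_p ^ 2` is at most `p k + p - 1`. -/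
theorem hasZeroSumSystem_rank_two {p : ℕ} [Fact p.Prime] (k : ℕ)
    (S : Multiset (Fin 2 → ZMod p)) (hS : p * k + (p - 1) ≤ S.card) :
    HasZeroSumSystem S k := by
  classical
  have hp : 2 ≤ p := (Fact.out : p.Prime).two_le
  induction k generalizing S with
  | zero => exact .zero S
  | succ k ih =>
    rw [Nat.mul_succ] at hS
    rcases Nat.eq_zero_or_pos k with rfl | hk
    · obtain ⟨T, hT, h0, hsum⟩ := exists_le_sum_eq_zero_of_lt_card S (by omega)
      exact .one hT h0 hsum
    · have hpk : p ≤ p * k := Nat.le_mul_of_pos_right p hk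
      obtain ⟨T, hT, h0, hc, hsum⟩ := exists_short_zero_sum_rank_two S (by omega)
      have hsub := Multiset.card_sub hT
      have := (ih (S - T) (by omega)).add (.one le_rfl h0 hsum)
      rwa [Multiset.sub_add_cancel hT] at this

section Covering

universe u

variable {p : ℕ} [Fact p.Prime] {V : Type u} [AddCommGroup V] [Module (ZMod p) V]

/-- A sequence in a plane through `e`, completed by fewer than `p` copies of `e`. -/
theorem exists_hasZeroSumSystem_add_replicate_of_plane (e g : V) (T : Multiset V)
    (hT : ∀ v ∈ T, ∃ a b : ZMod p, v = a • e + b • g) :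
    ∃ N k : ℕ, N ≤ p - 1 ∧ HasZeroSumSystem (T + Multiset.replicate N e) k ∧
      T.card + N = p * k + (p - 1) := by
  have hp : 2 ≤ p := (Fact.out : p.Prime).two_le
  refine ⟨p - 1 - T.card % p, T.card / p, by omega, ?_, ?_⟩
  · let φ : (Fin 2 → ZMod p) →ₗ[ZMod p] V := Fintype.linearCombination (ZMod p) ![e, g]
    have hφ : ∀ v ∈ T + Multiset.replicate (p - 1 - T.card % p) e, ∃ x, φ x = v := by
      intro v hv
      rcases Multiset.mem_add.1 hv with hv | hv
      · obtain ⟨a, b, rfl⟩ := hT v hv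
        exact ⟨![a, b], by simp [φ, Fintype.linearCombination_apply]⟩
      · rw [Multiset.eq_of_mem_replicate hv]
        exact ⟨![1, 0], by simp [φ, Fintype.linearCombination_apply]⟩
    obtain ⟨S, hS⟩ : ∃ S, Multiset.map φ S = T + Multiset.replicate (p - 1 - T.card % p) e := by
      refine ⟨(T + Multiset.replicate (p - 1 - T.card % p) e).map (Function.invFun φ), ?_⟩
      rw [Multiset.map_map]
      exact (Multiset.map_congr rfl fun v hv => Function.invFun_eq (hφ v hv)).trans
        (Multiset.map_id' _)
    have hcard := congrArg Multiset.card hS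
    rw [Multiset.card_map, Multiset.card_add, Multiset.card_replicate] at hcard
    rw [← hS]
    refine (hasZeroSumSystem_rank_two _ S ?_).map φ.toAddMonoidHom
    have := Nat.div_add_mod T.card p
    have := Nat.mod_lt T.card (by omega : 0 < p)
    omega
  · have := Nat.div_add_mod T.card p
    have := Nat.mod_lt T.card (by omega : 0 < p)
    omega

/-- A sequence covered by the planes through `e` and `g q`, `q ∈ F`, completed by copies of `e`. -/
theorem exists_hasZeroSumSystem_add_replicate {ι : Type*} (e : V) (g : ι → V) (c : V → ι)
    (hc : ∀ v, ∃ a b : ZMod p, v = a • e + b • g (c v)) (F : Finset ι) (T : Multiset V)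
    (hT : ∀ v ∈ T, c v ∈ F) :
    ∃ N k : ℕ, N ≤ F.card * (p - 1) ∧ HasZeroSumSystem (T + Multiset.replicate N e) k ∧
      T.card + N = p * k + F.card * (p - 1) := by
  classical
  induction F using Finset.induction_on generalizing T with
  | empty =>
    obtain rfl : T = 0 := Multiset.eq_zero_of_forall_notMem fun v hv => by simpa using hT v hv
    exact ⟨0, 0, by simp, .zero _, by simp⟩
  | insert q F hq ih =>
    obtain ⟨N, k, hN, hz, hk⟩ := exists_hasZeroSumSystem_add_replicate_of_plane (p := p) e (g q)
      (T.filter (c · = q)) fun v hv => by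
        obtain ⟨a, b, h⟩ := hc v
        exact ⟨a, b, by rwa [(Multiset.mem_filter.1 hv).2] at h⟩
    obtain ⟨N', k', hN', hz', hk'⟩ := ih (T.filter (¬ c · = q)) fun v hv => by
      obtain ⟨hv, hne⟩ := Multiset.mem_filter.1 hv
      exact Finset.mem_of_mem_insert_of_ne (hT v hv) hne
    have hsplit := Multiset.filter_add_not (c · = q) T
    have hcard := congrArg Multiset.card hsplit
    rw [Multiset.card_add] at hcard
    rw [Finset.card_insert_of_notMem hq]
    refine ⟨N + N', k + k', by rw [add_mul]; omega, ?_, by rw [add_mul, mul_add]; omega⟩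
    have h := hz.add hz'
    rwa [add_add_add_comm, hsplit, ← Multiset.replicate_add] at h

/-- The planes through a nonzero `e` are parametrised by the points of a projective space. -/
theorem exists_planes_through [Finite V] (e : V) (he : e ≠ 0) (hV : p < Nat.card V) :
    ∃ (ι : Type u) (_ : Fintype ι) (g : ι → V) (c : V → ι),
      (∀ v, ∃ a b : ZMod p, v = a • e + b • g (c v)) ∧
      p * (Fintype.card ι * (p - 1) + 1) = Nat.card V := by
  classical
  let E : Submodule (ZMod p) V := Submodule.span (ZMod p) {e}
  let Q := V ⧸ E
  have hE : Nat.card E = p := by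
    have := Nat.card_congr (LinearEquiv.toSpanNonzeroSingleton (ZMod p) V e he).toEquiv
    rw [← this, Nat.card_zmod]
  have hcard : Nat.card V = Nat.card Q * p := by
    rw [← hE]
    exact AddSubgroup.card_eq_card_quotient_mul_card_addSubgroup E.toAddSubgroup
  have : Finite Q := Quotient.finite _
  have : Nontrivial Q := by
    rw [← Finite.one_lt_card_iff_nontrivial]
    by_contra! hle
    have := Nat.mul_le_mul_right p hle
    omega
  let ι := Projectivization (ZMod p) Q
  have : Fintype ι := Fintype.ofFinite ι
  obtain ⟨w, hw⟩ := exists_ne (0 : Q)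
  let c : V → ι := fun v =>
    if h : E.mkQ v = 0 then Projectivization.mk _ w hw else Projectivization.mk _ (E.mkQ v) h
  choose g hg using fun q : ι => E.mkQ_surjective q.rep
  refine ⟨ι, this, g, c, fun v => ?_, ?_⟩
  · obtain ⟨b, hb⟩ : ∃ b : ZMod p, E.mkQ v = b • E.mkQ (g (c v)) := by
      by_cases h : E.mkQ v = 0
      · exact ⟨0, by simpa using h⟩
      · obtain ⟨a, ha⟩ := Projectivization.exists_smul_eq_mk_rep (ZMod p) (E.mkQ v) h
        refine ⟨(a⁻¹ : (ZMod p)ˣ), ?_⟩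
        have hcv : c v = Projectivization.mk _ (E.mkQ v) h := dif_neg h
        rw [hg, hcv, ← ha]
        exact (inv_smul_smul a _).symm
    rw [← map_smul, ← sub_eq_zero, ← map_sub, Submodule.mkQ_apply,
      Submodule.Quotient.mk_eq_zero] at hb
    obtain ⟨a, ha⟩ := Submodule.mem_span_singleton.1 hb
    exact ⟨a, b, by rw [ha, sub_add_cancel]⟩
  · have h := Projectivization.card' (ZMod p) Q
    rw [Nat.card_zmod, Nat.card_eq_fintype_card (α := Projectivization (ZMod p) Q)] at h
    rw [hcard, h, mul_comm]

/-- If `e ≠ 0` occurs often enough in `S`, a sequence `S` of length `#V / p + p * k` contains `k` disjoint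
zero-sum subsequences. -/
theorem hasZeroSumSystem_of_replicate_le [Finite V] {n k : ℕ} {e : V} (he : e ≠ 0)
    (hn : 1 < n) (hV : Nat.card V = p * n) {S : Multiset V}
    (heS : Multiset.replicate n e ≤ S) (hS : S.card = n + p * k) :
    HasZeroSumSystem S k := by
  classical
  have hp : 2 ≤ p := (Fact.out : p.Prime).two_le
  obtain ⟨ι, _, g, c, hc, hcard⟩ := exists_planes_through (p := p) e he
    (by rw [hV]; exact lt_mul_of_one_lt_right (by omega) hn)
  have hι : Fintype.card ι * (p - 1) + 1 = n :=
    Nat.eq_of_mul_eq_mul_left (by omega) (hcard.trans hV)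
  obtain ⟨T, rfl⟩ := Multiset.le_iff_exists_add.1 heS
  obtain ⟨N, j, hN, hz, hj⟩ := exists_hasZeroSumSystem_add_replicate e g c hc Finset.univ T
    fun v _ => Finset.mem_univ _
  rw [Finset.card_univ] at hN hj
  rw [Multiset.card_add, Multiset.card_replicate] at hS
  have hpe : p • e = 0 := by
    rw [← Nat.cast_smul_eq_nsmul (ZMod p), CharP.cast_eq_zero, zero_smul]
  have hdiv := Nat.div_add_mod (n - N) p
  have hmod := Nat.mod_lt (n - N) (by omega : 0 < p)
  refine (hz.add (.replicate (by omega) hpe ((n - N) / p))).mono ?_ ?_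
  · rw [add_assoc, ← Multiset.replicate_add, add_comm T]
    gcongr
    omega
  · by_contra! hlt
    have := Nat.mul_le_mul_left p (Nat.succ_le_of_lt hlt)
    rw [Nat.succ_eq_add_one, mul_add, mul_add] at this
    omega

end Covering

/-- Pigeonhole: a sequence of length greater than `n * #G` contains some element `n` times. -/
theorem exists_replicate_le_of_mul_lt_card {G : Type*} [Fintype G] {n : ℕ} {S : Multiset G}
    (hS : n * Fintype.card G < S.card) : ∃ g, Multiset.replicate n g ≤ S := by
  classical
  by_contra! h
  have hle : ∑ g, S.count g ≤ Fintype.card G * n := by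
    refine Finset.sum_le_card_nsmul _ _ _ fun g _ => ?_
    have := mt Multiset.le_count_iff_replicate_le.1 (h g)
    omega
  rw [Multiset.sum_count_eq_card fun a _ => Finset.mem_univ a, mul_comm] at hle
  omega

theorem etaConstant_le {G : Type*} [AddCommGroup G] [Fintype G] {M : ℕ}
    (hM : AddMonoid.exponent G * Fintype.card G < M) : etaConstant G ≤ M := by
  refine Nat.sInf_le fun S hS => ?_
  obtain ⟨g, hg⟩ := exists_replicate_le_of_mul_lt_card (hM.trans_eq hS.symm)
  refine ⟨_, hg, fun h => ?_, by simp, by simp [AddMonoid.exponent_nsmul_eq_zero]⟩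
  have hz : AddMonoid.exponent G = 0 := by simpa using congrArg Multiset.card h
  exact AddMonoid.exponent_ne_zero_of_finite hz

theorem exists_disjoint_zero_sum_system (p d : ℕ) (hp : p.Prime) (hd : 2 ≤ d) :
    ∃ k M : ℕ,
      etaConstant (Fin d → ZMod p) ≤ M ∧
      (∀ S : Multiset (Fin d → ZMod p), S.card = M →
        ∃ L : Multiset (Multiset (Fin d → ZMod p)),
          L.card = k ∧ L.sum ≤ S ∧ ∀ T ∈ L, T ≠ 0 ∧ T.sum = 0) ∧
      M ≤ p ^ (d - 1) + p * k := by
  classical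
  have : Fact p.Prime := ⟨hp⟩
  set n := p ^ (d - 1) with hn
  have hn1 : 1 < n := Nat.one_lt_pow (by omega) hp.one_lt
  have hV : Fintype.card (Fin d → ZMod p) = p * n := by
    rw [Fintype.card_fun, ZMod.card, Fintype.card_fin, hn, ← pow_succ', Nat.sub_add_cancel]
    omega
  have hp2 := hp.two_le
  refine ⟨n * (p * n), n + p * (n * (p * n)), etaConstant_le ?_, fun S hS => ?_, le_rfl⟩
  · have hexp : AddMonoid.exponent (Fin d → ZMod p) ≤ p := by
      refine Nat.le_of_dvd hp.pos (AddMonoid.exponent_dvd_of_forall_nsmul_eq_zero fun g => ?_)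
      ext i
      simp
    rw [hV]
    calc _ ≤ p * (p * n) := Nat.mul_le_mul_right _ hexp
      _ ≤ p * (n * (p * n)) := Nat.mul_le_mul_left _ (Nat.le_mul_of_pos_left _ (by omega))
      _ < _ := by omega
  change HasZeroSumSystem S _
  by_cases h : ∃ e ≠ 0, Multiset.replicate n e ≤ S
  · obtain ⟨e, he, heS⟩ := h
    exact hasZeroSumSystem_of_replicate_le he hn1 (by rw [Nat.card_eq_fintype_card, hV]) heS hS
  · have hzero : n * (p * n) ≤ S.count 0 := by
      have hne : (S.filter (¬ · = 0)).card ≤ n * (p * n) := by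
        by_contra! hlt
        obtain ⟨e, he⟩ := exists_replicate_le_of_mul_lt_card (hV ▸ hlt)
        have hmem : e ∈ S.filter (¬ · = 0) :=
          Multiset.mem_of_le he (Multiset.mem_replicate.2 ⟨by omega, rfl⟩)
        exact h ⟨e, (Multiset.mem_filter.1 hmem).2, he.trans (Multiset.filter_le _ _)⟩
      have hsplit := congrArg Multiset.card (Multiset.filter_add_not (· = 0) S)
      rw [Multiset.card_add, Multiset.filter_eq', Multiset.card_replicate] at hsplit
      have := Nat.mul_le_mul_right (n * (p * n)) hp2
      omega
    have hrep := HasZeroSumSystem.replicate one_ne_zero (one_nsmul (0 : Fin d → ZMod p))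
      (n * (p * n))
    rw [one_mul] at hrep
    exact hrep.mono (Multiset.le_count_iff_replicate_le.1 hzero) le_rfl
end

section
/- Let p be a prime. Every sequence of 6p − 3 elements of (ℤ/pℤ)^3 contains a nonempty zero-sum subsequence of length at most (3p − 1)/2. -/
open Finset

/-- The functions on `Finset ι` that are `R`-linear combinations of the indicators `U ↦ [A ⊆ U]`
with `#A ≤ d`, i.e. the functions on the Boolean cube given by polynomials of degree at most `d`. -/
def lowDegree (R ι : Type*) [CommRing R] [DecidableEq ι] (d : ℕ) :
    Submodule R (Finset ι → R) :=
  Submodule.span R {F | ∃ A : Finset ι, #A ≤ d ∧ F = fun U => if A ⊆ U then 1 else 0}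

namespace lowDegree

variable {R ι : Type*} [CommRing R] [DecidableEq ι]

theorem indicator_mem {d : ℕ} (A : Finset ι) (hA : #A ≤ d) :
    (fun U => if A ⊆ U then 1 else 0) ∈ lowDegree R ι d :=
  Submodule.subset_span ⟨A, hA, rfl⟩

theorem mono {d e : ℕ} (h : d ≤ e) : lowDegree R ι d ≤ lowDegree R ι e :=
  Submodule.span_mono fun _ ⟨A, hA, hF⟩ => ⟨A, hA.trans h, hF⟩

theorem one_mem : (1 : Finset ι → R) ∈ lowDegree R ι 0 := by
  have h := indicator_mem (R := R) (∅ : Finset ι) card_empty.le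
  simpa using! h

theorem const_mem (c : R) : (fun _ => c) ∈ lowDegree R ι 0 := by
  convert (lowDegree R ι 0).smul_mem c one_mem using 1
  ext U
  simp

theorem mul_mem {d e : ℕ} {F G : Finset ι → R} (hF : F ∈ lowDegree R ι d)
    (hG : G ∈ lowDegree R ι e) : F * G ∈ lowDegree R ι (d + e) := by
  have h := Submodule.mul_mem_mul hF hG
  rw [lowDegree, lowDegree, Submodule.span_mul_span] at h
  refine Submodule.span_mono ?_ h
  rintro _ ⟨_, ⟨A, hA, rfl⟩, _, ⟨B, hB, rfl⟩, rfl⟩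
  refine ⟨A ∪ B, (card_union_le A B).trans (add_le_add hA hB), ?_⟩
  ext U
  by_cases hAU : A ⊆ U <;> simp [union_subset_iff, hAU]

theorem pow_mem {d : ℕ} {F : Finset ι → R} (hF : F ∈ lowDegree R ι d) (n : ℕ) :
    F ^ n ∈ lowDegree R ι (n * d) := by
  induction n with
  | zero => simpa using one_mem
  | succ n ih =>
    rw [pow_succ, add_mul, one_mul]
    exact mul_mem ih hF

theorem prod_mem {κ : Type*} (s : Finset κ) {d : ℕ} {F : κ → Finset ι → R}
    (hF : ∀ j ∈ s, F j ∈ lowDegree R ι d) : ∏ j ∈ s, F j ∈ lowDegree R ι (#s * d) := by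
  classical
  induction s using Finset.induction_on with
  | empty => simpa using one_mem
  | insert a s ha ih =>
    rw [prod_insert ha, card_insert_of_notMem ha, add_mul, one_mul, add_comm]
    exact mul_mem (hF a (mem_insert_self a s)) (ih fun j hj => hF j (mem_insert_of_mem hj))

theorem sum_mem_one [Fintype ι] (w : ι → R) : (fun U => ∑ i ∈ U, w i) ∈ lowDegree R ι 1 := by
  have h : (fun U => ∑ i ∈ U, w i) =
      ∑ i, w i • (fun U : Finset ι => if {i} ⊆ U then (1 : R) else 0) := by
    ext U
    simp [Finset.sum_apply]
  rw [h]
  exact Submodule.sum_mem _ fun i _ => Submodule.smul_mem _ _ (indicator_mem _ (by simp))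

theorem choose_mem [Fintype ι] (n : ℕ) :
    (fun U => ((#U).choose n : R)) ∈ lowDegree R ι n := by
  have h : (fun U => ((#U).choose n : R)) =
      ∑ A ∈ powersetCard n univ, (fun U : Finset ι => if A ⊆ U then (1 : R) else 0) := by
    ext U
    rw [Finset.sum_apply, Finset.sum_boole, ← card_powersetCard]
    congr 2
    ext A
    simp [mem_powersetCard, and_comm]
  rw [h]
  exact Submodule.sum_mem _ fun A hA => indicator_mem _ (mem_powersetCard.1 hA).2.le

theorem alternating_sum_eq_zero {d : ℕ} {F : Finset ι → R} (hF : F ∈ lowDegree R ι d)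
    {T : Finset ι} (hT : d < #T) : ∑ U ∈ T.powerset, (-1) ^ #U * F U = 0 := by
  induction hF using Submodule.span_induction with
  | mem F hF =>
    obtain ⟨A, hA, rfl⟩ := hF
    obtain ⟨i, hiT, hiA⟩ := exists_mem_notMem_of_card_lt_card (hA.trans_lt hT)
    rw [← insert_erase hiT, sum_powerset_insert (notMem_erase i T), ← sum_add_distrib]
    refine sum_eq_zero fun U hU => ?_
    have hiU : i ∉ U := fun h => notMem_erase i T (mem_powerset.1 hU h)
    by_cases hAU : A ⊆ U <;>
      simp [card_insert_of_notMem hiU, subset_insert_iff_of_notMem hiA, pow_succ, hAU]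
  | zero => simp
  | add F G _ _ hF hG => simp [mul_add, sum_add_distrib, hF, hG]
  | smul c F _ hF => simp [mul_left_comm _ c, ← mul_sum, hF]

end lowDegree

section ZeroSum

variable {p : ℕ} [Fact p.Prime] {ι κ : Type*} [Fintype ι] [DecidableEq ι] [Fintype κ]

theorem one_sub_sum_pow_mem_lowDegree (w : ι → ZMod p) :
    (fun U => 1 - (∑ i ∈ U, w i) ^ (p - 1)) ∈ lowDegree (ZMod p) ι (p - 1) := by
  refine Submodule.sub_mem _ (lowDegree.mono (Nat.zero_le _) lowDegree.one_mem) ?_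
  simpa using! lowDegree.pow_mem (lowDegree.sum_mem_one w) (p - 1)

theorem one_sub_card_pow_mem_lowDegree :
    (fun U => 1 - (#U : ZMod p) ^ (p - 1)) ∈ lowDegree (ZMod p) ι (p - 1) := by
  simpa using one_sub_sum_pow_mem_lowDegree (p := p) (fun _ : ι => 1)

/-- A weighted form of Olson's theorem on zero-sum subsequences over `(ℤ/pℤ)^κ`. -/
theorem exists_zero_sum_of_lowDegree (v : ι → κ → ZMod p) {T : Finset ι} {d : ℕ}
    {w : Finset ι → ZMod p} (hw : w ∈ lowDegree (ZMod p) ι d) (hw0 : w ∅ ≠ 0)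
    (hT : d + Fintype.card κ * (p - 1) < #T) :
    ∃ U ⊆ T, U.Nonempty ∧ ∑ i ∈ U, v i = 0 ∧ w U ≠ 0 := by
  have hp : p - 1 ≠ 0 := Nat.sub_ne_zero_of_lt (Fact.out : p.Prime).one_lt
  have hmem := lowDegree.mul_mem hw (lowDegree.prod_mem univ
    fun (j : κ) _ => one_sub_sum_pow_mem_lowDegree fun i => v i j)
  have hsum := lowDegree.alternating_sum_eq_zero hmem hT
  by_contra! hU
  rw [sum_eq_single_of_mem ∅ (empty_mem_powerset T)] at hsum
  · simp [hp, hw0] at hsum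
  intro U hUT hne
  by_cases h0 : ∑ i ∈ U, v i = 0
  · simp [hU U (mem_powerset.1 hUT) (nonempty_iff_ne_empty.2 hne) h0]
  · obtain ⟨j, hj⟩ := Function.ne_iff.1 h0
    have : ∏ j, (1 - (∑ i ∈ U, v i j) ^ (p - 1)) = 0 := by
      refine prod_eq_zero (mem_univ j) ?_
      rw [Finset.sum_apply] at hj
      rw [ZMod.pow_card_sub_one_eq_one hj, sub_self]
    simp [Finset.prod_apply, this]

theorem dvd_of_one_sub_pow_ne_zero {n : ℕ} (h : 1 - (n : ZMod p) ^ (p - 1) ≠ 0) : p ∣ n := by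
  by_contra hn
  rw [← ZMod.natCast_eq_zero_iff] at hn
  exact h (by rw [ZMod.pow_card_sub_one_eq_one hn, sub_self])

theorem cast_choose_mul_prime (j : ℕ) : ((p * j).choose p : ZMod p) = j := by
  have hp : 0 < p := (Fact.out : p.Prime).pos
  have h := Choose.choose_modEq_choose_mod_mul_choose_div_nat (n := p * j) (k := p) (p := p)
  rw [← ZMod.natCast_eq_natCast_iff] at h
  simpa [Nat.div_self hp, Nat.mul_div_cancel_left j hp] using h

theorem exists_short_zero_sum_of_odd (hodd : Odd p) (v : ι → Fin 3 → ZMod p)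
    (hι : Fintype.card ι = 6 * p - 3) :
    ∃ U : Finset ι, U.Nonempty ∧ 2 * #U ≤ 3 * p - 1 ∧ ∑ i ∈ U, v i = 0 := by
  by_contra! hlong
  have hp := (Fact.out : p.Prime).two_le
  have long : ∀ U : Finset ι, U.Nonempty → ∑ i ∈ U, v i = 0 → 3 * p < 2 * #U := by
    intro U hU h0
    have := hlong U hU
    obtain ⟨m, hm⟩ := hodd
    by_contra! hle
    exact this (by omega) h0
  have compl : ∀ U V : Finset ι, U ⊆ V → ∑ i ∈ V, v i = 0 → ∑ i ∈ U, v i = 0 →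
      ∑ i ∈ V \ U, v i = 0 := by
    intro U V hUV hV hU
    rwa [← sum_sdiff hUV, hU, add_zero] at hV
  have no_three : ∀ V : Finset ι, ∑ i ∈ V, v i = 0 → #V ≠ p * 3 := by
    intro V hV hcard
    obtain ⟨x, hx⟩ : V.Nonempty := card_pos.1 (by omega)
    obtain ⟨U, hUV, hU, hU0, -⟩ := exists_zero_sum_of_lowDegree v (T := V.erase x)
      lowDegree.one_mem one_ne_zero (by simp only [card_erase_of_mem hx, Fintype.card_fin]; omega)
    have hUV' := hUV.trans (erase_subset x V)
    have h := long _ ⟨x, mem_sdiff.2 ⟨hx, fun h => notMem_erase x V (hUV h)⟩⟩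
      (compl U V hUV' hV hU0)
    have := long U hU hU0
    have := card_sdiff_add_card_eq_card hUV'
    omega
  have no_five : ∀ V : Finset ι, ∑ i ∈ V, v i = 0 → #V ≠ p * 5 := by
    intro V hV hcard
    obtain ⟨x, hx⟩ : V.Nonempty := card_pos.1 (by omega)
    obtain ⟨U, hUV, hU, hU0, hw⟩ := exists_zero_sum_of_lowDegree v (T := V.erase x)
      one_sub_card_pow_mem_lowDegree
      (by simp [Nat.sub_ne_zero_of_lt hp])
      (by simp only [card_erase_of_mem hx, Fintype.card_fin]; omega)
    obtain ⟨j, hj⟩ := dvd_of_one_sub_pow_ne_zero hw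
    have hUV' := hUV.trans (erase_subset x V)
    have h0 := compl U V hUV' hV hU0
    have h := long _ ⟨x, mem_sdiff.2 ⟨hx, fun h => notMem_erase x V (hUV h)⟩⟩ h0
    have := long U hU hU0
    have := no_three U hU0
    have := no_three _ h0
    have := card_sdiff_add_card_eq_card hUV'
    have hj5 : j < 5 := lt_of_mul_lt_mul_left (a := p) (by omega) (Nat.zero_le p)
    interval_cases j <;> omega
  have hmem : (fun U : Finset ι => (1 - (#U : ZMod p) ^ (p - 1)) *
      ((((#U).choose p : ZMod p) - 2) * (((#U).choose p : ZMod p) - 4))) ∈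
      lowDegree (ZMod p) ι (p - 1 + (p + p)) := by
    have hc (c : ZMod p) := Submodule.sub_mem _ (lowDegree.choose_mem (R := ZMod p) (ι := ι) p)
      (lowDegree.mono (Nat.zero_le p) (lowDegree.const_mem c))
    exact lowDegree.mul_mem one_sub_card_pow_mem_lowDegree (lowDegree.mul_mem (hc 2) (hc 4))
  have h8 : (2 * 4 : ZMod p) ≠ 0 := by
    have h2 : (2 : ZMod p) ≠ 0 := by
      intro h
      have := (ZMod.natCast_eq_zero_iff 2 p).1 (by exact_mod_cast h)
      have := Nat.le_of_dvd two_pos this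
      obtain ⟨m, hm⟩ := hodd
      omega
    convert pow_ne_zero 3 h2 using 1
    norm_num
  obtain ⟨U, -, hU, hU0, hw⟩ := exists_zero_sum_of_lowDegree v (T := univ) hmem
    (by simpa [Nat.sub_ne_zero_of_lt hp, Nat.choose_eq_zero_of_lt (show 0 < p by omega)] using h8)
    (by simp only [card_univ, hι, Fintype.card_fin]; omega)
  obtain ⟨j, hj⟩ := dvd_of_one_sub_pow_ne_zero (left_ne_zero_of_mul hw)
  have hw' := right_ne_zero_of_mul hw
  rw [hj, cast_choose_mul_prime] at hw'
  have := long U hU hU0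
  have := no_three U hU0
  have := no_five U hU0
  have := card_le_univ U
  have hj6 : j < 6 := lt_of_mul_lt_mul_left (a := p) (by omega) (Nat.zero_le p)
  interval_cases j
  · omega
  · omega
  · exact hw' (by simp)
  · omega
  · exact hw' (by simp)
  · omega

end ZeroSum

theorem exists_short_zero_sum_zmod_two {ι : Type*} [Fintype ι] [DecidableEq ι]
    (v : ι → Fin 3 → ZMod 2) (hι : Fintype.card ι = 9) :
    ∃ U : Finset ι, U.Nonempty ∧ 2 * #U ≤ 5 ∧ ∑ i ∈ U, v i = 0 := by
  obtain ⟨i, j, hij, h⟩ := Fintype.exists_ne_map_eq_of_card_lt v (by simp [hι])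
  refine ⟨{i, j}, insert_nonempty _ _, by simp [card_pair hij], ?_⟩
  rw [sum_pair hij, h]
  ext k
  exact CharTwo.add_self_eq_zero (v j k)

theorem short_zero_sum_zmod_p_pow_three (p : ℕ) (hp : p.Prime) :
    ∀ S : Multiset (Fin 3 → ZMod p), S.card = 6 * p - 3 →
      ∃ T : Multiset (Fin 3 → ZMod p),
        T ≤ S ∧ T ≠ 0 ∧ 2 * T.card ≤ 3 * p - 1 ∧ T.sum = 0 := by
  intro S hS
  obtain ⟨L, rfl⟩ := Quot.exists_rep S
  have hL : L.length = 6 * p - 3 := hS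
  obtain ⟨U, hU, hcard, h0⟩ : ∃ U : Finset (Fin L.length),
      U.Nonempty ∧ 2 * #U ≤ 3 * p - 1 ∧ ∑ i ∈ U, L.get i = 0 := by
    have := Fact.mk hp
    obtain rfl | hodd := hp.eq_two_or_odd'
    · exact exists_short_zero_sum_zmod_two L.get (by simp [hL])
    · exact exists_short_zero_sum_of_odd hodd L.get (by simp [hL])
  refine ⟨U.val.map L.get, ?_, ?_, by simpa using hcard, h0⟩
  · have hle := Multiset.map_le_map (f := L.get) (val_le_iff.2 (subset_univ U))
    rwa [Fin.univ_val_map, List.ofFn_get] at hle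
  · simpa using hU.ne_empty
end
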